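/- If a p-form field F on an n-dimensional Lorentzian spacetime is VSI₃, i.e., all scalar polynomial invariants constructed from F and its covariant derivatives up to third order vanish, then F is VSI: all scalar polynomial invariants of F of arbitrary order vanish. -/

import Mathlib

open scoped BigOperators

noncomputable section

namespace VSI

/-! ### Basic setup: tensor fields on an `n`-dimensional coordinate chart -/

/-- A point of an `n`-dimensional coordinate chart. -/
abbrev Pt (n : ℕ) := Fin n → ℝ

/-- A covariant tensor field of rank `k`, given by its components. -/
abbrev TensorField (n k : ℕ) := Pt n → (Fin k → Fin n) → ℝ

/-- A vector field, given by its components. -/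
abbrev VecField (n : ℕ) := Pt n → Fin n → ℝ

/-- A field of `n × n` matrices (e.g. a metric). -/
abbrev MetricField (n : ℕ) := Pt n → Matrix (Fin n) (Fin n) ℝ

/-- Partial derivative of a scalar function along the `a`-th coordinate. -/
def pd {n : ℕ} (f : Pt n → ℝ) (a : Fin n) (x : Pt n) : ℝ :=
  fderiv ℝ f x (Pi.single a 1)

/-- Partial derivative masked to the transverse directions (coordinates `≥ 2`). -/
def pdT {n : ℕ} (f : Pt n → ℝ) (a : Fin n) (x : Pt n) : ℝ :=
  if 2 ≤ (a : ℕ) then pd f a x else 0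

/-- A function on the chart is independent of the coordinate `r` (coordinate number 1). -/
def IndepOfR {n : ℕ} {α : Type*} (f : Pt n → α) : Prop :=
  ∀ x x' : Pt n, (∀ i : Fin n, (i : ℕ) ≠ 1 → x i = x' i) → f x = f x'

/-- A smooth symmetric metric of Lorentzian signature `(-,+,…,+)`. -/
def IsLorentzMetric {n : ℕ} (g : MetricField n) : Prop :=
  (∀ a b, ContDiff ℝ (⊤ : ℕ∞) fun x => g x a b) ∧ (∀ x, (g x).IsSymm) ∧
  (∀ x, ∃ P : Matrix (Fin n) (Fin n) ℝ, IsUnit P.det ∧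
    P.transpose * g x * P = Matrix.diagonal fun i : Fin n => if (i : ℕ) = 0 then (-1 : ℝ) else 1)

/-- Metric pairing of two vectors at a point. -/
def gdot {n : ℕ} (g : MetricField n) (x : Pt n) (X Y : Fin n → ℝ) : ℝ :=
  ∑ a, ∑ b, g x a b * X a * Y b

/-- Index lowering of a vector field. -/
def lower {n : ℕ} (g : MetricField n) (ℓ : VecField n) (x : Pt n) (a : Fin n) : ℝ :=
  ∑ b, g x a b * ℓ x b

/-- The 1-form (rank-1 covariant tensor field) associated with a vector field. -/
def lowerField {n : ℕ} (g : MetricField n) (ℓ : VecField n) : TensorField n 1 :=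
  fun x idx => lower g ℓ x (idx 0)

/-- Christoffel symbols `Γ^a_{bc}` of the Levi-Civita connection of `g`. -/
def christoffel {n : ℕ} (g : MetricField n) (x : Pt n) (a b c : Fin n) : ℝ :=
  (1/2) * ∑ d, (g x)⁻¹ a d *
    (pd (fun y => g y d c) b x + pd (fun y => g y b d) c x - pd (fun y => g y b c) d x)

/-- Covariant derivative of a covariant tensor field; the new (derivative) index is
the first index of the result. -/
def covD {n k : ℕ} (g : MetricField n) (T : TensorField n k) : TensorField n (k+1) :=
  fun x idx =>
    pd (fun y => T y fun m => idx m.succ) (idx 0) x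
    - ∑ m : Fin k, ∑ e : Fin n,
        christoffel g x e (idx 0) (idx m.succ) * T x (Function.update (fun m' => idx m'.succ) m e)

/-- Iterated covariant derivative. -/
def covDIter {n k : ℕ} (g : MetricField n) (T : TensorField n k) : (I : ℕ) → TensorField n (k + I)
  | 0 => T
  | I + 1 => covD g (covDIter g T I)

/-! ### Scalar polynomial invariants and tensor concomitants -/

/-- A scheme describing a polynomial concomitant of a rank-`k` tensor field: a full
metric contraction of a tensor product of covariant derivatives (of orders `ord j`)
of the field, with `r` free indices left over.  `m` is the number of contracted
index pairs; `slots` enumerates all index slots of the tensor product. -/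
structure ConcomScheme (k r : ℕ) where
  N : ℕ
  hN : 0 < N
  ord : Fin N → ℕ
  m : ℕ
  slots : ((Fin m × Bool) ⊕ Fin r) ≃ (Σ j : Fin N, Fin (k + ord j))

/-- The value of a concomitant scheme: all contracted index pairs are contracted with
the inverse metric. -/
def ConcomScheme.value {k r : ℕ} (S : ConcomScheme k r) {n : ℕ} (g : MetricField n)
    (T : TensorField n k) : TensorField n r := fun x free =>
  ∑ φ : Fin S.m × Bool → Fin n,
    (∏ i : Fin S.m, (g x)⁻¹ (φ (i, false)) (φ (i, true))) *
    ∏ j : Fin S.N, covDIter g T (S.ord j) x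
      (fun s => Sum.elim φ free (S.slots.symm ⟨j, s⟩))

/-- All scalar polynomial invariants constructed from `T` and its covariant
derivatives up to order `I` vanish. -/
def IsVSIUpTo {n k : ℕ} (g : MetricField n) (T : TensorField n k) (I : ℕ) : Prop :=
  ∀ S : ConcomScheme k 0, (∀ j, S.ord j ≤ I) → ∀ x v, S.value g T x v = 0

/-- All scalar polynomial invariants of arbitrary order vanish. -/
def IsVSI {n k : ℕ} (g : MetricField n) (T : TensorField n k) : Prop :=
  ∀ I : ℕ, IsVSIUpTo g T I

/-- All zeroth order scalar polynomial invariants of `T` vanish at the point `x`. -/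
def IsVSI0At {n k : ℕ} (g : MetricField n) (T : TensorField n k) (x : Pt n) : Prop :=
  ∀ S : ConcomScheme k 0, (∀ j, S.ord j = 0) → ∀ v, S.value g T x v = 0

/-- A rank-`r` tensor field `G` is (polynomially) constructed from `T`, its covariant
derivatives of arbitrary order and the metric. -/
def IsConstructedFrom {n k r : ℕ} (g : MetricField n) (T : TensorField n k)
    (G : TensorField n r) : Prop :=
  G ∈ Submodule.span ℝ {G' : TensorField n r | ∃ S : ConcomScheme k r, G' = S.value g T}

/-- A symmetric-2-tensor "correction" to the standard electromagnetic energy-momentum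
tensor: constructed from `T` and its covariant derivatives, where each monomial either
contains at least three factors of the field or at least one covariant derivative
(i.e. it comes from a non-Maxwellian term of a generalized electrodynamics). -/
def IsCorrectionTensor {n k : ℕ} (g : MetricField n) (T : TensorField n k)
    (Tc : TensorField n 2) : Prop :=
  Tc ∈ Submodule.span ℝ {G : TensorField n 2 |
    ∃ S : ConcomScheme k 2, (3 ≤ S.N ∨ ∃ j, 1 ≤ S.ord j) ∧ G = S.value g T}

/-! ### p-forms, type N, Lie derivative -/

def IsAlternating {n k : ℕ} (T : TensorField n k) : Prop :=
  ∀ (x : Pt n) (idx : Fin k → Fin n) (σ : Equiv.Perm (Fin k)),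
    T x (idx ∘ σ) = ((Equiv.Perm.sign σ : ℤ) : ℝ) * T x idx

def IsSmoothT {n k : ℕ} (T : TensorField n k) : Prop :=
  ∀ idx, ContDiff ℝ (⊤ : ℕ∞) fun x => T x idx

/-- A smooth differential form (totally antisymmetric covariant tensor field). -/
def IsFormField {n k : ℕ} (T : TensorField n k) : Prop :=
  IsSmoothT T ∧ IsAlternating T

def IsSmoothVec {n : ℕ} (ℓ : VecField n) : Prop :=
  ∀ a, ContDiff ℝ (⊤ : ℕ∞) fun x => ℓ x a

/-- A (nowhere vanishing, smooth) null vector field. -/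
def IsNullField {n : ℕ} (g : MetricField n) (ℓ : VecField n) : Prop :=
  IsSmoothVec ℓ ∧ (∀ x, ℓ x ≠ 0) ∧ ∀ x, gdot g x (ℓ x) (ℓ x) = 0

/-- `ℓ^a F_{a b₁ … b_{p-1}} = 0`. -/
def ContractsFirstZero {n p : ℕ} [NeZero p] (ℓ : VecField n) (F : TensorField n p) : Prop :=
  ∀ (x : Pt n) (v : Fin p → Fin n), (∑ a, ℓ x a * F x (Function.update v 0 a)) = 0

/-- `ℓ_{[a} F_{b₁ … b_p]} = 0`. -/
def WedgeWithZero {n p : ℕ} (g : MetricField n) (ℓ : VecField n) (F : TensorField n p) : Prop :=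
  ∀ (x : Pt n) (idx : Fin (p+1) → Fin n),
    (∑ σ : Equiv.Perm (Fin (p+1)), ((Equiv.Perm.sign σ : ℤ) : ℝ) *
      (lower g ℓ x (idx (σ 0)) * F x (fun m => idx (σ m.succ)))) = 0

/-- The `p`-form `F` is of type N with multiple null direction `ℓ`. -/
def IsTypeN {n p : ℕ} [NeZero p] (g : MetricField n) (F : TensorField n p)
    (ℓ : VecField n) : Prop :=
  IsNullField g ℓ ∧ ContractsFirstZero ℓ F ∧ WedgeWithZero g ℓ F

/-- Lie derivative of a covariant tensor field along a vector field. -/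
def lieD {n k : ℕ} (ℓ : VecField n) (T : TensorField n k) : TensorField n k :=
  fun x idx =>
    (∑ a, ℓ x a * pd (fun y => T y idx) a x)
    + ∑ m : Fin k, ∑ a, pd (fun y => ℓ y a) (idx m) x * T x (Function.update idx m a)

/-! ### Optical properties: geodesic, Kundt -/

/-- `∇_b ℓ_a` (first index is the derivative index). -/
def nablaLow {n : ℕ} (g : MetricField n) (ℓ : VecField n) (x : Pt n) (b a : Fin n) : ℝ :=
  covD g (lowerField g ℓ) x ![b, a]

/-- `ℓ` is geodesic: `ℓ^b ∇_b ℓ_a ∝ ℓ_a`. -/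
def IsGeodesicField {n : ℕ} (g : MetricField n) (ℓ : VecField n) : Prop :=
  ∀ x, ∃ c : ℝ, ∀ a, (∑ b, ℓ x b * nablaLow g ℓ x b a) = c * lower g ℓ x a

/-- `ℓ` is affinely parameterized: `ℓ^b ∇_b ℓ_a = 0`. -/
def IsAffinelyParam {n : ℕ} (g : MetricField n) (ℓ : VecField n) : Prop :=
  ∀ x a, (∑ b, ℓ x b * nablaLow g ℓ x b a) = 0

/-- `ℓ` is a Kundt null vector field: null, geodesic and with vanishing optical matrix
(expansion-free, shear-free and twist-free). -/
def IsKundt {n : ℕ} (g : MetricField n) (ℓ : VecField n) : Prop :=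
  IsNullField g ℓ ∧ IsGeodesicField g ℓ ∧
  ∀ (x : Pt n) (X Y : Fin n → ℝ), gdot g x X (ℓ x) = 0 → gdot g x Y (ℓ x) = 0 →
    (∑ a, ∑ b, X a * Y b * nablaLow g ℓ x b a) = 0

/-! ### Curvature -/

/-- Fully lowered Riemann tensor `R_{abcd}`. -/
def riemann {n : ℕ} (g : MetricField n) : TensorField n 4 := fun x idx =>
  ∑ e, g x (idx 0) e *
    (pd (fun y => christoffel g y e (idx 3) (idx 1)) (idx 2) x
     - pd (fun y => christoffel g y e (idx 2) (idx 1)) (idx 3) x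
     + ∑ f', (christoffel g x e (idx 2) f' * christoffel g x f' (idx 3) (idx 1)
            - christoffel g x e (idx 3) f' * christoffel g x f' (idx 2) (idx 1)))

def ricci {n : ℕ} (g : MetricField n) (x : Pt n) (b d : Fin n) : ℝ :=
  ∑ a, ∑ c, (g x)⁻¹ a c * riemann g x ![a, b, c, d]

def ricciScalar {n : ℕ} (g : MetricField n) (x : Pt n) : ℝ :=
  ∑ b, ∑ d, (g x)⁻¹ b d * ricci g x b d

def tracelessRicci {n : ℕ} (g : MetricField n) : TensorField n 2 := fun x idx =>
  ricci g x (idx 0) (idx 1) - ricciScalar g x / (n : ℝ) * g x (idx 0) (idx 1)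

/-- Weyl tensor `C_{abcd}` (for `n ≥ 3`). -/
def weyl {n : ℕ} (g : MetricField n) : TensorField n 4 := fun x idx =>
  riemann g x idx
  - (1 / ((n : ℝ) - 2)) *
      (g x (idx 0) (idx 2) * ricci g x (idx 3) (idx 1)
       - g x (idx 0) (idx 3) * ricci g x (idx 2) (idx 1)
       - g x (idx 1) (idx 2) * ricci g x (idx 3) (idx 0)
       + g x (idx 1) (idx 3) * ricci g x (idx 2) (idx 0))
  + (1 / (((n : ℝ) - 1) * ((n : ℝ) - 2))) * ricciScalar g x *
      (g x (idx 0) (idx 2) * g x (idx 3) (idx 1) - g x (idx 0) (idx 3) * g x (idx 2) (idx 1))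

/-! ### Null frames, boost weights, algebraic types -/

/-- A null frame at a point: two null vectors `e 0 = ℓ`, `e 1 = n` with `ℓ·n = 1`, and
orthonormal spacelike vectors `e i`, `i ≥ 2`, orthogonal to both. -/
structure NullFrameAt {n : ℕ} [NeZero n] (g : MetricField n) (x : Pt n) where
  e : Fin n → Fin n → ℝ
  h00 : gdot g x (e 0) (e 0) = 0
  h11 : gdot g x (e 1) (e 1) = 0
  h01 : gdot g x (e 0) (e 1) = 1
  h0i : ∀ i : Fin n, 2 ≤ (i : ℕ) → gdot g x (e 0) (e i) = 0
  h1i : ∀ i : Fin n, 2 ≤ (i : ℕ) → gdot g x (e 1) (e i) = 0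
  hij : ∀ i j : Fin n, 2 ≤ (i : ℕ) → 2 ≤ (j : ℕ) →
    gdot g x (e i) (e j) = (if i = j then 1 else 0)

/-- Boost weight of a frame multi-index: `+1` for each contraction with `ℓ = e 0`,
`-1` for each contraction with `n = e 1`. -/
def bw {n k : ℕ} (a : Fin k → Fin n) : ℤ :=
  ((Finset.univ.filter fun m => (a m : ℕ) = 0).card : ℤ)
  - ((Finset.univ.filter fun m => (a m : ℕ) = 1).card : ℤ)

/-- Frame components of a covariant tensor. -/
def frameComp {n k : ℕ} (T : TensorField n k) (e : Fin n → Fin n → ℝ) (x : Pt n)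
    (a : Fin k → Fin n) : ℝ :=
  ∑ idx : Fin k → Fin n, T x idx * ∏ m, e (a m) (idx m)

/-- The tensor field `T` has boost order at most `b` with respect to the null
direction `ℓ`: in any null frame containing `ℓ`, all frame components of boost
weight `> b` vanish.  `b = 0` is the aligned type II condition, `b = -1` type III. -/
def BoostOrderLE {n k : ℕ} [NeZero n] (g : MetricField n) (ℓ : VecField n)
    (T : TensorField n k) (b : ℤ) : Prop :=
  ∀ (x : Pt n) (fr : NullFrameAt g x), fr.e 0 = ℓ x →
    ∀ a : Fin k → Fin n, b < bw a → frameComp T fr.e x a = 0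

/-- `g` is a degenerate Kundt metric with Kundt null direction `ℓ`: `ℓ` is Kundt and
the Riemann tensor together with its covariant derivatives of all orders is of aligned
type II with respect to `ℓ`. -/
def IsDegenerateKundt {n : ℕ} [NeZero n] (g : MetricField n) (ℓ : VecField n) : Prop :=
  IsKundt g ℓ ∧ ∀ I : ℕ, BoostOrderLE g ℓ (covDIter g (riemann g) I) 0

/-! ### Exterior derivative, Hodge dual, Maxwell equations -/

/-- Exterior derivative (components, no normalization factor). -/
def extD {n k : ℕ} (F : TensorField n k) : TensorField n (k+1) := fun x idx =>
  ∑ m : Fin (k+1), (-1 : ℝ) ^ (m : ℕ) *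
    pd (fun y => F y fun i => idx (m.succAbove i)) (idx m) x

/-- Sign of a self-map of `Fin k` (0 if not bijective). -/
def permSign {k : ℕ} (f : Fin k → Fin k) : ℤ :=
  if h : Function.Bijective f then Equiv.Perm.sign (Equiv.ofBijective f h) else 0

/-- Raise all indices of a covariant tensor with the inverse metric. -/
def raiseAll {n k : ℕ} (g : MetricField n) (T : TensorField n k) : TensorField n k :=
  fun x idx => ∑ jdx : Fin k → Fin n, (∏ m, (g x)⁻¹ (idx m) (jdx m)) * T x jdx

/-- Hodge dual of a `p`-form (`p + q = n`), via the metric volume element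
`√|det g| ε_{a₁…aₙ}`. -/
def hodge {n p q : ℕ} (h : p + q = n) (g : MetricField n) (F : TensorField n p) :
    TensorField n q := fun x idx =>
  (1 / (Nat.factorial p : ℝ)) *
    ∑ a : Fin p → Fin n, raiseAll g F x a *
      (Real.sqrt |(g x).det| *
        ((permSign fun i => Fin.append a idx (Fin.cast h.symm i) : ℤ) : ℝ))

/-- Source-free Maxwell equations `dF = 0 = d*F` for a `p`-form (`p + q = n`). -/
def MaxwellEqs {n p q : ℕ} (h : p + q = n) (g : MetricField n) (F : TensorField n p) : Prop :=
  (∀ x idx, extD F x idx = 0) ∧ (∀ x idx, extD (hodge h g F) x idx = 0)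

/-! ### Wedge products -/

def wedgeP {n a b : ℕ} (F : TensorField n a) (G : TensorField n b) : TensorField n (a+b) :=
  fun x idx => ∑ σ : Equiv.Perm (Fin (a+b)), ((Equiv.Perm.sign σ : ℤ) : ℝ) *
    (F x fun i => idx (σ (Fin.castAdd b i))) * (G x fun j => idx (σ (Fin.natAdd a j)))

def wedgePow {n p : ℕ} (F : TensorField n p) : (k : ℕ) → TensorField n (p * k)
  | 0 => fun _ _ => 1
  | k + 1 => wedgeP (wedgePow F k) F

def castT {n a b : ℕ} (h : a = b) (T : TensorField n a) : TensorField n b :=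
  fun x idx => T x fun i => idx (Fin.cast h i)

/-! ### Degenerate Kundt metrics in adapted coordinates -/

/-- The Kundt metric `ds² = 2 du (dr + H du + W_α dx^α) + g_{αβ} dx^α dx^β` in
coordinates `(u, r, x^α) = (x⁰, x¹, x^{α≥2})`. -/
def kundtMetric {n : ℕ} (H : Pt n → ℝ) (W : Pt n → Fin n → ℝ) (hT : MetricField n) :
    MetricField n := fun x => Matrix.of fun a b =>
  if (a : ℕ) = 0 ∧ (b : ℕ) = 0 then 2 * H x
  else if ((a : ℕ) = 0 ∧ (b : ℕ) = 1) ∨ ((a : ℕ) = 1 ∧ (b : ℕ) = 0) then 1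
  else if (a : ℕ) = 0 then W x b
  else if (b : ℕ) = 0 then W x a
  else if (a : ℕ) = 1 ∨ (b : ℕ) = 1 then 0
  else hT x a b

/-- A transverse (Riemannian) metric `g_{αβ}(u,x)`, stored as an `n×n` matrix padded
by the identity on the coordinates `u, r`. -/
def IsTransverseMetric {n : ℕ} (hT : MetricField n) : Prop :=
  (∀ (x : Pt n) (a b : Fin n), ((a : ℕ) < 2 ∨ (b : ℕ) < 2) → hT x a b = (if a = b then 1 else 0)) ∧
  (∀ x, (hT x).IsSymm) ∧ (∀ a b, ContDiff ℝ (⊤ : ℕ∞) fun x => hT x a b) ∧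
  IndepOfR hT ∧ (∀ x, (hT x).PosDef)

/-- Data of a degenerate Kundt metric: `W_α = r W¹_α + W⁰_α`,
`H = r² H² + r H¹ + H⁰`, transverse metric `hT`. -/
structure DegKundtData (n : ℕ) where
  H2 : Pt n → ℝ
  H1 : Pt n → ℝ
  H0 : Pt n → ℝ
  W1 : Pt n → Fin n → ℝ
  W0 : Pt n → Fin n → ℝ
  hT : MetricField n

def DegKundtData.Hfun {n : ℕ} [NeZero n] (D : DegKundtData n) : Pt n → ℝ :=
  fun z => (z 1)^2 * D.H2 z + z 1 * D.H1 z + D.H0 z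

def DegKundtData.Wfun {n : ℕ} [NeZero n] (D : DegKundtData n) : Pt n → Fin n → ℝ :=
  fun z b => z 1 * D.W1 z b + D.W0 z b

/-- The degenerate Kundt metric built from the data. -/
def DegKundtData.metric {n : ℕ} [NeZero n] (D : DegKundtData n) : MetricField n :=
  kundtMetric D.Hfun D.Wfun D.hT

/-- Regularity and shape conditions on the degenerate Kundt data: the metric functions
depend only on `(u, x^α)` and are smooth, `W`'s are transverse. -/
def DegKundtData.Regular {n : ℕ} (D : DegKundtData n) : Prop :=
  IsTransverseMetric D.hT ∧
  IndepOfR D.H2 ∧ IndepOfR D.H1 ∧ IndepOfR D.H0 ∧ IndepOfR D.W1 ∧ IndepOfR D.W0 ∧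
  ContDiff ℝ (⊤ : ℕ∞) D.H2 ∧ ContDiff ℝ (⊤ : ℕ∞) D.H1 ∧ ContDiff ℝ (⊤ : ℕ∞) D.H0 ∧
  (∀ a, ContDiff ℝ (⊤ : ℕ∞) fun x => D.W1 x a) ∧ (∀ a, ContDiff ℝ (⊤ : ℕ∞) fun x => D.W0 x a) ∧
  (∀ (x : Pt n) (a : Fin n), (a : ℕ) < 2 → D.W1 x a = 0) ∧ (∀ (x : Pt n) (a : Fin n), (a : ℕ) < 2 → D.W0 x a = 0)

/-- The `(q+1)`-form `du ∧ f` built from a transverse `q`-form `f`. -/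
def duWedge {n q : ℕ} (f : TensorField n q) : TensorField n (q+1) := fun x idx =>
  ∑ m : Fin (q+1), (-1 : ℝ) ^ (m : ℕ) * (if (idx m : ℕ) = 0 then 1 else 0) *
    f x (fun i => idx (m.succAbove i))

/-- `f_{[α₂…α_p , α₁]} = 0`: `f` is closed in the transverse geometry. -/
def TransClosed {n q : ℕ} (f : TensorField n q) : Prop :=
  ∀ (x : Pt n) (v : Fin (q+1) → Fin n), (∀ i, 2 ≤ (v i : ℕ)) →
    (∑ m : Fin (q+1), (-1 : ℝ) ^ (m : ℕ) *
      pd (fun y => f y fun i => v (m.succAbove i)) (v m) x) = 0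

/-- `(√g̃ f^{β α₁…α_{p-2}})_{,β} = 0`: `f` is co-closed in the transverse geometry. -/
def TransCoclosed {n q : ℕ} [NeZero q] (hT : MetricField n) (f : TensorField n q) : Prop :=
  ∀ (x : Pt n) (v : Fin q → Fin n),
    (∑ b : Fin n, pd (fun y =>
      Real.sqrt (hT y).det * raiseAll hT f y (Function.update v 0 b)) b x) = 0

/-! ### Transverse curvature -/

def christoffelT {n : ℕ} (h : MetricField n) (x : Pt n) (a b c : Fin n) : ℝ :=
  (1/2) * ∑ d, (h x)⁻¹ a d *
    (pdT (fun y => h y d c) b x + pdT (fun y => h y b d) c x - pdT (fun y => h y b c) d x)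

def covDT {n k : ℕ} (h : MetricField n) (T : TensorField n k) : TensorField n (k+1) :=
  fun x idx =>
    pdT (fun y => T y fun m => idx m.succ) (idx 0) x
    - ∑ m : Fin k, ∑ e : Fin n,
        christoffelT h x e (idx 0) (idx m.succ) * T x (Function.update (fun m' => idx m'.succ) m e)

def riemannT {n : ℕ} (h : MetricField n) : TensorField n 4 := fun x idx =>
  ∑ e, h x (idx 0) e *
    (pdT (fun y => christoffelT h y e (idx 3) (idx 1)) (idx 2) x
     - pdT (fun y => christoffelT h y e (idx 2) (idx 1)) (idx 3) x
     + ∑ f', (christoffelT h x e (idx 2) f' * christoffelT h x f' (idx 3) (idx 1)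
            - christoffelT h x e (idx 3) f' * christoffelT h x f' (idx 2) (idx 1)))

def ricciT {n : ℕ} (h : MetricField n) (x : Pt n) (b d : Fin n) : ℝ :=
  ∑ a, ∑ c, (h x)⁻¹ a c * riemannT h x ![a, b, c, d]

def ricciScalarT {n : ℕ} (h : MetricField n) (x : Pt n) : ℝ :=
  ∑ b, ∑ d, (h x)⁻¹ b d * ricciT h x b d

/-- A covector field as a rank-1 tensor field. -/
def oneForm {n : ℕ} (W : Pt n → Fin n → ℝ) : TensorField n 1 := fun x idx => W x (idx 0)

/-- Transverse covariant derivative `∇̃_b V_a` (`= V_{a||b}`). -/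
def nablaT {n : ℕ} (h : MetricField n) (V : TensorField n 1) (x : Pt n) (b a : Fin n) : ℝ :=
  covDT h V x ![b, a]

/-- Second transverse covariant derivative `∇̃_c ∇̃_b V_a`. -/
def nablaT2 {n : ℕ} (h : MetricField n) (V : TensorField n 1) (x : Pt n) (c b a : Fin n) : ℝ :=
  covDT h (covDT h V) x ![c, b, a]

/-- Transverse divergence `V^{α}{}_{||α}`. -/
def divT {n : ℕ} (h : MetricField n) (V : TensorField n 1) (x : Pt n) : ℝ :=
  ∑ b, ∑ c, (h x)⁻¹ b c * nablaT h V x b c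

def gradT {n : ℕ} (f : Pt n → ℝ) : TensorField n 1 := fun x idx => pdT f (idx 0) x

/-- Transverse Laplacian. -/
def laplaceT {n : ℕ} (h : MetricField n) (f : Pt n → ℝ) (x : Pt n) : ℝ :=
  ∑ a, ∑ b, (h x)⁻¹ a b * covDT h (gradT f) x ![a, b]

def lnSqrtDet {n : ℕ} (h : MetricField n) (y : Pt n) : ℝ :=
  Real.log (Real.sqrt (h y).det)

/-! ### Electromagnetic energy-momentum tensor -/

/-- Standard energy-momentum tensor of a `(q+1)`-form Maxwell field:
`T_{ab} = (1/q!) (F_{a c⃗} F_b{}^{c⃗} - (1/(2(q+1))) g_{ab} F_{c⃗}F^{c⃗})`. -/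
def emTensor {n q : ℕ} (g : MetricField n) (F : TensorField n (q+1)) (x : Pt n)
    (a b : Fin n) : ℝ :=
  (1 / (Nat.factorial q : ℝ)) *
    ((∑ v : Fin q → Fin n, F x (Fin.cons a v) *
        ∑ w : Fin q → Fin n, (∏ i, (g x)⁻¹ (v i) (w i)) * F x (Fin.cons b w))
     - (1 / (2 * ((q : ℝ) + 1))) * g x a b *
        ∑ v : Fin (q+1) → Fin n, F x v * raiseAll g F x v)

/-! ### Coordinate transformations (for adapted coordinates) -/

/-- Jacobian `∂ψ^a/∂y^b` of a coordinate change. -/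
def jac {n : ℕ} (ψ : Pt n → Pt n) (y : Pt n) (a b : Fin n) : ℝ :=
  pd (fun z => ψ z a) b y

/-- Pullback of the metric along the coordinate change `ψ` (from new to old coords). -/
def pullMetric {n : ℕ} (g : MetricField n) (ψ : Pt n → Pt n) : MetricField n :=
  fun y => Matrix.of fun μ ν => ∑ a, ∑ b, jac ψ y a μ * jac ψ y b ν * g (ψ y) a b

/-- Pullback of a covariant tensor field along `ψ`. -/
def pullForm {n p : ℕ} (F : TensorField n p) (ψ : Pt n → Pt n) : TensorField n p :=
  fun y idx => ∑ jdx : Fin p → Fin n, (∏ m, jac ψ y (jdx m) (idx m)) * F (ψ y) jdx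

/-! ### Parallelly transported adapted frames -/

/-- A null frame field containing `ℓ`, parallelly transported along `ℓ` and adapted
(`M^i_{jk} = 0`). -/
structure AdaptedPTFrame {n : ℕ} [NeZero n] (g : MetricField n) (ℓ : VecField n) where
  fr : ∀ x : Pt n, NullFrameAt g x
  aligned : ∀ x, (fr x).e 0 = ℓ x
  parallel : ∀ (x : Pt n) (a c : Fin n),
    (∑ b, ℓ x b * (pd (fun y => (fr y).e a c) b x
      + ∑ d, christoffel g x c b d * (fr x).e a d)) = 0
  adapted : ∀ (x : Pt n) (i j k : Fin n), 2 ≤ (i : ℕ) → 2 ≤ (j : ℕ) → 2 ≤ (k : ℕ) →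
    (∑ a, ∑ b, covD g (lowerField g fun z => (fr z).e j) x ![b, a]
      * (fr x).e i a * (fr x).e k b) = 0

/-! ### Explicit Petrov type III solutions -/

/-- The type III vacuum metric of Petrov,
`ds² = 2 du (dr + ½(xr − x eˣ) du) + eˣ(dx² + e^{2u} dy²)`, in coordinates
`(u,r,x,y)`. -/
def petrovG : MetricField 4 := fun z => Matrix.of fun a b =>
  if a = 0 ∧ b = 0 then z 2 * z 1 - z 2 * Real.exp (z 2)
  else if (a = 0 ∧ b = 1) ∨ (a = 1 ∧ b = 0) then 1
  else if a = 2 ∧ b = 2 then Real.exp (z 2)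
  else if a = 3 ∧ b = 3 then Real.exp (z 2 + 2 * z 0)
  else 0

/-- The same metric with the electromagnetic backreaction term
`−2κ₀ eˣ c(u)²` included in `2H`. -/
def petrovEM (κ₀ : ℝ) (c : ℝ → ℝ) : MetricField 4 := fun z => Matrix.of fun a b =>
  if a = 0 ∧ b = 0 then z 2 * z 1 - z 2 * Real.exp (z 2) - 2 * κ₀ * Real.exp (z 2) * (c (z 0))^2
  else if (a = 0 ∧ b = 1) ∨ (a = 1 ∧ b = 0) then 1
  else if a = 2 ∧ b = 2 then Real.exp (z 2)
  else if a = 3 ∧ b = 3 then Real.exp (z 2 + 2 * z 0)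
  else 0

/-- The null direction `ℓ = ∂_r`. -/
def ellR : VecField 4 := fun _ a => if a = 1 then 1 else 0

/-- The transverse covector of the VSI Maxwell field (4). -/
def petrovA (c : ℝ → ℝ) (z : Pt 4) : Fin 4 → ℝ := fun a =>
  if a = 2 then -(Real.exp (z 2 / 2) * c (z 0) * Real.cos (z 3 * Real.exp (z 0) / 2))
  else if a = 3 then Real.exp (z 2 / 2) * c (z 0) * Real.exp (z 0) * Real.sin (z 3 * Real.exp (z 0) / 2)
  else 0

/-- The Maxwell 2-form
`F = e^{x/2} c(u) du ∧ (−cos(y eᵘ/2) dx + eᵘ sin(y eᵘ/2) dy)`. -/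
def petrovF (c : ℝ → ℝ) : TensorField 4 2 := fun z idx =>
  (if idx 0 = 0 then petrovA c z (idx 1) else 0)
  - (if idx 1 = 0 then petrovA c z (idx 0) else 0)


set_option linter.unusedSectionVars false
set_option linter.unusedSimpArgs false
section calc1
variable {A : Type*} [CommRing A] [Algebra ℝ A] {n : ℕ}

abbrev Vec (n : ℕ) (A : Type*) := Fin n → A
abbrev Ten (n : ℕ) (A : Type*) (k : ℕ) := (Fin k → Fin n) → A

def bs (a : Fin n) : Vec n A := Pi.single a 1

def sl {k : ℕ} (S : Ten n A (k+1)) (x : Vec n A) : Ten n A k :=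
  fun idx => ∑ a, x a * S (Fin.cons a idx)

lemma sl_bs {k : ℕ} (S : Ten n A (k+1)) (a : Fin n) : sl S (bs a) = fun idx => S (Fin.cons a idx) := by
  funext idx
  simp [sl, bs, Pi.single_apply]

lemma ten_ext {k : ℕ} {S S' : Ten n A (k+1)} (h : ∀ x, sl S x = sl S' x) : S = S' := by
  funext idx
  have := congrFun (h (bs (idx 0))) (fun m => idx m.succ)
  rw [sl_bs, sl_bs] at this
  have e : (Fin.cons (idx 0) (fun m => idx m.succ) : Fin (k+1) → Fin n) = idx := Fin.cons_self_tail idx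
  simpa only [e] using this

lemma sl_add_left {k : ℕ} (S S' : Ten n A (k+1)) (x : Vec n A) : sl (S + S') x = sl S x + sl S' x := by
  funext idx; simp [sl, mul_add, Finset.sum_add_distrib]
lemma sl_sub_left {k : ℕ} (S S' : Ten n A (k+1)) (x : Vec n A) : sl (S - S') x = sl S x - sl S' x := by
  funext idx; simp [sl, mul_sub, Finset.sum_sub_distrib]
lemma sl_neg_left {k : ℕ} (S : Ten n A (k+1)) (x : Vec n A) : sl (-S) x = - sl S x := by
  funext idx; simp [sl]
lemma sl_smul_left {k : ℕ} (f : A) (S : Ten n A (k+1)) (x : Vec n A) : sl (f • S) x = f • sl S x := by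
  funext idx; simp [sl, Finset.mul_sum]; refine Finset.sum_congr rfl fun _ _ => by ring
lemma sl_zero_left {k : ℕ} (x : Vec n A) : sl (0 : Ten n A (k+1)) x = 0 := by
  funext idx; simp [sl]
lemma sl_add {k : ℕ} (S : Ten n A (k+1)) (x y : Vec n A) : sl S (x + y) = sl S x + sl S y := by
  funext idx; simp [sl, add_mul, Finset.sum_add_distrib]
lemma sl_sub {k : ℕ} (S : Ten n A (k+1)) (x y : Vec n A) : sl S (x - y) = sl S x - sl S y := by
  funext idx; simp [sl, sub_mul, Finset.sum_sub_distrib]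
lemma sl_neg {k : ℕ} (S : Ten n A (k+1)) (x : Vec n A) : sl S (-x) = - sl S x := by
  funext idx; simp [sl]
lemma sl_smul {k : ℕ} (S : Ten n A (k+1)) (f : A) (x : Vec n A) : sl S (f • x) = f • sl S x := by
  funext idx; simp [sl, Finset.mul_sum, mul_assoc]
lemma sl_zero {k : ℕ} (S : Ten n A (k+1)) : sl S 0 = 0 := by
  funext idx; simp [sl]

lemma vec_eq_sum (x : Vec n A) : x = ∑ a, x a • (bs a : Vec n A) := by
  funext e; simp [bs, Finset.sum_apply, Pi.single_apply]

structure Op (n : ℕ) (A : Type*) [CommRing A] [Algebra ℝ A] where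
  d : Derivation ℝ A A
  D : Vec n A → Vec n A
  D_add : ∀ x y, D (x + y) = D x + D y
  D_smul : ∀ (f : A) x, D (f • x) = f • D x + d f • x

lemma Op.D_zero (O : Op n A) : O.D 0 = 0 := by
  have := O.D_add 0 0
  simpa using this

lemma Op.D_sum (O : Op n A) {ι : Type*} (s : Finset ι) (f : ι → Vec n A) :
    O.D (∑ i ∈ s, f i) = ∑ i ∈ s, O.D (f i) := by
  classical
  induction s using Finset.induction_on with
  | empty => simp [O.D_zero]
  | insert i s hi ih => rw [Finset.sum_insert hi, Finset.sum_insert hi, O.D_add, ih]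

def act (O : Op n A) {k : ℕ} (S : Ten n A k) : Ten n A k :=
  fun idx => O.d (S idx) - ∑ m, ∑ e, O.D (bs (idx m)) e * S (Function.update idx m e)

lemma Op.D_expand (O : Op n A) (x : Vec n A) (e : Fin n) :
    O.D x e = O.d (x e) + ∑ a, x a * O.D (bs a) e := by
  conv_lhs => rw [vec_eq_sum x]
  rw [O.D_sum, Finset.sum_apply]
  simp only [O.D_smul, Pi.add_apply, Pi.smul_apply, smul_eq_mul, Finset.sum_add_distrib]
  rw [add_comm]
  congr 1
  simp [bs, Pi.single_apply]

lemma act_add (O : Op n A) {k : ℕ} (S S' : Ten n A k) : act O (S + S') = act O S + act O S' := by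
  funext idx
  simp only [act, Pi.add_apply, map_add, mul_add, Finset.sum_add_distrib]; ring

lemma act_zero (O : Op n A) {k : ℕ} : act O (0 : Ten n A k) = 0 := by
  funext idx
  simp [act]

lemma act_neg (O : Op n A) {k : ℕ} (S : Ten n A k) : act O (-S) = - act O S := by
  have := act_add O S (-S)
  rw [add_neg_cancel, act_zero] at this
  exact (neg_eq_of_add_eq_zero_right this.symm).symm

lemma act_sub (O : Op n A) {k : ℕ} (S S' : Ten n A k) : act O (S - S') = act O S - act O S' := by
  rw [sub_eq_add_neg, act_add, act_neg, ← sub_eq_add_neg]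

lemma act_smul (O : Op n A) {k : ℕ} (f : A) (S : Ten n A k) :
    act O (f • S) = f • act O S + O.d f • S := by
  funext idx
  simp only [act, Pi.smul_apply, Pi.add_apply, smul_eq_mul, Derivation.leibniz, mul_sub, Finset.mul_sum]
  have : ∀ m e, O.D (bs (idx m)) e * (f * S (Function.update idx m e))
    = f * (O.D (bs (idx m)) e * S (Function.update idx m e)) := fun m e => by ring
  simp only [this]; ring

lemma act_Ten0 (O : Op n A) (S : Ten n A 0) (idx) : act O S idx = O.d (S idx) := by
  simp [act]

lemma sl_act (O : Op n A) {k : ℕ} (S : Ten n A (k+1)) (x : Vec n A) :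
    sl (act O S) x = act O (sl S x) - sl S (O.D x) := by
  funext idx
  simp only [sl, act, Pi.sub_apply]
  simp only [Fin.sum_univ_succ, Fin.cons_zero, Fin.cons_succ, Fin.update_cons_zero, ← Fin.cons_update]
  simp only [O.D_expand x, map_sum, Derivation.leibniz, smul_eq_mul, mul_sub, mul_add, add_mul,
    Finset.sum_add_distrib, Finset.sum_sub_distrib, Finset.mul_sum, Finset.sum_mul]
  have e1 : ∑ a, ∑ m : Fin k, ∑ e, x a * (O.D (bs (idx m)) e * S (Fin.cons a (Function.update idx m e)))
      = ∑ m : Fin k, ∑ e, ∑ a, O.D (bs (idx m)) e * (x a * S (Fin.cons a (Function.update idx m e))) := by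
    rw [Finset.sum_comm]
    refine Finset.sum_congr rfl fun m _ => ?_
    rw [Finset.sum_comm]
    refine Finset.sum_congr rfl fun e _ => Finset.sum_congr rfl fun a _ => by ring
  have e2 : ∑ a, ∑ e, x a * (O.D (bs a) e * S (Fin.cons e idx))
      = ∑ e, ∑ a, x a * O.D (bs a) e * S (Fin.cons e idx) := by
    rw [Finset.sum_comm]
    refine Finset.sum_congr rfl fun e _ => Finset.sum_congr rfl fun a _ => by ring
  have e3 : ∑ a, S (Fin.cons a idx) * O.d (x a) = ∑ a, O.d (x a) * S (Fin.cons a idx) :=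
    Finset.sum_congr rfl fun a _ => by ring
  rw [e1, e2, e3]
  ring

/-- commutator -/
lemma act_comm (O1 O2 O3 O4 : Op n A)
    (hd : ∀ f, O3.d f = O1.d (O2.d f) - O2.d (O1.d f) - O4.d f)
    (hD : ∀ x, O3.D x = O1.D (O2.D x) - O2.D (O1.D x) - O4.D x) :
    ∀ {k : ℕ} (S : Ten n A k), act O1 (act O2 S) - act O2 (act O1 S) - act O4 S = act O3 S := by
  intro k
  induction k with
  | zero => intro S; funext idx; simp only [Pi.sub_apply, act_Ten0, hd]
  | succ k ih =>
    intro S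
    apply ten_ext
    intro x
    simp only [sl_sub_left, sl_act, act_sub, hD, sl_sub, ← ih]
    abel

lemma act_lin (O1 O2 O3 : Op n A) (f : A)
    (hd : ∀ u, O3.d u = f * O1.d u + O2.d u)
    (hD : ∀ x, O3.D x = f • O1.D x + O2.D x) {k : ℕ} (S : Ten n A k) :
    act O3 S = f • act O1 S + act O2 S := by
  funext idx
  simp only [act, hd, hD, Pi.add_apply, Pi.smul_apply, smul_eq_mul, add_mul, Finset.sum_add_distrib,
    mul_sub, Finset.mul_sum, mul_assoc]
  ring

/-- endomorphism as an operator -/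
def endo (E : Vec n A →ₗ[A] Vec n A) : Op n A where
  d := 0
  D := E
  D_add := E.map_add
  D_smul := fun f x => by simp

lemma act_endo_smul (E : Vec n A →ₗ[A] Vec n A) {k : ℕ} (f : A) (S : Ten n A k) :
    act (endo E) (f • S) = f • act (endo E) S := by
  rw [act_smul]; simp [endo]

/-! boost order -/
variable (Φ : ℤ → Submodule A (Vec n A))

def BO : ∀ {k : ℕ}, Ten n A k → ℤ → Prop
  | 0, S, s => s < 0 → S = 0
  | _+1, S, s => ∀ w x, x ∈ Φ w → BO (sl S x) (s - w)

variable {Φ}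
lemma BO.mono : ∀ {k : ℕ} {S : Ten n A k} {s s' : ℤ}, BO Φ S s → s ≤ s' → BO Φ S s'
  | 0, _, _, _, h, hs => fun h' => h (by omega)
  | _+1, _, _, _, h, hs => fun w x hx => BO.mono (h w x hx) (by omega)
lemma BO.zero : ∀ {k : ℕ} (s : ℤ), BO Φ (0 : Ten n A k) s
  | 0, _ => fun _ => rfl
  | _+1, s => fun w x _ => by rw [sl_zero_left]; exact BO.zero _
lemma BO.add : ∀ {k : ℕ} {S S' : Ten n A k} {s : ℤ}, BO Φ S s → BO Φ S' s → BO Φ (S + S') s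
  | 0, _, _, _, h, h2 => fun h' => by rw [h h', h2 h', add_zero]
  | _+1, _, _, _, h, h2 => fun w x hx => by rw [sl_add_left]; exact BO.add (h w x hx) (h2 w x hx)
lemma BO.smul : ∀ {k : ℕ} {S : Ten n A k} {s : ℤ} (f : A), BO Φ S s → BO Φ (f • S) s
  | 0, _, _, f, h => fun h' => by rw [h h', smul_zero]
  | _+1, _, _, f, h => fun w x hx => by rw [sl_smul_left]; exact BO.smul f (h w x hx)
lemma BO.neg {k : ℕ} {S : Ten n A k} {s : ℤ} (h : BO Φ S s) : BO Φ (-S) s := by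
  have := h.smul (-1 : A)
  simpa using this
lemma BO.sub {k : ℕ} {S S' : Ten n A k} {s : ℤ} (h : BO Φ S s) (h2 : BO Φ S' s) : BO Φ (S - S') s := by
  rw [sub_eq_add_neg]; exact h.add h2.neg
lemma BO.sl {k : ℕ} {S : Ten n A (k+1)} {s w : ℤ} {x : Vec n A} (h : BO Φ S s) (hx : x ∈ Φ w) :
    BO Φ (sl S x) (s - w) := h w x hx
lemma BO.sl' {k : ℕ} {S : Ten n A (k+1)} {s w s' : ℤ} {x : Vec n A} (h : BO Φ S s) (hx : x ∈ Φ w)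
    (hs : s - w ≤ s') : BO Φ (VSI.sl S x) s' := (h w x hx).mono hs

lemma BO.act (O : Op n A) (d : ℤ) (hD : ∀ w x, x ∈ Φ w → O.D x ∈ Φ (w - d)) (hd : 0 ≤ d ∨ O.d = 0) :
    ∀ {k : ℕ} {S : Ten n A k} {s : ℤ}, BO Φ S s → BO Φ (act O S) (s + d)
  | 0, S, s, h => fun h' => by
      rcases hd with hd | hd
      · rw [h (by omega), act_zero]
      · funext idx; rw [act_Ten0, hd]; simp
  | _+1, S, s, h => fun w x hx => by
      rw [sl_act]
      refine BO.sub ?_ ?_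
      · exact (BO.act O d hD hd (h w x hx)).mono (by omega)
      · exact (h _ _ (hD w x hx)).mono (by omega)

end calc1

set_option linter.unusedSectionVars false
set_option linter.unusedSimpArgs false
section geo1
variable {A : Type*} [CommRing A] [Algebra ℝ A] {n : ℕ}

lemma two_cancel {a : A} (h : a + a = 0) : a = 0 := by
  have : (2 : ℝ)⁻¹ • (a + a) = 0 := by rw [h, smul_zero]
  rw [← two_smul ℝ a, smul_smul] at this
  norm_num at this
  exact this

lemma lin_expand {B : Type*} [AddCommGroup B] [Module A B] (f : Vec n A →ₗ[A] B) (x : Vec n A) :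
    f x = ∑ a, x a • f (bs a) := by
  conv_lhs => rw [vec_eq_sum x]
  simp

def ev1 (S : Ten n A 1) (u : Vec n A) : A := sl S u ![]
def ev2 (S : Ten n A 2) (u v : Vec n A) : A := sl (sl S u) v ![]
def ev3 (S : Ten n A 3) (x u v : Vec n A) : A := sl (sl (sl S x) u) v ![]

lemma ev1_act (O : Op n A) (S : Ten n A 1) (u : Vec n A) :
    ev1 (act O S) u = O.d (ev1 S u) - ev1 S (O.D u) := by
  simp only [ev1, sl_act, Pi.sub_apply, act_Ten0]
lemma ev2_act (O : Op n A) (S : Ten n A 2) (u v : Vec n A) :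
    ev2 (act O S) u v = O.d (ev2 S u v) - ev2 S (O.D u) v - ev2 S u (O.D v) := by
  simp only [ev2, sl_act, sl_sub_left, Pi.sub_apply, act_Ten0]; ring
lemma ev3_act (O : Op n A) (S : Ten n A 3) (x u v : Vec n A) :
    ev3 (act O S) x u v = O.d (ev3 S x u v) - ev3 S (O.D x) u v - ev3 S x (O.D u) v - ev3 S x u (O.D v) := by
  simp only [ev3, sl_act, sl_sub_left, Pi.sub_apply, act_Ten0]; ring

lemma ten0_ext {S S' : Ten n A 0} (h : S ![] = S' ![]) : S = S' := by
  funext idx; rw [Subsingleton.elim idx ![]]; exact h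
lemma ten2_ext {S S' : Ten n A 2} (h : ∀ u v, ev2 S u v = ev2 S' u v) : S = S' :=
  ten_ext fun u => ten_ext fun v => ten0_ext (h u v)

lemma ev1_add (S : Ten n A 1) (u v : Vec n A) : ev1 S (u + v) = ev1 S u + ev1 S v := by simp [ev1, sl_add]
lemma ev1_smul (S : Ten n A 1) (f : A) (u : Vec n A) : ev1 S (f • u) = f * ev1 S u := by simp [ev1, sl_smul]
lemma ev2_add_left (S : Ten n A 2) (u u' v : Vec n A) : ev2 S (u + u') v = ev2 S u v + ev2 S u' v := by
  simp [ev2, sl_add, sl_add_left]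
lemma ev2_add_right (S : Ten n A 2) (u v v' : Vec n A) : ev2 S u (v + v') = ev2 S u v + ev2 S u v' := by
  simp [ev2, sl_add]
lemma ev2_sub_left (S : Ten n A 2) (u u' v : Vec n A) : ev2 S (u - u') v = ev2 S u v - ev2 S u' v := by
  simp [ev2, sl_sub, sl_sub_left]
lemma ev2_sub_right (S : Ten n A 2) (u v v' : Vec n A) : ev2 S u (v - v') = ev2 S u v - ev2 S u v' := by
  simp [ev2, sl_sub]
lemma ev2_smul_left (S : Ten n A 2) (f : A) (u v : Vec n A) : ev2 S (f • u) v = f * ev2 S u v := by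
  simp [ev2, sl_smul, sl_smul_left]
lemma ev2_smul_right (S : Ten n A 2) (f : A) (u v : Vec n A) : ev2 S u (f • v) = f * ev2 S u v := by
  simp [ev2, sl_smul]
lemma ev2_zero_left (S : Ten n A 2) (v : Vec n A) : ev2 S 0 v = 0 := by simp [ev2, sl_zero, sl_zero_left]
lemma ev2_zero_right (S : Ten n A 2) (v : Vec n A) : ev2 S v 0 = 0 := by simp [ev2, sl_zero]

structure Geo (n : ℕ) (A : Type*) [CommRing A] [Algebra ℝ A] where
  par : Fin n → Derivation ℝ A A
  par_comm : ∀ a b f, par a (par b f) = par b (par a f)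
  G : Fin n → Fin n → A
  G_symm : ∀ a b, G a b = G b a
  gam : Fin n → Fin n → A
  gam_symm : ∀ a b, gam a b = gam b a
  inv : ∀ a c, ∑ b, gam a b * G b c = if a = c then 1 else 0
  Gam : Fin n → Fin n → Fin n → A
  Gam_symm : ∀ e b c, Gam e b c = Gam e c b
  compat : ∀ a b c, par a (G b c) = ∑ e, Gam e a b * G e c + ∑ e, Gam e a c * G b e

namespace Geo
variable (g : Geo n A)

def dv (x : Vec n A) : Derivation ℝ A A := ∑ a, x a • g.par a

lemma dv_apply (x : Vec n A) (f : A) : g.dv x f = ∑ a, x a * g.par a f := by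
  have h : ⇑(∑ a, x a • g.par a) = ∑ a, ⇑(x a • g.par a) :=
    map_sum (Derivation.coeFnAddMonoidHom (R := ℝ) (A := A) (M := A)) _ _
  rw [dv, h, Finset.sum_apply]
  rfl
lemma dv_add (x y : Vec n A) (f : A) : g.dv (x + y) f = g.dv x f + g.dv y f := by
  simp [dv_apply, add_mul, Finset.sum_add_distrib]
lemma dv_smul (h : A) (x : Vec n A) (f : A) : g.dv (h • x) f = h * g.dv x f := by
  simp [dv_apply, Finset.mul_sum, mul_assoc]

def GM (x v : Vec n A) : Vec n A := fun e => ∑ b, ∑ c, g.Gam e b c * x b * v c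
lemma GM_add_left (x y v : Vec n A) : g.GM (x + y) v = g.GM x v + g.GM y v := by
  funext e; simp [GM, mul_add, add_mul, Finset.sum_add_distrib]
lemma GM_symm (x v : Vec n A) : g.GM x v = g.GM v x := by
  funext e; simp only [GM]; rw [Finset.sum_comm]
  refine Finset.sum_congr rfl fun a _ => Finset.sum_congr rfl fun b _ => by rw [g.Gam_symm]; ring
lemma GM_add_right (x v u : Vec n A) : g.GM x (v + u) = g.GM x v + g.GM x u := by
  rw [GM_symm, GM_add_left, GM_symm _ v, GM_symm _ u]
lemma GM_smul_left (f : A) (x v : Vec n A) : g.GM (f • x) v = f • g.GM x v := by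
  funext e; simp only [GM, Pi.smul_apply, smul_eq_mul, Finset.mul_sum]
  refine Finset.sum_congr rfl fun a _ => Finset.sum_congr rfl fun b _ => by ring
lemma GM_smul_right (f : A) (x v : Vec n A) : g.GM x (f • v) = f • g.GM x v := by
  rw [GM_symm, GM_smul_left, GM_symm]

def nab (x : Vec n A) : Op n A where
  d := g.dv x
  D := fun v => (fun e => g.dv x (v e)) + g.GM x v
  D_add := fun u v => by rw [GM_add_right]; funext e; simp; ring
  D_smul := fun f v => by
    rw [GM_smul_right]; funext e; simp [Derivation.leibniz]; ring

/-- the Lie derivative operator -/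
def lie (x : Vec n A) : Op n A where
  d := g.dv x
  D := fun v => fun e => g.dv x (v e) - g.dv v (x e)
  D_add := fun u v => by funext e; simp [dv_add]; ring
  D_smul := fun f v => by
    funext e; simp [Derivation.leibniz, dv_smul]; ring

lemma dv_lie (x v : Vec n A) (f : A) :
    g.dv ((g.lie x).D v) f = g.dv x (g.dv v f) - g.dv v (g.dv x f) := by
  simp only [lie, dv_apply, map_sum, Derivation.leibniz, smul_eq_mul, sub_mul,
    Finset.sum_sub_distrib, Finset.mul_sum, Finset.sum_mul, mul_add, Finset.sum_add_distrib]
  have : ∑ b, ∑ a, v b * (x a * g.par a (g.par b f)) = ∑ a, ∑ b, x a * (v b * g.par b (g.par a f)) := by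
    rw [Finset.sum_comm]
    refine Finset.sum_congr rfl fun a _ => Finset.sum_congr rfl fun b _ => by rw [g.par_comm]; ring
  rw [this]
  have h1 : ∀ x v : Vec n A, ∑ a, ∑ b, x b * g.par b (v a) * g.par a f = ∑ a, ∑ b, g.par a f * (x b * g.par b (v a)) := by
    intro x v
    refine Finset.sum_congr rfl fun a _ => Finset.sum_congr rfl fun b _ => by ring
  rw [h1, h1]
  ring

lemma torsion (x v : Vec n A) : (g.nab x).D v - (g.nab v).D x = (g.lie x).D v := by
  funext e; simp only [nab, lie, Pi.sub_apply, Pi.add_apply, g.GM_symm v x]; ring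

lemma jacobi (z x v : Vec n A) : (g.lie z).D ((g.lie x).D v) =
    (g.lie ((g.lie z).D x)).D v + (g.lie x).D ((g.lie z).D v) := by
  funext e
  have h1 : ∀ x v : Vec n A, ∀ e, (g.lie x).D v e = g.dv x (v e) - g.dv v (x e) := fun _ _ _ => rfl
  simp only [Pi.add_apply]
  rw [h1 z, h1 ((g.lie z).D x), h1 x ((g.lie z).D v)]
  rw [dv_lie, dv_lie, dv_lie]
  simp only [h1, map_sub]
  ring

lemma lie_self (x : Vec n A) : (g.lie x).D x = 0 := by
  funext e; simp [lie]

lemma nab_D_add (x y v : Vec n A) : (g.nab (x + y)).D v = (g.nab x).D v + (g.nab y).D v := by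
  simp only [nab, GM_add_left, dv_add]; funext e; simp; ring
lemma nab_D_smul (f : A) (x v : Vec n A) : (g.nab (f • x)).D v = f • (g.nab x).D v := by
  simp only [nab, GM_smul_left, dv_smul]; funext e; simp; ring

lemma act_nab_add (x y : Vec n A) {k : ℕ} (S : Ten n A k) :
    act (g.nab (x + y)) S = act (g.nab x) S + act (g.nab y) S := by
  have := act_lin (g.nab x) (g.nab y) (g.nab (x + y)) 1 (fun u => by simp [nab, dv_add])
    (fun u => by rw [nab_D_add, one_smul]) S
  simpa using this

lemma act_nab_smul (f : A) (x : Vec n A) {k : ℕ} (S : Ten n A k) :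
    act (g.nab (f • x)) S = f • act (g.nab x) S := by
  have := act_lin (g.nab x) (endo 0) (g.nab (f • x)) f (fun u => by simp [nab, dv_smul, endo])
    (fun u => by rw [nab_D_smul]; simp [endo]) S
  rw [this]
  have h0 : act (endo (0 : Vec n A →ₗ[A] Vec n A)) S = 0 := by
    funext idx; simp [act, endo]
  rw [h0, add_zero]

def cov {k : ℕ} (S : Ten n A k) : Ten n A (k+1) :=
  fun idx => act (g.nab (bs (idx 0))) S (fun m => idx m.succ)

lemma sl_cov {k : ℕ} (S : Ten n A k) (x : Vec n A) : sl (g.cov S) x = act (g.nab x) S := by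
  let f : Vec n A →ₗ[A] Ten n A k :=
    { toFun := fun x => act (g.nab x) S
      map_add' := fun x y => g.act_nab_add x y S
      map_smul' := fun c x => g.act_nab_smul c x S }
  have := lin_expand f x
  change act (g.nab x) S = _ at this
  rw [this]
  funext idx
  simp only [sl, cov, Finset.sum_apply, Pi.smul_apply, smul_eq_mul, Fin.cons_zero, Fin.cons_succ]
  rfl

lemma cov_add {k : ℕ} (S S' : Ten n A k) : g.cov (S + S') = g.cov S + g.cov S' :=
  ten_ext fun x => by simp only [sl_cov, sl_add_left, act_add]
lemma cov_zero {k : ℕ} : g.cov (0 : Ten n A k) = 0 :=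
  ten_ext fun x => by simp only [sl_cov, sl_zero_left, act_zero]

def gT : Ten n A 2 := fun idx => g.G (idx 0) (idx 1)
def ip (u v : Vec n A) : A := ev2 g.gT u v

lemma ip_eq (u v : Vec n A) : g.ip u v = ∑ b, ∑ a, v b * (u a * g.G a b) := by
  simp only [ip, ev2, sl, gT, Fin.cons_zero, Finset.mul_sum]
  rfl
lemma ip_symm (u v : Vec n A) : g.ip u v = g.ip v u := by
  rw [ip_eq, ip_eq, Finset.sum_comm]
  refine Finset.sum_congr rfl fun a _ => Finset.sum_congr rfl fun b _ => by rw [g.G_symm]; ring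
lemma ip_add_left (u u' v : Vec n A) : g.ip (u + u') v = g.ip u v + g.ip u' v := ev2_add_left _ _ _ _
lemma ip_add_right (u v v' : Vec n A) : g.ip u (v + v') = g.ip u v + g.ip u v' := ev2_add_right _ _ _ _
lemma ip_sub_left (u u' v : Vec n A) : g.ip (u - u') v = g.ip u v - g.ip u' v := ev2_sub_left _ _ _ _
lemma ip_sub_right (u v v' : Vec n A) : g.ip u (v - v') = g.ip u v - g.ip u v' := ev2_sub_right _ _ _ _
lemma ip_smul_left (f : A) (u v : Vec n A) : g.ip (f • u) v = f * g.ip u v := ev2_smul_left _ _ _ _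
lemma ip_smul_right (f : A) (u v : Vec n A) : g.ip u (f • v) = f * g.ip u v := ev2_smul_right _ _ _ _
lemma ip_zero_left (v : Vec n A) : g.ip 0 v = 0 := ev2_zero_left _ _
lemma ip_zero_right (v : Vec n A) : g.ip v 0 = 0 := ev2_zero_right _ _

lemma cov_gT : g.cov g.gT = 0 := by
  funext idx
  simp only [cov, act, gT, nab, Fin.sum_univ_two, dv_apply, Pi.zero_apply]
  have h1 : ∀ a c : Fin n, ∑ b, (bs a : Vec n A) b * g.par b (g.G (idx (Fin.succ 0)) c) = g.par a (g.G (idx (Fin.succ 0)) c) := by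
    intro a c; simp [bs, Pi.single_apply]
  have h2 : ∀ (a c b' e: Fin n), g.par a ((bs c : Vec n A) e) = 0 := by
    intro a c b' e
    by_cases h : c = e
    · subst h; simp [bs]
    · simp [bs, Pi.single_apply, Ne.symm h]
  have h3 : ∀ a b e, g.GM (bs a) (bs b) e = g.Gam e a b := by
    intro a b e
    simp [GM, bs, Pi.single_apply]
  have h4 : ∀ (j : Fin 2) (e : Fin n), (Function.update (fun m : Fin 2 => idx m.succ) 0 e) 1 = idx (Fin.succ 1) := by
    intro j e; rfl
  simp only [Pi.add_apply, h3]
  have h5 : ∀ (a c e : Fin n), ∑ b, (bs a : Vec n A) b * g.par b ((bs c : Vec n A) e) = 0 := by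
    intro a c e
    refine Finset.sum_eq_zero fun b _ => by rw [h2 _ _ b, mul_zero]
  rw [h1]
  simp only [h5, zero_add, Function.update_self, ne_eq, Fin.isValue, one_ne_zero, not_false_eq_true,
    Function.update_of_ne, zero_ne_one, g.compat]
  ring

lemma act_nab_gT (x : Vec n A) : act (g.nab x) g.gT = 0 := by
  rw [← sl_cov, cov_gT, sl_zero_left]

lemma dv_ip (x u v : Vec n A) : g.dv x (g.ip u v) = g.ip ((g.nab x).D u) v + g.ip u ((g.nab x).D v) := by
  have := ev2_act (g.nab x) g.gT u v
  rw [act_nab_gT] at this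
  have h0 : ev2 (0 : Ten n A 2) u v = 0 := by simp [ev2, sl_zero_left]
  rw [h0] at this
  change 0 = g.dv x (g.ip u v) - g.ip _ v - g.ip u _ at this
  linear_combination -this

lemma nondeg {z : Vec n A} (h : ∀ v, g.ip z v = 0) : z = 0 := by
  funext e
  have h1 : ∀ b, ∑ a, z a * g.G a b = 0 := by
    intro b
    have := h (bs b)
    rw [ip_eq] at this
    simpa [bs, Pi.single_apply] using this
  have : z e = ∑ a, z a * ∑ b, g.gam e b * g.G b a := by simp [g.inv]
  rw [this]
  simp only [Finset.mul_sum]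
  rw [Finset.sum_comm]
  refine Finset.sum_eq_zero fun b _ => ?_
  have : ∑ a, z a * (g.gam e b * g.G b a) = g.gam e b * ∑ a, z a * g.G a b := by
    rw [Finset.mul_sum]; refine Finset.sum_congr rfl fun a _ => by rw [g.G_symm]; ring
  rw [this, h1, mul_zero]

/-- curvature like tensor -/
def CC (z : Vec n A) : Vec n A →ₗ[A] Vec n A →ₗ[A] Vec n A :=
  LinearMap.mk₂ A (fun x u => (g.lie z).D ((g.nab x).D u) - (g.nab x).D ((g.lie z).D u)
      - (g.nab ((g.lie z).D x)).D u)
    (fun x y u => by simp only [(g.lie z).D_add, nab_D_add]; abel)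
    (fun f x u => by
      simp only [(g.lie z).D_smul, nab_D_add, nab_D_smul]
      simp only [smul_sub, lie]; module)
    (fun x u v => by simp only [(g.lie z).D_add, (g.nab _).D_add]; abel)
    (fun f x u => by
      simp only [(g.lie z).D_smul, (g.nab _).D_smul, (g.lie z).D_add, (g.nab _).D_add]
      have : (g.nab ((g.lie z).D x)).d f = (g.lie z).d ((g.nab x).d f) - (g.nab x).d ((g.lie z).d f) :=
        g.dv_lie z x f
      rw [this]
      module)

lemma CC_apply (z x u : Vec n A) : g.CC z x u = (g.lie z).D ((g.nab x).D u) - (g.nab x).D ((g.lie z).D u)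
      - (g.nab ((g.lie z).D x)).D u := rfl

lemma lie_D_sub (z u v : Vec n A) : (g.lie z).D (u - v) = (g.lie z).D u - (g.lie z).D v := by
  rw [eq_sub_iff_add_eq, ← (g.lie z).D_add, sub_add_cancel]

lemma CC_symm (z x u : Vec n A) : g.CC z x u = g.CC z u x := by
  have h := g.jacobi z x u
  rw [← g.torsion x u, lie_D_sub, ← g.torsion x, ← g.torsion _ u] at h
  rw [CC_apply, CC_apply]
  rw [sub_eq_iff_eq_add] at h
  rw [h]
  abel

end Geo

/-- `K · S` -/
def kt (K : Vec n A →ₗ[A] Vec n A →ₗ[A] Vec n A) {k : ℕ} (S : Ten n A k) : Ten n A (k+1) :=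
  fun idx => act (endo (K (bs (idx 0)))) S (fun m => idx m.succ)

lemma sl_kt (K : Vec n A →ₗ[A] Vec n A →ₗ[A] Vec n A) {k : ℕ} (S : Ten n A k) (x : Vec n A) :
    sl (kt K S) x = act (endo (K x)) S := by
  let f : Vec n A →ₗ[A] Ten n A k :=
    { toFun := fun x => act (endo (K x)) S
      map_add' := fun x y => by
        have := act_lin (endo (K x)) (endo (K y)) (endo (K (x + y))) 1 (fun u => by simp [endo])
          (fun u => by simp [endo]) S
        simpa using this
      map_smul' := fun c x => by
        have := act_lin (endo (K x)) (endo (K 0)) (endo (K (c • x))) c (fun u => by simp [endo])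
          (fun u => by simp [endo]) S
        rw [this]
        have h0 : act (endo (K 0)) S = 0 := by
          funext idx; simp [act, endo]
        rw [h0, add_zero]; rfl }
  have := lin_expand f x
  change act (endo (K x)) S = _ at this
  rw [this]
  funext idx
  simp only [sl, kt, Finset.sum_apply, Pi.smul_apply, smul_eq_mul, Fin.cons_zero, Fin.cons_succ]
  rfl

/-- derivative of a bilinear map -/
def opK (O : Op n A) (K : Vec n A →ₗ[A] Vec n A →ₗ[A] Vec n A) : Vec n A →ₗ[A] Vec n A →ₗ[A] Vec n A :=
  LinearMap.mk₂ A (fun x u => O.D (K x u) - K (O.D x) u - K x (O.D u))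
    (fun x y u => by simp only [O.D_add, map_add, LinearMap.add_apply]; abel)
    (fun f x u => by
      simp only [O.D_smul, map_smul, map_add, LinearMap.add_apply, LinearMap.smul_apply]; module)
    (fun x u v => by simp only [O.D_add, map_add]; abel)
    (fun f x u => by
      simp only [O.D_smul, map_smul, map_add]; module)

lemma opK_apply (O : Op n A) (K : Vec n A →ₗ[A] Vec n A →ₗ[A] Vec n A) (x u : Vec n A) :
    opK O K x u = O.D (K x u) - K (O.D x) u - K x (O.D u) := rfl

lemma act_kt (O : Op n A) (K : Vec n A →ₗ[A] Vec n A →ₗ[A] Vec n A) {k : ℕ} (S : Ten n A k) :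
    act O (kt K S) = kt (opK O K) S + kt K (act O S) := by
  apply ten_ext; intro x
  rw [sl_act, sl_add_left, sl_kt, sl_kt, sl_kt, sl_kt]
  rw [← act_comm O (endo (K x)) (endo (opK O K x)) (endo (K (O.D x)))]
  · abel
  · intro f; simp [endo]
  · intro v; simp [endo, opK_apply]; abel

lemma Geo.lie_cov (g : Geo n A) (z : Vec n A) {k : ℕ} (S : Ten n A k) :
    act (g.lie z) (g.cov S) = g.cov (act (g.lie z) S) + kt (g.CC z) S := by
  apply ten_ext; intro x
  rw [sl_act, sl_add_left, sl_kt, g.sl_cov, g.sl_cov, g.sl_cov]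
  rw [← act_comm (g.lie z) (g.nab x) (endo (g.CC z x)) (g.nab ((g.lie z).D x))]
  · abel
  · intro f
    change 0 = g.dv z (g.dv x f) - g.dv x (g.dv z f) - g.dv ((g.lie z).D x) f
    rw [g.dv_lie, sub_self]
  · intro v; rfl

end geo1

set_option linter.unusedSectionVars false
set_option linter.unusedSimpArgs false
section geo2
variable {A : Type*} [CommRing A] [Algebra ℝ A] {n : ℕ}

structure NGeo (n : ℕ) (A : Type*) [CommRing A] [Algebra ℝ A] extends Geo n A where
  l : Vec n A
  nn : Vec n A
  null : toGeo.ip l l = 0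
  norm : toGeo.ip l nn = 1

namespace NGeo
variable (g : NGeo n A)

def perp : Submodule A (Vec n A) where
  carrier := {v | g.ip g.l v = 0}
  add_mem' := fun {u v} hu hv => by
    simp only [Set.mem_ofPred_eq] at *; rw [g.ip_add_right, hu, hv, add_zero]
  zero_mem' := g.ip_zero_right _
  smul_mem' := fun f u hu => by
    simp only [Set.mem_ofPred_eq] at *; rw [g.ip_smul_right, hu, mul_zero]

def Fil (w : ℤ) : Submodule A (Vec n A) :=
  if w ≤ -1 then ⊤ else if w = 0 then g.perp else if w = 1 then Submodule.span A {g.l} else ⊥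

lemma mem_Fil_neg {w : ℤ} (h : w ≤ -1) (x : Vec n A) : x ∈ g.Fil w := by simp [Fil, h]
lemma mem_Fil_zero {x : Vec n A} : x ∈ g.Fil 0 ↔ g.ip g.l x = 0 := by
  simp only [Fil, show ¬ ((0:ℤ) ≤ -1) by norm_num, if_false, if_true]; rfl
lemma mem_Fil_one {x : Vec n A} : x ∈ g.Fil 1 ↔ ∃ f : A, f • g.l = x := by
  simp only [Fil, show ¬ ((1:ℤ) ≤ -1) by norm_num, show ¬ ((1:ℤ) = 0) by norm_num, if_false, if_true]
  exact Submodule.mem_span_singleton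
lemma mem_Fil_two {w : ℤ} (h : 2 ≤ w) {x : Vec n A} : x ∈ g.Fil w ↔ x = 0 := by
  simp only [Fil, show ¬ (w ≤ -1) by omega, show ¬ (w = 0) by omega, show ¬ (w = 1) by omega, if_false]
  exact Submodule.mem_bot A
lemma l_mem : g.l ∈ g.Fil 1 := g.mem_Fil_one.2 ⟨1, one_smul _ _⟩
lemma nn_mem : g.nn ∈ g.Fil (-1) := g.mem_Fil_neg le_rfl _
lemma Fil_anti_succ (w : ℤ) {x : Vec n A} (hx : x ∈ g.Fil (w + 1)) : x ∈ g.Fil w := by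
  rcases lt_trichotomy w 0 with h | h | h
  · exact g.mem_Fil_neg (by omega) x
  · subst h
    obtain ⟨f, rfl⟩ := g.mem_Fil_one.1 hx
    rw [g.mem_Fil_zero, g.ip_smul_right, g.null, mul_zero]
  · rw [g.mem_Fil_two (by omega)] at hx
    rw [hx]; exact Submodule.zero_mem _
lemma Fil_anti {w w' : ℤ} (h : w ≤ w') {x : Vec n A} (hx : x ∈ g.Fil w') : x ∈ g.Fil w := by
  obtain ⟨k, rfl⟩ := Int.le.dest h
  clear h
  induction k with
  | zero => simpa using hx
  | succ k ih => exact ih (g.Fil_anti_succ _ (by convert hx using 2; push_cast; ring))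
lemma l_mem0 : g.l ∈ g.Fil 0 := g.Fil_anti (by norm_num) g.l_mem

/-- case analysis on the filtration -/
lemma Fil_cases {P : ℤ → Vec n A → Prop} (hneg : ∀ w x, w ≤ -1 → P w x) (h0 : ∀ x, x ∈ g.Fil 0 → P 0 x)
    (h1 : ∀ f : A, P 1 (f • g.l)) (h2 : ∀ w, 2 ≤ w → P w 0) : ∀ w x, x ∈ g.Fil w → P w x := by
  intro w x hx
  rcases lt_trichotomy w 0 with h | h | h
  · exact hneg w x (by omega)
  · subst h; exact h0 x hx
  · by_cases h' : w = 1
    · subst h'; obtain ⟨f, rfl⟩ := g.mem_Fil_one.1 hx; exact h1 f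
    · rw [g.mem_Fil_two (by omega)] at hx; rw [hx]; exact h2 w (by omega)

lemma orth {a b : ℤ} {u v : Vec n A} (hu : u ∈ g.Fil a) (hv : v ∈ g.Fil b) (h : 0 < a + b) : g.ip u v = 0 := by
  revert h
  revert hv
  refine g.Fil_cases (P := fun a u => v ∈ g.Fil b → 0 < a + b → g.ip u v = 0) ?_ ?_ ?_ ?_ a u hu
  · intro w x hw hv h; rw [(g.mem_Fil_two (by omega)).1 hv]; exact g.ip_zero_right _
  · intro x hx hv h
    obtain ⟨f, rfl⟩ := g.mem_Fil_one.1 (g.Fil_anti (show (1:ℤ) ≤ b by omega) hv)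
    rw [g.ip_smul_right, g.ip_symm, g.mem_Fil_zero.1 hx, mul_zero]
  · intro f hv h
    rw [g.ip_smul_left, g.mem_Fil_zero.1 (g.Fil_anti (show (0:ℤ) ≤ b by omega) hv), mul_zero]
  · intro w hw _ _; exact g.ip_zero_left _

lemma split (x : Vec n A) : ∃ v ∈ g.Fil 0, x = g.ip g.l x • g.nn + v := by
  refine ⟨x - g.ip g.l x • g.nn, ?_, by abel⟩
  rw [g.mem_Fil_zero, g.ip_sub_right, g.ip_smul_right, g.norm]; ring

lemma dual {c : ℤ} {z : Vec n A} (h : ∀ v ∈ g.Fil (1 - c), g.ip z v = 0) : z ∈ g.Fil c := by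
  rcases lt_trichotomy c 0 with hc | hc | hc
  · exact g.mem_Fil_neg (by omega) _
  · subst hc
    rw [g.mem_Fil_zero, g.ip_symm]
    exact h _ (by simpa using g.l_mem)
  · by_cases h' : c = 1
    · subst h'
      rw [g.mem_Fil_one]
      refine ⟨g.ip z g.nn, ?_⟩
      rw [← sub_eq_zero]
      apply g.nondeg
      intro v
      obtain ⟨u, hu, hv⟩ := g.split v
      have h0 := h u (by simpa using hu)
      rw [hv, g.ip_sub_left, g.ip_smul_left, g.ip_add_right, g.ip_add_right, g.ip_smul_right, g.ip_smul_right,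
        g.norm, g.mem_Fil_zero.1 hu, h0]
      ring
    · rw [g.mem_Fil_two (by omega)]
      exact g.nondeg fun v => h v (g.mem_Fil_neg (by omega) v)

lemma BO_gT : BO g.Fil g.gT 0 := by
  intro a x hx b u hu h
  exact ten0_ext (g.orth hx hu (by omega))

abbrev L : Op n A := g.lie g.l
def Nx : Vec n A →ₗ[A] Vec n A where
  toFun := fun x => (g.nab x).D g.l
  map_add' := fun x y => g.nab_D_add x y _
  map_smul' := fun f x => g.nab_D_smul f x _

lemma nab_l (v : Vec n A) : (g.nab g.l).D v = g.L.D v + g.Nx v := by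
  rw [← g.torsion]; simp [Nx]

lemma act_nab_l {k : ℕ} (S : Ten n A k) : act (g.nab g.l) S = act g.L S + act (endo g.Nx) S := by
  have := act_lin g.L (endo g.Nx) (g.nab g.l) 1 (fun u => by simp [endo, Geo.lie, Geo.nab])
    (fun u => by rw [nab_l, one_smul]; rfl) S
  simpa using this

/-- weak Kundt -/
def WK : Prop := ∀ x ∈ g.Fil 0, (g.nab x).D g.l ∈ g.Fil 1
/-- full Kundt and affine -/
def FK : Prop := g.WK ∧ (g.nab g.l).D g.l = 0

lemma ip_nab_l (x : Vec n A) : g.ip ((g.nab x).D g.l) g.l = 0 := by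
  have := g.dv_ip x g.l g.l
  rw [g.null, map_zero, g.ip_symm g.l] at this
  exact two_cancel this.symm

/-- general covariant derivative lowers the filtration by at most one -/
lemma nab_gen (x : Vec n A) : ∀ w v, v ∈ g.Fil w → (g.nab x).D v ∈ g.Fil (w - 1) := by
  refine g.Fil_cases ?_ ?_ ?_ ?_
  · intro w v hw; exact g.mem_Fil_neg (by omega) _
  · intro v _; exact g.mem_Fil_neg (by omega) _
  · intro f
    rw [(g.nab x).D_smul]
    refine Submodule.add_mem _ (Submodule.smul_mem _ _ ?_) (Submodule.smul_mem _ _ ?_)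
    · rw [show (1:ℤ) - 1 = 0 by norm_num, g.mem_Fil_zero, g.ip_symm]; exact g.ip_nab_l x
    · exact g.l_mem0
  · intro w hw; rw [(g.nab x).D_zero]; exact Submodule.zero_mem _

variable {g}
lemma WK.nab0 (hK : g.WK) {x : Vec n A} (hx : x ∈ g.Fil 0) :
    ∀ w v, v ∈ g.Fil w → (g.nab x).D v ∈ g.Fil (w - 0) := by
  refine g.Fil_cases ?_ ?_ ?_ ?_
  · intro w v hw; exact g.mem_Fil_neg (by omega) _
  · intro v hv
    rw [sub_zero, g.mem_Fil_zero, g.ip_symm]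
    have := g.dv_ip x v g.l
    rw [g.ip_symm, g.mem_Fil_zero.1 hv, map_zero, g.orth hv (hK x hx) (by norm_num), add_zero] at this
    exact this.symm
  · intro f
    rw [(g.nab x).D_smul, sub_zero]
    exact Submodule.add_mem _ (Submodule.smul_mem _ _ (hK x hx)) (Submodule.smul_mem _ _ g.l_mem)
  · intro w hw; rw [(g.nab x).D_zero]; exact Submodule.zero_mem _

lemma WK.BO_nab0 (hK : g.WK) {x : Vec n A} (hx : x ∈ g.Fil 0) {k : ℕ} {S : Ten n A k} {s : ℤ}
    (h : BO g.Fil S s) : BO g.Fil (act (g.nab x) S) s := by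
  have := BO.act (g.nab x) 0 (hK.nab0 hx) (Or.inl le_rfl) h
  simpa using this

variable (g) in
lemma BO_nab (x : Vec n A) {k : ℕ} {S : Ten n A k} {s : ℤ}
    (h : BO g.Fil S s) : BO g.Fil (act (g.nab x) S) (s + 1) :=
  BO.act (g.nab x) 1 (g.nab_gen x) (Or.inl (by norm_num)) h

lemma FK.Nx_mem (hK : g.FK) : ∀ w v, v ∈ g.Fil w → g.Nx v ∈ g.Fil (w - (-1)) := by
  refine g.Fil_cases ?_ ?_ ?_ ?_
  · intro w v hw
    by_cases h : w = -1
    · subst h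
      rw [show (-1:ℤ) - (-1) = 0 by norm_num, g.mem_Fil_zero, g.ip_symm]; exact g.ip_nab_l v
    · exact g.mem_Fil_neg (by omega) _
  · intro v hv
    rw [show (0:ℤ) - -1 = 1 by norm_num]; exact hK.1 v hv
  · intro f; rw [map_smul]
    change f • (g.nab g.l).D g.l ∈ _
    rw [hK.2, smul_zero]; exact Submodule.zero_mem _
  · intro w _; rw [map_zero]; exact Submodule.zero_mem _

lemma FK.BO_N (hK : g.FK) {k : ℕ} {S : Ten n A k} {s : ℤ}
    (h : BO g.Fil S s) : BO g.Fil (act (endo g.Nx) S) (s - 1) :=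
  BO.act (endo g.Nx) (-1) hK.Nx_mem (Or.inr rfl) h

lemma FK.L_mem (hK : g.FK) : ∀ w v, v ∈ g.Fil w → g.L.D v ∈ g.Fil (w - 0) := by
  intro w v hv
  have : g.L.D v = (g.nab g.l).D v - g.Nx v := by rw [nab_l]; abel
  rw [this]
  exact Submodule.sub_mem _ (hK.1.nab0 g.l_mem0 w v hv) (g.Fil_anti (by omega) (hK.Nx_mem w v hv))

lemma FK.L_mem' (hK : g.FK) {w : ℤ} {v : Vec n A} (hv : v ∈ g.Fil w) : g.L.D v ∈ g.Fil w := by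
  simpa using hK.L_mem w v hv

lemma FK.BO_L (hK : g.FK) {k : ℕ} {S : Ten n A k} {s : ℤ}
    (h : BO g.Fil S s) : BO g.Fil (act g.L S) s := by
  have := BO.act g.L 0 hK.L_mem (Or.inl le_rfl) h
  simpa using this

/-- step (ii) -/
lemma FK.BO_cov (hK : g.FK) {k : ℕ} {S : Ten n A k} {s : ℤ}
    (h : BO g.Fil S s) (hL : BO g.Fil (act g.L S) (s - 1)) : BO g.Fil (g.cov S) s := by
  intro w x hx
  rw [g.sl_cov]
  revert w x
  refine g.Fil_cases ?_ ?_ ?_ ?_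
  · intro w x hw; exact (g.BO_nab x h).mono (by omega)
  · intro x hx; rw [sub_zero]; exact hK.1.BO_nab0 hx h
  · intro f
    rw [g.act_nab_smul, act_nab_l]
    exact (hL.add (hK.BO_N h)).smul f
  · intro w _
    rw [← g.sl_cov, sl_zero]; exact BO.zero _

/-! bilinear maps -/
variable (g) in
def BOK (K : Vec n A →ₗ[A] Vec n A →ₗ[A] Vec n A) (s : ℤ) : Prop :=
  ∀ a b x u, x ∈ g.Fil a → u ∈ g.Fil b → K x u ∈ g.Fil (a + b - s)

lemma BOK.kt {K : Vec n A →ₗ[A] Vec n A →ₗ[A] Vec n A} {s s' : ℤ} (hK : g.BOK K s) {k : ℕ} {S : Ten n A k}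
    (h : BO g.Fil S s') : BO g.Fil (kt K S) (s + s') := by
  intro a x hx
  rw [sl_kt]
  exact (BO.act (endo (K x)) (s - a) (fun b u hu => g.Fil_anti (by omega) (hK a b x u hx hu)) (Or.inr rfl) h).mono
    (by omega)

variable (g) in
def BT : ℕ → ∀ {k : ℕ}, Ten n A k → ℤ → Prop
  | 0, _, S, s => BO g.Fil S s
  | j+1, _, S, s => BO g.Fil S s ∧ BT j (act g.L S) (s - 1)
variable (g) in
def BTK : ℕ → (Vec n A →ₗ[A] Vec n A →ₗ[A] Vec n A) → ℤ → Prop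
  | 0, K, s => g.BOK K s
  | j+1, K, s => g.BOK K s ∧ BTK j (opK g.L K) (s - 1)
variable (g) in
def BO3 (f : Vec n A → Vec n A → Vec n A → A) (s : ℤ) : Prop :=
  ∀ a b c x u v, x ∈ g.Fil a → u ∈ g.Fil b → v ∈ g.Fil c → s - a - b - c < 0 → f x u v = 0
variable (g) in
def L3 (f : Vec n A → Vec n A → Vec n A → A) : Vec n A → Vec n A → Vec n A → A :=
  fun x u v => g.L.d (f x u v) - f (g.L.D x) u v - f x (g.L.D u) v - f x u (g.L.D v)
variable (g) in
def BT3 : ℕ → (Vec n A → Vec n A → Vec n A → A) → ℤ → Prop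
  | 0, f, s => g.BO3 f s
  | j+1, f, s => g.BO3 f s ∧ BT3 j (g.L3 f) (s - 1)

lemma BT.bo {k : ℕ} {S : Ten n A k} {s : ℤ} : ∀ {j : ℕ}, g.BT j S s → BO g.Fil S s
  | 0, h => h
  | _+1, h => h.1
lemma BT.pred : ∀ {j k : ℕ} {S : Ten n A k} {s : ℤ}, g.BT (j+1) S s → g.BT j S s
  | 0, _, _, _, h => h.1
  | _+1, _, _, _, h => ⟨h.1, BT.pred h.2⟩
lemma BT.add : ∀ {j k : ℕ} {S S' : Ten n A k} {s : ℤ}, g.BT j S s → g.BT j S' s → g.BT j (S + S') s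
  | 0, _, _, _, _, h, h2 => BO.add h h2
  | _+1, _, _, _, _, h, h2 => ⟨BO.add h.1 h2.1, by rw [act_add]; exact BT.add h.2 h2.2⟩
lemma BT.zero : ∀ {j k : ℕ} {s : ℤ}, g.BT j (0 : Ten n A k) s
  | 0, _, _ => BO.zero _
  | _+1, _, _ => ⟨BO.zero _, by rw [act_zero]; exact BT.zero⟩
lemma BTK.bo {K : Vec n A →ₗ[A] Vec n A →ₗ[A] Vec n A} {s : ℤ} : ∀ {j : ℕ}, g.BTK j K s → g.BOK K s
  | 0, h => h
  | _+1, h => h.1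
lemma BTK.pred : ∀ {j : ℕ} {K : Vec n A →ₗ[A] Vec n A →ₗ[A] Vec n A} {s : ℤ}, g.BTK (j+1) K s → g.BTK j K s
  | 0, _, _, h => h.1
  | _+1, _, _, h => ⟨h.1, BTK.pred h.2⟩
lemma BT3.bo {f : Vec n A → Vec n A → Vec n A → A} {s : ℤ} : ∀ {j : ℕ}, g.BT3 j f s → g.BO3 f s
  | 0, h => h
  | _+1, h => h.1
lemma BT3.pred : ∀ {j : ℕ} {f : Vec n A → Vec n A → Vec n A → A} {s : ℤ}, g.BT3 (j+1) f s → g.BT3 j f s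
  | 0, _, _, h => h.1
  | _+1, _, _, h => ⟨h.1, BT3.pred h.2⟩
lemma BO3.add {f f' : Vec n A → Vec n A → Vec n A → A} {s : ℤ} (h : g.BO3 f s) (h' : g.BO3 f' s) :
    g.BO3 (fun x u v => f x u v + f' x u v) s := fun a b c x u v hx hu hv hs => by
  simp only [h a b c x u v hx hu hv hs, h' a b c x u v hx hu hv hs, add_zero]
lemma BO3.neg {f : Vec n A → Vec n A → Vec n A → A} {s : ℤ} (h : g.BO3 f s) :
    g.BO3 (fun x u v => - f x u v) s := fun a b c x u v hx hu hv hs => by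
  simp only [h a b c x u v hx hu hv hs, neg_zero]
lemma BT3.add : ∀ {j : ℕ} {f f' : Vec n A → Vec n A → Vec n A → A} {s : ℤ}, g.BT3 j f s → g.BT3 j f' s →
    g.BT3 j (fun x u v => f x u v + f' x u v) s
  | 0, _, _, _, h, h2 => BO3.add h h2
  | _+1, f, f', _, h, h2 => ⟨BO3.add h.1 h2.1, by
      have : g.L3 (fun x u v => f x u v + f' x u v) = fun x u v => g.L3 f x u v + g.L3 f' x u v := by
        funext x u v; simp only [L3, map_add]; ring
      rw [this]; exact BT3.add h.2 h2.2⟩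
lemma BT3.neg : ∀ {j : ℕ} {f : Vec n A → Vec n A → Vec n A → A} {s : ℤ}, g.BT3 j f s →
    g.BT3 j (fun x u v => - f x u v) s
  | 0, _, _, h => BO3.neg h
  | _+1, f, _, h => ⟨BO3.neg h.1, by
      have : g.L3 (fun x u v => - f x u v) = fun x u v => - g.L3 f x u v := by
        funext x u v; simp only [L3, map_neg]; ring
      rw [this]; exact BT3.neg h.2⟩
lemma BT3.half : ∀ {j : ℕ} {f : Vec n A → Vec n A → Vec n A → A} {s : ℤ},
    g.BT3 j (fun x u v => f x u v + f x u v) s → g.BT3 j f s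
  | 0, _, _, h => fun a b c x u v hx hu hv hs => two_cancel (h a b c x u v hx hu hv hs)
  | _+1, f, _, h => ⟨fun a b c x u v hx hu hv hs => two_cancel (h.1 a b c x u v hx hu hv hs), by
      have : g.L3 (fun x u v => f x u v + f x u v) = fun x u v => g.L3 f x u v + g.L3 f x u v := by
        funext x u v; simp only [L3, map_add]; ring
      have h2 := h.2
      rw [this] at h2; exact BT3.half h2⟩
lemma BT3.swap : ∀ {j : ℕ} {f : Vec n A → Vec n A → Vec n A → A} {s : ℤ}, g.BT3 j f s →
    g.BT3 j (fun x u v => f u x v) s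
  | 0, _, _, h => fun a b c x u v hx hu hv hs => h b a c u x v hu hx hv (by omega)
  | _+1, f, _, h => ⟨fun a b c x u v hx hu hv hs => h.1 b a c u x v hu hx hv (by omega), by
      have : g.L3 (fun x u v => f u x v) = fun x u v => g.L3 f u x v := by
        funext x u v; simp only [L3]; ring
      rw [this]; exact BT3.swap h.2⟩
lemma BT3.rot : ∀ {j : ℕ} {f : Vec n A → Vec n A → Vec n A → A} {s : ℤ}, g.BT3 j f s →
    g.BT3 j (fun x u v => f v x u) s
  | 0, _, _, h => fun a b c x u v hx hu hv hs => h c a b v x u hv hx hu (by omega)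
  | _+1, f, _, h => ⟨fun a b c x u v hx hu hv hs => h.1 c a b v x u hv hx hu (by omega), by
      have : g.L3 (fun x u v => f v x u) = fun x u v => g.L3 f v x u := by
        funext x u v; simp only [L3]; ring
      rw [this]; exact BT3.rot h.2⟩

lemma BO3_ev3 {S : Ten n A 3} {s : ℤ} (h : BO g.Fil S s) : g.BO3 (ev3 S) s :=
  fun a b c x u v hx hu hv hs => congrFun (h a x hx b u hu c v hv (by omega)) ![]
lemma BT3_ev3 : ∀ {j : ℕ} {S : Ten n A 3} {s : ℤ}, g.BT j S s → g.BT3 j (ev3 S) s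
  | 0, _, _, h => BO3_ev3 h
  | _+1, S, _, h => ⟨BO3_ev3 h.1, by
      have : g.L3 (ev3 S) = ev3 (act g.L S) := by
        funext x u v; rw [ev3_act]; rfl
      rw [this]; exact BT3_ev3 h.2⟩

lemma BO.ev2 {S : Ten n A 2} {s a b : ℤ} {u v : Vec n A} (h : BO g.Fil S s) (hu : u ∈ g.Fil a) (hv : v ∈ g.Fil b)
    (hs : s - a - b < 0) : ev2 S u v = 0 := congrFun (h a u hu b v hv (by omega)) ![]

lemma BTK.kt : ∀ {j : ℕ} {K : Vec n A →ₗ[A] Vec n A →ₗ[A] Vec n A} {s s' : ℤ} {k : ℕ} {S : Ten n A k},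
    g.BTK j K s → g.BT j S s' → g.BT j (kt K S) (s + s')
  | 0, _, _, _, _, _, hK, h => BOK.kt hK h
  | _+1, K, s, s', _, S, hK, h => ⟨BOK.kt hK.1 h.1, by
      rw [act_kt]
      refine BT.add ?_ ?_
      · have := BTK.kt hK.2 h.pred; rwa [show s - 1 + s' = s + s' - 1 by ring] at this
      · have := BTK.kt hK.pred h.2; rwa [show s + (s' - 1) = s + s' - 1 by ring] at this⟩

/-- `Q ∘ K` -/
def qk (Q : Ten n A 2) (K : Vec n A →ₗ[A] Vec n A →ₗ[A] Vec n A) : Vec n A → Vec n A → Vec n A → A :=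
  fun x u v => ev2 Q (K x u) v

lemma BO3_qk {K : Vec n A →ₗ[A] Vec n A →ₗ[A] Vec n A} {s s' : ℤ} {Q : Ten n A 2} (hK : g.BOK K s)
    (hQ : BO g.Fil Q s') : g.BO3 (qk Q K) (s + s') := fun a b c x u v hx hu hv hs =>
  BO.ev2 hQ (hK a b x u hx hu) hv (by omega)

variable (g) in
lemma L3_qk (Q : Ten n A 2) (K : Vec n A →ₗ[A] Vec n A →ₗ[A] Vec n A) :
    g.L3 (qk Q K) = fun x u v => qk (act g.L Q) K x u v + qk Q (opK g.L K) x u v := by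
  funext x u v
  simp only [L3, qk, ev2_act, opK_apply, ev2_sub_left]; ring

lemma BT3_qk : ∀ {j : ℕ} {K : Vec n A →ₗ[A] Vec n A →ₗ[A] Vec n A} {s s' : ℤ} {Q : Ten n A 2},
    g.BTK j K s → g.BT j Q s' → g.BT3 j (qk Q K) (s + s')
  | 0, _, _, _, _, hK, h => BO3_qk hK h
  | _+1, K, s, s', Q, hK, h => ⟨BO3_qk hK.1 h.1, by
      rw [L3_qk]
      refine BT3.add ?_ ?_
      · have := BT3_qk hK.pred h.2; rwa [show s + (s' - 1) = s + s' - 1 by ring] at this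
      · have := BT3_qk hK.2 h.pred; rwa [show s - 1 + s' = s + s' - 1 by ring] at this⟩

variable (g) in
def HH : Ten n A 2 := act g.L g.gT

lemma BOK_of_BO3 {K : Vec n A →ₗ[A] Vec n A →ₗ[A] Vec n A} {s : ℤ} (h : g.BO3 (qk g.gT K) s) : g.BOK K s :=
  fun a b x u hx hu => g.dual fun v hv => h a b _ x u v hx hu hv (by omega)

lemma BTK_of_BT3 : ∀ {j : ℕ} {K : Vec n A →ₗ[A] Vec n A →ₗ[A] Vec n A} {s : ℤ},
    g.BT j g.HH (-1) → g.BT3 j (qk g.gT K) s → g.BTK j K s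
  | 0, _, _, _, h => BOK_of_BO3 h
  | _+1, K, s, hH, h => ⟨BOK_of_BO3 h.1, by
      have h1 := BTK_of_BT3 hH.pred h.pred
      have h2 := BT3_qk h1 hH.pred
      have h3 := h.2
      have e : qk g.gT (opK g.L K) = fun x u v => g.L3 (qk g.gT K) x u v + (- qk g.HH K x u v) := by
        rw [L3_qk]; funext x u v; simp only [HH]; ring
      refine BTK_of_BT3 hH.pred ?_
      rw [e]
      exact BT3.add h3 (BT3.neg h2)⟩

/-- the fundamental formula for `C` -/
lemma C3_formula (x u v : Vec n A) :
    qk g.gT (g.CC g.l) x u v + qk g.gT (g.CC g.l) x u v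
      = (ev3 (g.cov g.HH) x u v + ev3 (g.cov g.HH) u x v) + (- ev3 (g.cov g.HH) v x u) := by
  have hc : ∀ x u v, ev3 (g.cov g.HH) x u v = - (- qk g.gT (g.CC g.l) x u v - qk g.gT (g.CC g.l) x v u) := by
    intro x u v
    have h := g.lie_cov g.l g.gT
    rw [g.cov_gT, act_zero] at h
    have h2 : ev3 (g.cov g.HH) x u v = - ev3 (kt (g.CC g.l) g.gT) x u v := by
      have : g.cov g.HH = - kt (g.CC g.l) g.gT := by
        rw [eq_neg_iff_add_eq_zero]; exact h.symm
      rw [this]; simp [ev3, sl_neg_left]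
    rw [h2]
    have h3 : ev3 (kt (g.CC g.l) g.gT) x u v = ev2 (act (endo (g.CC g.l x)) g.gT) u v := by
      simp only [ev3, ev2, sl_kt]
    rw [h3, ev2_act]
    have : ev2 g.gT u ((endo (g.CC g.l x)).D v) = ev2 g.gT (g.CC g.l x v) u := g.ip_symm _ _
    rw [this]
    simp [qk, endo]
  have hs : ∀ x u v, qk g.gT (g.CC g.l) x u v = qk g.gT (g.CC g.l) u x v := by
    intro x u v; simp only [qk, g.CC_symm g.l x u]
  rw [hc, hc, hc, hs u x v, hs v x u, hs v u x]
  ring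

lemma BTK_CC {j : ℕ} (hH : g.BT j g.HH (-1)) (h : g.BT j (g.cov g.HH) (-1)) : g.BTK j (g.CC g.l) (-1) := by
  refine BTK_of_BT3 hH (BT3.half ?_)
  have h3 := BT3_ev3 h
  have e : (fun x u v => qk g.gT (g.CC g.l) x u v + qk g.gT (g.CC g.l) x u v)
    = fun x u v => (ev3 (g.cov g.HH) x u v + ev3 (g.cov g.HH) u x v) + (- ev3 (g.cov g.HH) v x u) := by
    funext x u v; exact C3_formula x u v
  rw [e]
  exact BT3.add (BT3.add h3 h3.swap) h3.rot.neg

lemma BT_cov (hK : g.FK) (hH : ∀ j, g.BT j g.HH (-1)) : ∀ (j : ℕ) {k : ℕ} {S : Ten n A k} {s : ℤ},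
    g.BT (j+1) S s → g.BT j (g.cov S) s
  | 0, _, _, _, h => hK.BO_cov h.1 h.2
  | j+1, k, S, s, h => ⟨hK.BO_cov h.1 h.2.bo, by
      rw [g.lie_cov]
      refine BT.add (BT_cov hK hH j h.2) ?_
      have hC : g.BTK j (g.CC g.l) (-1) := BTK_CC (hH j) (BT_cov hK hH j (hH (j+1)))
      have := BTK.kt hC h.pred.pred
      rwa [show -1 + s = s - 1 by ring] at this⟩

def covN (g : Geo n A) {k : ℕ} (S : Ten n A k) : (I : ℕ) → Ten n A (k + I)
  | 0 => S
  | I+1 => g.cov (covN g S I)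

lemma BT_covN (hK : g.FK) (hH : ∀ j, g.BT j g.HH (-1)) {k : ℕ} {S : Ten n A k} (hS : ∀ j, g.BT j S (-1)) :
    ∀ I j, g.BT j (covN g.toGeo S I) (-1)
  | 0, j => hS j
  | I+1, j => BT_cov hK hH j (BT_covN hK hH hS I (j+1))

lemma FK.BO_H (hK : g.FK) : BO g.Fil g.HH (-1) := by
  have := g.act_nab_l g.gT
  rw [g.act_nab_gT] at this
  have e : g.HH = - act (endo g.Nx) g.gT := eq_neg_of_add_eq_zero_left this.symm
  rw [e]
  exact (hK.BO_N g.BO_gT).neg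

/-- Part II -/
theorem part_two (hK : g.FK) (h1 : BO g.Fil (act g.L g.HH) (-2)) (h2 : act g.L (act g.L g.HH) = 0)
    {k : ℕ} {S : Ten n A k} (hS : BO g.Fil S (-1)) (hLS : act g.L S = 0) (I : ℕ) :
    BO g.Fil (covN g.toGeo S I) (-1) := by
  have hH1 := hK.BO_H
  refine (BT_covN hK ?_ ?_ I 0)
  · intro j
    match j with
    | 0 => exact hH1
    | 1 => exact ⟨hH1, h1⟩
    | j+2 => exact ⟨hH1, h1, by rw [h2]; exact BT.zero⟩
  · intro j
    match j with
    | 0 => exact hS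
    | j+1 => exact ⟨hS, by rw [hLS]; exact BT.zero⟩

end NGeo
end geo2

set_option linter.unusedSectionVars false
set_option linter.unusedSimpArgs false
section geo3
variable {A : Type*} [CommRing A] [Algebra ℝ A] {n : ℕ}

def Alt : ∀ {k : ℕ}, Ten n A k → Prop
  | 0, _ => True
  | 1, _ => True
  | _+2, S => (∀ x y, sl (sl S x) y = - sl (sl S y) x) ∧ ∀ x, Alt (sl S x)

lemma Alt.sl : ∀ {k : ℕ} {S : Ten n A (k+1)}, Alt S → ∀ x, Alt (sl S x)
  | 0, _, _, _ => trivial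
  | _+1, _, h, x => h.2 x
lemma Alt.add : ∀ {k : ℕ} {S S' : Ten n A k}, Alt S → Alt S' → Alt (S + S')
  | 0, _, _, _, _ => trivial
  | 1, _, _, _, _ => trivial
  | _+2, _, _, h, h' => ⟨fun x y => by
      simp only [sl_add_left]; rw [h.1 x y, h'.1 x y]; abel,
      fun x => by rw [sl_add_left]; exact Alt.add (h.2 x) (h'.2 x)⟩
lemma Alt.smul (f : A) : ∀ {k : ℕ} {S : Ten n A k}, Alt S → Alt (f • S)
  | 0, _, _ => trivial
  | 1, _, _ => trivial
  | _+2, _, h => ⟨fun x y => by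
      simp only [sl_smul_left]; rw [h.1 x y, smul_neg],
      fun x => by rw [sl_smul_left]; exact Alt.smul f (h.2 x)⟩
lemma Alt.neg {k : ℕ} {S : Ten n A k} (h : Alt S) : Alt (-S) := by
  have := h.smul (-1 : A); simpa using this
lemma Alt.sub {k : ℕ} {S S' : Ten n A k} (h : Alt S) (h' : Alt S') : Alt (S - S') := by
  rw [sub_eq_add_neg]; exact h.add h'.neg
lemma Alt.act (O : Op n A) : ∀ {k : ℕ} {S : Ten n A k}, Alt S → Alt (act O S)
  | 0, _, _ => trivial
  | 1, _, _ => trivial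
  | _+2, S, h => ⟨fun x y => by
      simp only [sl_act, sl_sub_left]
      rw [h.1 x y, h.1 (O.D x) y, h.1 x (O.D y), act_neg]; abel,
      fun x => by rw [sl_act]; exact Alt.sub (Alt.act O (h.2 x)) (h.2 _)⟩

def Kills (z : Vec n A) : ∀ {k : ℕ}, Ten n A k → Prop
  | 0, _ => True
  | _+1, S => sl S z = 0 ∧ ∀ x, Kills z (sl S x)

lemma Alt.kills {z : Vec n A} : ∀ {k : ℕ} {S : Ten n A (k+1)}, Alt S → VSI.sl S z = 0 → Kills z S
  | 0, _, _, h => ⟨h, fun _ => trivial⟩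
  | k+1, S, hA, h => ⟨h, fun x => (hA.sl x).kills (by rw [hA.1 x z, h, sl_zero_left, neg_zero])⟩

lemma ten_two_cancel {k : ℕ} {S : Ten n A k} (h : S = -S) : S = 0 := by
  funext idx
  apply two_cancel
  have := congrFun h idx
  simp only [Pi.neg_apply] at this
  nth_rewrite 1 [this]
  simp

lemma Alt.kills_sl {z : Vec n A} : ∀ {k : ℕ} {S : Ten n A (k+1)}, Alt S → Kills z (VSI.sl S z)
  | 0, _, _ => trivial
  | k+1, S, hA => (hA.sl z).kills (ten_two_cancel (hA.1 z z))

/-- rank one endomorphism -/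
def rk (φ : Vec n A →ₗ[A] A) (z : Vec n A) : Vec n A →ₗ[A] Vec n A := φ.smulRight z

lemma act_rk_kills (φ : Vec n A →ₗ[A] A) (z : Vec n A) : ∀ {k : ℕ} {R : Ten n A k}, Kills z R →
    act (endo (rk φ z)) R = 0
  | 0, R, _ => by funext idx; rw [act_Ten0]; simp [endo]
  | k+1, R, h => ten_ext fun x => by
      rw [sl_act, act_rk_kills φ z (h.2 x), sl_zero_left]
      have : (endo (rk φ z)).D x = φ x • z := rfl
      rw [this, sl_smul, h.1, smul_zero, sub_zero]

namespace NGeo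
variable {g : NGeo n A}

lemma lemA : ∀ {k : ℕ} {S : Ten n A k}, BO g.Fil S (-1) → Kills g.nn S → S = 0
  | 0, S, h, _ => h (by norm_num)
  | k+1, S, h, hk => ten_ext fun x => by
      obtain ⟨v, hv, hx⟩ := g.split x
      rw [hx, sl_add, sl_smul, hk.1, smul_zero, zero_add, sl_zero_left]
      exact lemA (by simpa using h.sl hv) (hk.2 v)

lemma lemB : ∀ {k : ℕ} {S : Ten n A k}, BO g.Fil S (-2) → Alt S → S = 0
  | 0, S, h, _ => h (by norm_num)
  | k+1, S, h, hA => by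
      refine lemA (h.mono (by norm_num)) (hA.kills ?_)
      exact lemA (h.sl' g.nn_mem (by norm_num)) hA.kills_sl

variable (g) in
def ipL (u : Vec n A) : Vec n A →ₗ[A] A where
  toFun := g.ip u
  map_add' := g.ip_add_right u
  map_smul' := fun f x => g.ip_smul_right f u x

lemma lemE {q : ℕ} {F : Ten n A (q+1)} (hF : BO g.Fil F (-1)) (hA : Alt F) (E : Vec n A →ₗ[A] Vec n A)
    (hE : ∀ v ∈ g.Fil 0, E v ∈ g.Fil 1) : act (endo E) F = - g.ip g.l (E g.nn) • F := by
  have hkl : Kills g.l F := hA.kills (lemB (g := g) (hF.sl' g.l_mem (by norm_num)) (hA.sl _))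
  have hP : act (endo (rk (g.ipL g.l) g.nn)) F = - F := by
    rw [eq_neg_iff_add_eq_zero]
    have hAlt : Alt (act (endo (rk (g.ipL g.l) g.nn)) F + F) := (hA.act _).add hA
    refine lemA (BO.add ?_ hF) (hAlt.kills ?_)
    · have := BO.act (Φ := g.Fil) (endo (rk (g.ipL g.l) g.nn)) 0 ?_ (Or.inr rfl) hF
      · simpa using this
      · refine g.Fil_cases ?_ ?_ ?_ ?_
        · intro w x hw; exact g.mem_Fil_neg (by omega) _
        · intro x hx
          change g.ip g.l x • g.nn ∈ _
          rw [g.mem_Fil_zero.1 hx, zero_smul]; exact Submodule.zero_mem _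
        · intro f
          change g.ip g.l (f • g.l) • g.nn ∈ _
          rw [g.ip_smul_right, g.null, mul_zero, zero_smul]; exact Submodule.zero_mem _
        · intro w _; rw [Op.D_zero]; exact Submodule.zero_mem _
    · rw [sl_add_left, sl_act, act_rk_kills _ _ hA.kills_sl]
      have : (endo (rk (g.ipL g.l) g.nn)).D g.nn = g.ip g.l g.nn • g.nn := rfl
      rw [this, g.norm, one_smul]; abel
  have hP2 : act (endo (rk (g.ipL g.nn) g.l)) F = 0 := act_rk_kills _ _ hkl
  obtain ⟨c, hc⟩ := g.mem_Fil_one.1 (hE g.l g.l_mem0)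
  set b := g.ip g.l (E g.nn) with hb
  let E' : Vec n A →ₗ[A] Vec n A := E - b • rk (g.ipL g.l) g.nn - c • rk (g.ipL g.nn) g.l
  have hE'a : ∀ x, E' x = E x - (b * g.ip g.l x) • g.nn - (c * g.ip g.nn x) • g.l := by
    intro x
    change E x - b • (g.ip g.l x • g.nn) - c • (g.ip g.nn x • g.l) = _
    rw [smul_smul, smul_smul]
  have h0 : act (endo E') F = 0 := by
    refine lemB (g := g) ?_ (hA.act _)
    have := BO.act (Φ := g.Fil) (endo E') (-1) ?_ (Or.inr rfl) hF
    · simpa using this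
    · refine g.Fil_cases ?_ ?_ ?_ ?_
      · intro w x hw
        by_cases h : w = -1
        · subst h
          change E' x ∈ _
          obtain ⟨v, hv, hx⟩ := g.split x
          rw [show (-1:ℤ) - (-1) = 0 by norm_num, g.mem_Fil_zero, hE'a, g.ip_sub_right, g.ip_sub_right,
            g.ip_smul_right, g.ip_smul_right, g.norm, g.null]
          nth_rewrite 1 [hx]
          rw [map_add, map_smul, g.ip_add_right, g.ip_smul_right, ← hb,
            g.mem_Fil_zero.1 (g.Fil_anti (by norm_num) (hE v hv))]
          ring
        · exact g.mem_Fil_neg (by omega) _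
      · intro x hx
        change E' x ∈ _
        rw [show (0:ℤ) - (-1) = 1 by norm_num, hE'a, g.mem_Fil_zero.1 hx, mul_zero, zero_smul, sub_zero]
        exact Submodule.sub_mem _ (hE x hx) (Submodule.smul_mem _ _ g.l_mem)
      · intro f
        change E' (f • g.l) ∈ _
        rw [map_smul, hE'a, ← hc, g.null, g.ip_symm, g.norm, mul_zero, zero_smul, mul_one, sub_zero, sub_self,
          smul_zero]
        exact Submodule.zero_mem _
      · intro w _; rw [Op.D_zero]; exact Submodule.zero_mem _
  have e1 := act_lin (endo (rk (g.ipL g.l) g.nn)) (endo (E' + c • rk (g.ipL g.nn) g.l)) (endo E) b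
    (fun u => by simp [endo]) (fun x => by
      change E x = b • (g.ip g.l x • g.nn) + (E' x + c • (g.ip g.nn x • g.l))
      rw [hE'a, smul_smul, smul_smul]; abel) F
  have e2 := act_lin (endo (rk (g.ipL g.nn) g.l)) (endo E') (endo (E' + c • rk (g.ipL g.nn) g.l)) c
    (fun u => by simp [endo]) (fun x => by
      change E' x + c • (g.ip g.nn x • g.l) = c • (g.ip g.nn x • g.l) + E' x
      abel) F
  rw [e1, e2, hP, hP2, h0]
  simp

end NGeo

/-! pairing -/
def pr (γ : Fin n → Fin n → A) : ∀ {k : ℕ}, Ten n A k → Ten n A k → A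
  | 0, S, S' => S ![] * S' ![]
  | _+1, S, S' => ∑ a, ∑ b, γ a b * pr γ (sl S (bs a)) (sl S' (bs b))

variable (γ : Fin n → Fin n → A)
lemma pr_add_left : ∀ {k : ℕ} (S S' R : Ten n A k), pr γ (S + S') R = pr γ S R + pr γ S' R
  | 0, _, _, _ => by simp [pr, add_mul]
  | _+1, S, S', R => by
      simp only [pr, sl_add_left, pr_add_left, mul_add, Finset.sum_add_distrib]
lemma pr_add_right : ∀ {k : ℕ} (R S S' : Ten n A k), pr γ R (S + S') = pr γ R S + pr γ R S'
  | 0, _, _, _ => by simp [pr, mul_add]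
  | _+1, R, S, S' => by
      simp only [pr, sl_add_left, pr_add_right, mul_add, Finset.sum_add_distrib]
lemma pr_smul_left (f : A) : ∀ {k : ℕ} (S R : Ten n A k), pr γ (f • S) R = f * pr γ S R
  | 0, _, _ => by simp [pr, mul_assoc]
  | _+1, S, R => by
      simp only [pr, sl_smul_left, pr_smul_left, Finset.mul_sum]
      refine Finset.sum_congr rfl fun a _ => Finset.sum_congr rfl fun b _ => by ring
lemma pr_smul_right (f : A) : ∀ {k : ℕ} (R S : Ten n A k), pr γ R (f • S) = f * pr γ R S
  | 0, _, _ => by simp [pr]; ring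
  | _+1, S, R => by
      simp only [pr, sl_smul_left, pr_smul_right, Finset.mul_sum]
      refine Finset.sum_congr rfl fun a _ => Finset.sum_congr rfl fun b _ => by ring
lemma pr_symm (hγ : ∀ a b, γ a b = γ b a) : ∀ {k : ℕ} (R S : Ten n A k), pr γ R S = pr γ S R
  | 0, _, _ => by simp [pr]; ring
  | _+1, S, R => by
      simp only [pr]
      rw [Finset.sum_comm]
      refine Finset.sum_congr rfl fun a _ => Finset.sum_congr rfl fun b _ => by rw [hγ, pr_symm hγ]

def prL {k : ℕ} : Ten n A k →ₗ[A] Ten n A k →ₗ[A] A :=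
  LinearMap.mk₂ A (pr γ) (pr_add_left γ) (fun f S R => pr_smul_left γ f S R) (pr_add_right γ)
    (fun f S R => pr_smul_right γ f S R)
lemma prL_apply {k : ℕ} (S R : Ten n A k) : prL γ S R = pr γ S R := rfl
lemma pr_zero_left {k : ℕ} (R : Ten n A k) : pr γ 0 R = 0 := by rw [← prL_apply]; simp
lemma pr_zero_right {k : ℕ} (R : Ten n A k) : pr γ R 0 = 0 := by rw [← prL_apply]; simp
lemma pr_neg_left {k : ℕ} (S R : Ten n A k) : pr γ (-S) R = - pr γ S R := by
  have := ((prL γ).flip R).map_neg S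
  simpa only [LinearMap.flip_apply, prL_apply] using this
lemma pr_neg_right {k : ℕ} (S R : Ten n A k) : pr γ S (-R) = - pr γ S R := by
  have := (prL γ S).map_neg R
  simpa only [prL_apply] using this

def slL {k : ℕ} (S : Ten n A (k+1)) : Vec n A →ₗ[A] Ten n A k where
  toFun := sl S
  map_add' := sl_add S
  map_smul' := sl_smul S
lemma sl_expand {k : ℕ} (S : Ten n A (k+1)) (x : Vec n A) : sl S x = ∑ a, x a • sl S (bs a) :=
  lin_expand (slL S) x

lemma pr_sl {k : ℕ} (S S' : Ten n A (k+1)) (x y : Vec n A) :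
    pr γ (sl S x) (sl S' y) = ∑ a, ∑ b, x a * y b * pr γ (sl S (bs a)) (sl S' (bs b)) := by
  rw [sl_expand S x, sl_expand S' y, ← prL_apply]
  simp only [map_sum, LinearMap.sum_apply, map_smul, LinearMap.smul_apply, smul_eq_mul, prL_apply, Finset.mul_sum]
  rw [Finset.sum_comm]
  refine Finset.sum_congr rfl fun a _ => Finset.sum_congr rfl fun b _ => by ring

/-- frame at a point -/
structure Frame (γ : Fin n → Fin n → A) (l nn : Vec n A) (ev : A →+* ℝ) where
  w : Fin n → Vec n A
  eq : ∀ a b, ev (γ a b) = ev (l a) * ev (nn b) + ev (nn a) * ev (l b) + ∑ i, ev (w i a) * ev (w i b)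

variable {γ} {l nn : Vec n A} {ev : A →+* ℝ}
lemma pr_frame (fr : Frame γ l nn ev) {k : ℕ} (S S' : Ten n A (k+1)) :
    ev (pr γ S S') = ev (pr γ (sl S l) (sl S' nn)) + ev (pr γ (sl S nn) (sl S' l))
      + ∑ i, ev (pr γ (sl S (fr.w i)) (sl S' (fr.w i))) := by
  rw [pr_sl γ S S' l nn, pr_sl γ S S' nn l]
  simp only [pr_sl γ S S' (fr.w _) (fr.w _)]
  rw [pr]
  simp only [map_sum, map_mul, fr.eq, add_mul, Finset.sum_add_distrib, Finset.sum_mul]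
  congr 1
  symm
  rw [Finset.sum_comm]
  refine Finset.sum_congr rfl fun a _ => ?_
  rw [Finset.sum_comm]

/-- swapping the roles of the two null vectors -/
def Frame.flip (fr : Frame γ l nn ev) : Frame γ nn l ev where
  w := fr.w
  eq := fun a b => by rw [fr.eq]; ring

lemma pos_kills (fr : Frame γ l nn ev) : ∀ {k : ℕ} {R : Ten n A k}, Kills l R → 0 ≤ ev (pr γ R R)
  | 0, R, _ => by simp only [pr, map_mul]; exact mul_self_nonneg _
  | k+1, R, h => by
      rw [pr_frame fr, h.1, pr_zero_left, pr_zero_right, map_zero, zero_add, zero_add]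
      exact Finset.sum_nonneg fun i _ => pos_kills fr (h.2 _)

end geo3

set_option linter.unusedSectionVars false
set_option linter.unusedSimpArgs false
set_option linter.unusedVariables false
section geo4
variable {A : Type*} [CommRing A] [Algebra ℝ A] {n : ℕ}

/-! derivative of the pairing -/
namespace Geo
variable (g : Geo n A)

def raise (c : Fin n) : Vec n A := fun b => g.gam c b

lemma inv' (a c : Fin n) : ∑ b, g.G a b * g.gam b c = if a = c then 1 else 0 := by
  rw [← if_congr (eq_comm (a := c) (b := a)) rfl rfl, ← g.inv c a]
  refine Finset.sum_congr rfl fun b _ => ?_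
  rw [g.G_symm a b, g.gam_symm b c, mul_comm]

lemma ip_raise (c : Fin n) (v : Vec n A) : g.ip (g.raise c) v = v c := by
  rw [ip_eq]
  have : ∀ b, ∑ a, v b * (g.raise c a * g.G a b) = v b * if c = b then 1 else 0 := by
    intro b
    rw [← g.inv c b, Finset.mul_sum]; rfl
  simp [this]

lemma D_bs_d (x : Vec n A) (a e : Fin n) : g.dv x ((bs a : Vec n A) e) = 0 := by
  by_cases h : a = e
  · subst h; simp [bs]
  · simp [bs, Pi.single_apply, Ne.symm h]

lemma gam_compat (x : Vec n A) (c e : Fin n) : g.dv x (g.gam c e) =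
    - ∑ b, g.gam e b * (g.nab x).D (bs b) c - ∑ a, g.gam c a * (g.nab x).D (bs a) e := by
  have h1 : ∀ b, g.ip ((g.nab x).D (g.raise c)) (bs b) = - (g.nab x).D (bs b) c := by
    intro b
    have := g.dv_ip x (g.raise c) (bs b)
    rw [ip_raise, ip_raise, D_bs_d] at this
    linear_combination -this
  have h2 : (g.nab x).D (g.raise c) e = ∑ b, g.gam e b * g.ip ((g.nab x).D (g.raise c)) (bs b) := by
    rw [← g.ip_raise e ((g.nab x).D (g.raise c)), ip_symm]
    exact lin_expand (⟨⟨g.ip ((g.nab x).D (g.raise c)), g.ip_add_right _⟩, fun f u => g.ip_smul_right f _ u⟩ :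
      Vec n A →ₗ[A] A) (g.raise e)
  rw [Op.D_expand] at h2
  simp only [h1] at h2
  have h3 : (g.nab x).d (g.raise c e) = g.dv x (g.gam c e) := rfl
  rw [h3] at h2
  simp only [mul_neg, Finset.sum_neg_distrib] at h2
  change _ + ∑ a, g.gam c a * _ = _ at h2
  linear_combination h2

lemma dv_pr (x : Vec n A) : ∀ {k : ℕ} (S S' : Ten n A k),
    g.dv x (pr g.gam S S') = pr g.gam (act (g.nab x) S) S' + pr g.gam S (act (g.nab x) S')
  | 0, S, S' => by
      simp only [pr, act_Ten0, Derivation.leibniz, smul_eq_mul]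
      change _ = g.dv x _ * _ + _ * g.dv x _
      ring
  | k+1, S, S' => by
      simp only [pr, map_sum, Derivation.leibniz, smul_eq_mul, dv_pr x, sl_act]
      have e1 : ∀ (R R' : Ten n A k) P, pr g.gam (R - R') P = pr g.gam R P - pr g.gam R' P := by
        intro R R' P; rw [sub_eq_add_neg, pr_add_left, pr_neg_left, ← sub_eq_add_neg]
      have e2 : ∀ (R R' : Ten n A k) P, pr g.gam P (R - R') = pr g.gam P R - pr g.gam P R' := by
        intro R R' P; rw [sub_eq_add_neg, pr_add_right, pr_neg_right, ← sub_eq_add_neg]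
      simp only [e1, e2, mul_add, mul_sub, Finset.sum_add_distrib, Finset.sum_sub_distrib]
      have k1 : ∑ a, ∑ b, g.gam a b * pr g.gam (sl S ((g.nab x).D (bs a))) (sl S' (bs b))
          = ∑ a, ∑ b, (∑ c, g.gam b c * (g.nab x).D (bs c) a) * pr g.gam (sl S (bs a)) (sl S' (bs b)) := by
        have : ∀ a b, g.gam a b * pr g.gam (sl S ((g.nab x).D (bs a))) (sl S' (bs b))
            = ∑ c, g.gam a b * (g.nab x).D (bs a) c * pr g.gam (sl S (bs c)) (sl S' (bs b)) := by
          intro a b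
          rw [sl_expand S, ← prL_apply]
          simp only [map_sum, LinearMap.sum_apply, map_smul, LinearMap.smul_apply, smul_eq_mul, prL_apply,
            Finset.mul_sum, mul_assoc]
        simp only [this, Finset.sum_mul]
        conv_lhs => rw [Finset.sum_comm]
        conv_rhs => rw [Finset.sum_comm]
        refine Finset.sum_congr rfl fun b _ => ?_
        rw [Finset.sum_comm]
        refine Finset.sum_congr rfl fun a _ => Finset.sum_congr rfl fun c _ => ?_
        rw [g.gam_symm c b]
      have k2 : ∑ a, ∑ b, g.gam a b * pr g.gam (sl S (bs a)) (sl S' ((g.nab x).D (bs b)))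
          = ∑ a, ∑ b, (∑ c, g.gam a c * (g.nab x).D (bs c) b) * pr g.gam (sl S (bs a)) (sl S' (bs b)) := by
        have : ∀ a b, g.gam a b * pr g.gam (sl S (bs a)) (sl S' ((g.nab x).D (bs b)))
            = ∑ c, g.gam a b * (g.nab x).D (bs b) c * pr g.gam (sl S (bs a)) (sl S' (bs c)) := by
          intro a b
          rw [sl_expand S', ← prL_apply]
          simp only [map_sum, LinearMap.sum_apply, map_smul, LinearMap.smul_apply, smul_eq_mul, prL_apply,
            Finset.mul_sum, mul_assoc]
        simp only [this, Finset.sum_mul]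
        refine Finset.sum_congr rfl fun a _ => ?_
        rw [Finset.sum_comm]
      have k3 : ∑ a, ∑ b, pr g.gam (sl S (bs a)) (sl S' (bs b)) * g.dv x (g.gam a b)
          = - ∑ a, ∑ b, (∑ c, g.gam b c * (g.nab x).D (bs c) a) * pr g.gam (sl S (bs a)) (sl S' (bs b))
          - ∑ a, ∑ b, (∑ c, g.gam a c * (g.nab x).D (bs c) b) * pr g.gam (sl S (bs a)) (sl S' (bs b)) := by
        rw [← Finset.sum_neg_distrib, ← Finset.sum_sub_distrib]
        refine Finset.sum_congr rfl fun a _ => ?_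
        rw [← Finset.sum_neg_distrib, ← Finset.sum_sub_distrib]
        refine Finset.sum_congr rfl fun b _ => ?_
        rw [gam_compat]; ring
      rw [k1, k2, k3]
      ring

end Geo

def TT (γ : Fin n → Fin n → A) {k : ℕ} (S S' : Ten n A (k+1)) : Ten n A 2 :=
  fun idx => pr γ (sl S (bs (idx 0))) (sl S' (bs (idx 1)))

lemma ev2_eq (S : Ten n A 2) (x y : Vec n A) : ev2 S x y = ∑ a, ∑ b, x a * y b * S ![a, b] := by
  simp only [ev2, sl, Finset.mul_sum]
  rw [Finset.sum_comm]
  refine Finset.sum_congr rfl fun a _ => Finset.sum_congr rfl fun b _ => ?_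
  have : (Fin.cons a (Fin.cons b ![]) : Fin 2 → Fin n) = ![a, b] := rfl
  rw [this]; ring

lemma ev2_TT (γ : Fin n → Fin n → A) {k : ℕ} (S S' : Ten n A (k+1)) (x y : Vec n A) :
    ev2 (TT γ S S') x y = pr γ (sl S x) (sl S' y) := by
  rw [ev2_eq, pr_sl]; rfl

lemma Geo.act_TT (g : Geo n A) (x : Vec n A) {k : ℕ} (S S' : Ten n A (k+1)) :
    act (g.nab x) (TT g.gam S S') = TT g.gam (act (g.nab x) S) S' + TT g.gam S (act (g.nab x) S') := by
  refine ten2_ext fun u v => ?_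
  have e : ∀ P Q : Ten n A 2, ev2 (P + Q) u v = ev2 P u v + ev2 Q u v := by
    intro P Q; simp [ev2, sl_add_left]
  rw [ev2_act, e]
  simp only [ev2_TT, sl_act]
  change g.dv x _ - _ - _ = _
  rw [g.dv_pr]
  have e1 : ∀ (R R' : Ten n A k) P, pr g.gam (R - R') P = pr g.gam R P - pr g.gam R' P := by
    intro R R' P; rw [sub_eq_add_neg, pr_add_left, pr_neg_left, ← sub_eq_add_neg]
  have e2 : ∀ (R R' : Ten n A k) P, pr g.gam P (R - R') = pr g.gam P R - pr g.gam P R' := by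
    intro R R' P; rw [sub_eq_add_neg, pr_add_right, pr_neg_right, ← sub_eq_add_neg]
  rw [e1, e2]; ring

lemma TT_sub_left (γ : Fin n → Fin n → A) {k : ℕ} (S S' R : Ten n A (k+1)) :
    TT γ (S - S') R = TT γ S R - TT γ S' R := by
  funext idx; simp only [TT, sl_sub_left, Pi.sub_apply]
  rw [sub_eq_add_neg, pr_add_left, pr_neg_left, ← sub_eq_add_neg]
lemma TT_sub_right (γ : Fin n → Fin n → A) {k : ℕ} (S S' R : Ten n A (k+1)) :
    TT γ R (S - S') = TT γ R S - TT γ R S' := by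
  funext idx; simp only [TT, sl_sub_left, Pi.sub_apply]
  rw [sub_eq_add_neg, pr_add_right, pr_neg_right, ← sub_eq_add_neg]

/-- second jets -/
lemma Geo.jet2 (g : Geo n A) {k : ℕ} (S : Ten n A (k+1)) (x y : Vec n A) :
    sl (sl (g.cov (g.cov (TT g.gam S S))) x) y =
      TT g.gam (sl (sl (g.cov (g.cov S)) x) y) S + TT g.gam (sl (g.cov S) y) (sl (g.cov S) x)
      + (TT g.gam (sl (g.cov S) x) (sl (g.cov S) y) + TT g.gam S (sl (sl (g.cov (g.cov S)) x) y)) := by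
  simp only [g.sl_cov, sl_act, g.act_TT, act_add, TT_sub_left, TT_sub_right]
  abel

end geo4

section geo5
variable {A : Type*} [CommRing A] [Algebra ℝ A] {n : ℕ}
namespace NGeo
variable {g : NGeo n A} {ev : A →+* ℝ} (fr : Frame g.gam g.l g.nn ev)

lemma ev_vec (x : Vec n A) (a : Fin n) : ev (x a) = ev (g.ip x g.nn) * ev (g.l a) + ev (g.ip g.l x) * ev (g.nn a)
    + ∑ i, ev (g.ip x (fr.w i)) * ev (fr.w i a) := by
  have h : x a = ∑ b, g.gam a b * g.ip (bs b) x := by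
    conv_lhs => rw [← g.ip_raise a x, vec_eq_sum (g.raise a)]
    exact (by
      rw [← vec_eq_sum]
      exact lin_expand (⟨⟨fun u => g.ip u x, fun u v => g.ip_add_left u v x⟩, fun f u => g.ip_smul_left f u x⟩ :
        Vec n A →ₗ[A] A) (g.raise a))
  have h2 : ∀ u : Vec n A, g.ip u x = ∑ b, u b * g.ip (bs b) x := fun u =>
    lin_expand (⟨⟨fun u => g.ip u x, fun u v => g.ip_add_left u v x⟩, fun f u => g.ip_smul_left f u x⟩ :
        Vec n A →ₗ[A] A) u
  rw [h, g.ip_symm x g.nn, h2 g.nn, h2 g.l]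
  have h3 : ∀ i, g.ip x (fr.w i) = ∑ b, fr.w i b * g.ip (bs b) x := fun i => by rw [g.ip_symm, h2]
  simp only [h3, map_sum, map_mul, fr.eq, add_mul, Finset.sum_add_distrib, Finset.sum_mul]
  congr 1
  · congr 1 <;> refine Finset.sum_congr rfl fun b _ => by ring
  · rw [Finset.sum_comm]
    refine Finset.sum_congr rfl fun b _ => Finset.sum_congr rfl fun i _ => by ring

/-- real-valued linear functional evaluated in the frame -/
lemma ev_lin (φ : Vec n A →ₗ[A] A) (x : Vec n A) : ev (φ x) = ev (g.ip x g.nn) * ev (φ g.l)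
    + ev (g.ip g.l x) * ev (φ g.nn) + ∑ i, ev (g.ip x (fr.w i)) * ev (φ (fr.w i)) := by
  rw [lin_expand φ x, lin_expand φ g.l, lin_expand φ g.nn]
  have h3 : ∀ i, φ (fr.w i) = ∑ a, fr.w i a • φ (bs a) := fun i => lin_expand φ _
  simp only [h3, smul_eq_mul, map_sum, map_mul, ev_vec fr x, add_mul, Finset.sum_add_distrib, Finset.sum_mul,
    Finset.mul_sum]
  congr 1
  · congr 1 <;> refine Finset.sum_congr rfl fun b _ => by ring
  · rw [Finset.sum_comm]
    refine Finset.sum_congr rfl fun b _ => Finset.sum_congr rfl fun i _ => by ring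

variable (g ev) in
/-- vanishing at a point on the orthogonal complement of the null vector -/
def Zev : ∀ {k : ℕ}, Ten n A k → Prop
  | 0, R => ev (R ![]) = 0
  | _+1, R => ∀ v ∈ g.Fil 0, Zev (sl R v)

lemma Zev_lin : ∀ {k : ℕ} {ι : Type} (s : Finset ι) (c : ι → A) (S : ι → Ten n A k) (R : Ten n A k)
    (h : ∀ idx, ev (R idx) = ∑ i ∈ s, ev (c i) * ev (S i idx)) (hS : ∀ i ∈ s, g.Zev ev (S i)), g.Zev ev R
  | 0, ι, s, c, S, R, h, hS => by
      change ev (R ![]) = 0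
      rw [h]
      refine Finset.sum_eq_zero fun i hi => ?_
      have : ev (S i ![]) = 0 := hS i hi
      rw [this, mul_zero]
  | k+1, ι, s, c, S, R, h, hS => fun v hv => by
      refine Zev_lin s c (fun i => sl (S i) v) (sl R v) (fun idx => ?_) (fun i hi => hS i hi v hv)
      simp only [sl, map_sum, map_mul, h, Finset.mul_sum]
      rw [Finset.sum_comm]
      refine Finset.sum_congr rfl fun b _ => Finset.sum_congr rfl fun i _ => by ring

variable (hw : ∀ i, g.ip g.l (fr.w i) = 0)

end NGeo
end geo5

set_option linter.unusedSectionVars false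
set_option linter.unusedSimpArgs false
set_option linter.unusedVariables false
section geo6
variable {A : Type*} [CommRing A] [Algebra ℝ A] {n : ℕ}
namespace NGeo
variable {g : NGeo n A} {ev : A →+* ℝ}

lemma Zev_of_w (fr : Frame g.gam g.l g.nn ev) {k : ℕ} {R : Ten n A (k+1)}
    (h1 : sl R g.l = 0) (h : ∀ i, g.Zev ev (sl R (fr.w i))) : g.Zev ev R := by
  intro v hv
  refine Zev_lin Finset.univ (fun i => g.ip v (fr.w i)) (fun i => sl R (fr.w i)) _ (fun idx => ?_) (fun i _ => h i)
  have := ev_lin fr (⟨⟨fun x => sl R x idx, fun x y => congrFun (sl_add R x y) idx⟩, fun f x => congrFun (sl_smul R f x) idx⟩ :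
    Vec n A →ₗ[A] A) v
  change ev (sl R v idx) = _ * ev (sl R g.l idx) + _ * ev (sl R g.nn idx) + ∑ i, _ * ev (sl R (fr.w i) idx) at this
  rw [this, h1, g.mem_Fil_zero.1 hv]
  simp

lemma pos_Z (fr : Frame g.gam g.l g.nn ev) : ∀ {k : ℕ} {R : Ten n A k}, Kills g.l R →
    ev (pr g.gam R R) = 0 → g.Zev ev R
  | 0, R, _, h => by
      simp only [pr, map_mul] at h
      exact mul_self_eq_zero.1 h
  | k+1, R, hk, h => by
      rw [pr_frame fr, hk.1, pr_zero_left, pr_zero_right, map_zero, zero_add, zero_add] at h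
      rw [Finset.sum_eq_zero_iff_of_nonneg (fun i _ => pos_kills fr (hk.2 _))] at h
      exact Zev_of_w fr hk.1 fun i => pos_Z fr (hk.2 _) (h i (Finset.mem_univ _))

lemma Zev_kn : ∀ {k : ℕ} {R : Ten n A k}, Kills g.nn R → g.Zev ev R → ∀ idx, ev (R idx) = 0
  | 0, R, _, h, idx => by rw [Subsingleton.elim idx ![]]; exact h
  | k+1, R, hk, h, idx => by
      obtain ⟨v, hv, hx⟩ := g.split (bs (idx 0))
      have e : R idx = sl R (bs (idx 0)) (fun m => idx m.succ) := by
        rw [sl_bs]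
        exact congrArg R (Fin.cons_self_tail idx).symm
      rw [e, hx, sl_add, sl_smul, hk.1, smul_zero, zero_add]
      exact Zev_kn (hk.2 v) (h v hv) _

/-- interior product pairing -/
lemma lemX (fr : Frame g.gam g.l g.nn ev) (hw : ∀ i, g.ip g.l (fr.w i) = 0) :
    ∀ {k : ℕ} {R S : Ten n A (k+1)}, Alt R → Kills g.l R → g.Zev ev R → Alt S →
    ev (pr g.gam R S) = (k+1) * ev (pr g.gam (sl R g.nn) (sl S g.l))
  | 0, R, S, hR, hk, hz, hS => by
      rw [pr_frame fr, hk.1, pr_zero_left, map_zero, zero_add]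
      have : ∀ i, ev (pr g.gam (sl R (fr.w i)) (sl S (fr.w i))) = 0 := by
        intro i
        have h0 : ev (sl R (fr.w i) ![]) = 0 := hz _ (g.mem_Fil_zero.2 (hw i))
        simp only [pr, map_mul, h0, zero_mul]
      simp [this]
  | k+1, R, S, hR, hk, hz, hS => by
      have ih : ∀ i, ev (pr g.gam (sl R (fr.w i)) (sl S (fr.w i))) =
          (k+1) * ev (pr g.gam (sl (sl R g.nn) (fr.w i)) (sl (sl S g.l) (fr.w i))) := by
        intro i
        rw [lemX fr hw (hR.sl _) (hk.2 _) (hz _ (g.mem_Fil_zero.2 (hw i))) (hS.sl _), hR.1, hS.1,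
          pr_neg_left, pr_neg_right, neg_neg]
      have h2 := pr_frame fr (sl R g.nn) (sl S g.l)
      have h3 : sl (sl R g.nn) g.nn = 0 := ten_two_cancel (hR.1 _ _)
      rw [(hk.2 g.nn).1, h3, pr_zero_left, pr_zero_left, map_zero, zero_add, zero_add] at h2
      rw [pr_frame fr, hk.1, pr_zero_left, map_zero, zero_add]
      simp only [ih, ← Finset.mul_sum]
      rw [← h2]; push_cast; ring

lemma pr_BO (fr : Frame g.gam g.l g.nn ev) (hw : ∀ i, g.ip g.l (fr.w i) = 0) :
    ∀ {k : ℕ} {S S' : Ten n A k} {s s' : ℤ}, BO g.Fil S s → BO g.Fil S' s' → s + s' < 0 →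
    ev (pr g.gam S S') = 0
  | 0, S, S', s, s', h, h', hs => by
      by_cases h0 : s < 0
      · rw [h h0, pr_zero_left, map_zero]
      · rw [h' (by omega), pr_zero_right, map_zero]
  | k+1, S, S', s, s', h, h', hs => by
      rw [pr_frame fr, pr_BO fr hw (h.sl g.l_mem) (h'.sl g.nn_mem) (by omega),
        pr_BO fr hw (h.sl g.nn_mem) (h'.sl g.l_mem) (by omega)]
      rw [Finset.sum_eq_zero fun i _ => pr_BO fr hw (h.sl (g.mem_Fil_zero.2 (hw i)))
        (h'.sl (g.mem_Fil_zero.2 (hw i))) (by omega)]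
      ring

/-! algebraic boost order -/
lemma BO_kills : ∀ {k : ℕ} {S : Ten n A k}, Kills g.l S → Kills g.nn S → BO g.Fil S 0
  | 0, S, _, _ => fun h => absurd h (lt_irrefl _)
  | k+1, S, hl, hn => by
      refine g.Fil_cases ?_ ?_ ?_ ?_
      · intro w x hx
        obtain ⟨v, hv, e⟩ := g.split x
        rw [e, sl_add, sl_smul, hn.1, smul_zero, zero_add]
        exact (BO_kills (hl.2 v) (hn.2 v)).mono (by omega)
      · intro x hx; exact (BO_kills (hl.2 x) (hn.2 x)).mono (by omega)
      · intro f; rw [sl_smul, hl.1, smul_zero]; exact BO.zero _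
      · intro w _; rw [sl_zero]; exact BO.zero _

variable (g) in
def Z0 : ∀ {k : ℕ}, Ten n A k → Prop
  | 0, R => R ![] = 0
  | _+1, R => ∀ v ∈ g.Fil 0, Z0 (sl R v)

lemma BO_of_Z0 : ∀ {k : ℕ} {S : Ten n A k}, Alt S → Kills g.l S → g.Z0 S → BO g.Fil S (-1)
  | 0, S, _, _, h => fun _ => ten0_ext h
  | k+1, S, hA, hl, hz => by
      refine g.Fil_cases ?_ ?_ ?_ ?_
      · intro w x hx
        obtain ⟨v, hv, e⟩ := g.split x
        rw [e, sl_add, sl_smul]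
        exact (((BO_kills (hl.2 _) hA.kills_sl).smul _).mono (by omega)).add
          ((BO_of_Z0 (hA.sl v) (hl.2 v) (hz v hv)).mono (by omega))
      · intro x hx; exact (BO_of_Z0 (hA.sl x) (hl.2 x) (hz x hx)).mono (by omega)
      · intro f; rw [sl_smul, hl.1, smul_zero]; exact BO.zero _
      · intro w _; rw [sl_zero]; exact BO.zero _

end NGeo

/-- frames at all points -/
structure EGeo (n : ℕ) (A : Type*) [CommRing A] [Algebra ℝ A] extends NGeo n A where
  Y : Type
  ev : Y → A →+* ℝ
  inj : ∀ f : A, (∀ y, ev y f = 0) → f = 0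
  fr : ∀ y, Frame gam l nn (ev y)
  hw : ∀ y i, toGeo.ip l ((fr y).w i) = 0

namespace EGeo
variable {g : EGeo n A}

lemma Z0_of : ∀ {k : ℕ} {S : Ten n A k}, (∀ y, g.Zev (g.ev y) S) → g.Z0 S
  | 0, S, h => g.inj _ h
  | k+1, S, h => fun v hv => Z0_of fun y => h y v hv

lemma eq_zero_of {k : ℕ} {R : Ten n A k} (hl : Kills g.l R) (hn : Kills g.nn R)
    (h : ∀ y, g.ev y (pr g.gam R R) = 0) : R = 0 := by
  funext idx
  exact g.inj _ fun y => NGeo.Zev_kn hn (NGeo.pos_Z (g.fr y) hl (h y)) idx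

/-- the algebraic type N property -/
lemma typeN {q : ℕ} {F : Ten n A (q+1)} (hA : Alt F)
    (hT : ∀ x y, pr g.gam (sl F x) (sl F y) = g.ip g.l x * g.ip g.l y) : BO g.Fil F (-1) := by
  have h0 : sl F g.l = 0 := by
    have hl : Kills g.l (sl F g.l) := hA.kills_sl
    have e1 : pr g.gam (sl F g.l) (sl F g.l) = 0 := by rw [hT, g.null, zero_mul]
    rcases q with _ | k
    · exact eq_zero_of hl trivial fun y => by rw [e1, map_zero]
    · have hz : ∀ y, g.Zev (g.ev y) (sl F g.l) := fun y => NGeo.pos_Z (g.fr y) hl (by rw [e1, map_zero])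
      have hAl := hA.sl g.l
      have h1 : sl (sl F g.l) g.nn = 0 := by
        refine eq_zero_of (hl.2 _) hAl.kills_sl fun y => ?_
        have e2 := NGeo.lemX (g.fr y) (g.hw y) hAl hl (hz y) (hA.sl g.nn)
        rw [hT, g.null, zero_mul, map_zero, hA.1 g.nn g.l, pr_neg_right, map_neg] at e2
        have : ((k:ℝ)+1) ≠ 0 := by positivity
        have e3 : ((k:ℝ)+1) * g.ev y (pr g.gam (sl (sl F g.l) g.nn) (sl (sl F g.l) g.nn)) = 0 := by linarith
        exact (mul_eq_zero.1 e3).resolve_left this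
      exact eq_zero_of hl (hAl.kills h1) fun y => by rw [e1, map_zero]
  have hk := hA.kills h0
  refine NGeo.BO_of_Z0 hA hk (Z0_of fun y v hv => NGeo.pos_Z (g.fr y) (hk.2 v) ?_)
  rw [hT, g.mem_Fil_zero.1 hv, zero_mul, map_zero]

end EGeo

/-! labels -/
abbrev Lab (n : ℕ) := Fin n ⊕ Bool
/-- boost weight of a label -/
def Lab.wt : Lab n → ℤ
  | .inl _ => 0
  | .inr true => 1
  | .inr false => -1
def Lab.star : Lab n → Lab n
  | .inl i => .inl i
  | .inr b => .inr (!b)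
/-- order of the derivative along a label -/
def Lab.b : Lab n → ℤ
  | .inl _ => -1
  | .inr true => -1
  | .inr false => 0
lemma Lab.wt_star (t : Lab n) : t.star.wt = - t.wt := by
  rcases t with i | (_ | _) <;> simp [wt, star]
lemma Lab.star_star (t : Lab n) : t.star.star = t := by
  rcases t with i | (_ | _) <;> simp [star]
lemma Lab.b_wt (t : Lab n) : t.b + t.wt ≤ 0 := by
  rcases t with i | (_ | _) <;> simp [wt, b]
lemma Lab.b_wt_lt {t : Lab n} (h : t ≠ .inr true) : t.b + t.wt ≤ -1 := by
  rcases t with i | (_ | _) <;> simp_all [wt, b]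

namespace EGeo
variable (g : EGeo n A)
def vec (y : g.Y) : Lab n → Vec n A
  | .inl i => (g.fr y).w i
  | .inr true => g.l
  | .inr false => g.nn
lemma vec_mem (y : g.Y) (t : Lab n) : g.vec y t ∈ g.Fil t.wt := by
  rcases t with i | (_ | _)
  · exact g.mem_Fil_zero.2 (g.hw y i)
  · exact g.nn_mem
  · exact g.l_mem
lemma pr_lab (y : g.Y) {k : ℕ} (S S' : Ten n A (k+1)) :
    g.ev y (pr g.gam S S') = ∑ t : Lab n, g.ev y (pr g.gam (sl S (g.vec y t)) (sl S' (g.vec y t.star))) := by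
  rw [pr_frame (g.fr y), Fintype.sum_sum_type, add_comm]
  simp only [Fintype.sum_bool]; rfl
lemma pr_BO (y : g.Y) {k : ℕ} {S S' : Ten n A k} {s s' : ℤ} (h : BO g.Fil S s) (h' : BO g.Fil S' s')
    (hs : s + s' < 0) : g.ev y (pr g.gam S S') = 0 := NGeo.pr_BO (g.fr y) (g.hw y) h h' hs
lemma ev_lin (y : g.Y) (φ : Vec n A →ₗ[A] A) (x : Vec n A) : g.ev y (φ x) = g.ev y (g.ip x g.nn) * g.ev y (φ g.l)
    + g.ev y (g.ip g.l x) * g.ev y (φ g.nn) + ∑ i, g.ev y (g.ip x ((g.fr y).w i)) * g.ev y (φ ((g.fr y).w i)) :=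
  NGeo.ev_lin (g.fr y) φ x
/-- contraction in the frame -/
lemma ev_gam (y : g.Y) (f : Vec n A →ₗ[A] Vec n A →ₗ[A] A) :
    g.ev y (∑ c, ∑ d, g.gam c d * f (bs c) (bs d)) = ∑ t : Lab n, g.ev y (f (g.vec y t) (g.vec y t.star)) := by
  have e : ∀ x u, f x u = ∑ c, ∑ d, x c * u d * f (bs c) (bs d) := by
    intro x u
    rw [lin_expand f x, LinearMap.sum_apply]
    refine Finset.sum_congr rfl fun c _ => ?_
    rw [LinearMap.smul_apply, lin_expand (f (bs c)) u, smul_eq_mul, Finset.mul_sum]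
    refine Finset.sum_congr rfl fun d _ => ?_
    rw [smul_eq_mul, mul_assoc]
  rw [Fintype.sum_sum_type, add_comm]
  simp only [Fintype.sum_bool, vec, Lab.star, Bool.not_true, Bool.not_false]
  rw [e g.l g.nn, e g.nn g.l]
  simp only [e ((g.fr y).w _)]
  simp only [map_sum, map_mul, (g.fr y).eq, add_mul, Finset.sum_add_distrib, Finset.sum_mul]
  congr 1
  symm
  rw [Finset.sum_comm]
  refine Finset.sum_congr rfl fun a _ => ?_
  rw [Finset.sum_comm]
end EGeo

end geo6

set_option linter.unusedSectionVars false
set_option linter.unusedSimpArgs false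
set_option linter.unusedVariables false
section geo7
variable {A : Type*} [CommRing A] [Algebra ℝ A] {n : ℕ}

/-! alternating slices and permuted tensors -/
def Alt1 {k : ℕ} (S : Ten n A (k+1)) : Prop := ∀ x, Alt (sl S x)
def Alt2 {k : ℕ} (S : Ten n A (k+2)) : Prop := ∀ x, Alt1 (sl S x)
def Alt3 {k : ℕ} (S : Ten n A (k+3)) : Prop := ∀ x, Alt2 (sl S x)
lemma Alt1.act (O : Op n A) {k : ℕ} {S : Ten n A (k+1)} (h : Alt1 S) : Alt1 (act O S) := fun x => by
  rw [sl_act]; exact ((h x).act O).sub (h _)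
lemma Alt1.sub {k : ℕ} {S S' : Ten n A (k+1)} (h : Alt1 S) (h' : Alt1 S') : Alt1 (S - S') := fun x => by
  rw [sl_sub_left]; exact (h x).sub (h' x)
lemma Alt2.act (O : Op n A) {k : ℕ} {S : Ten n A (k+2)} (h : Alt2 S) : Alt2 (act O S) := fun x => by
  rw [sl_act]; exact ((h x).act O).sub (h _)
lemma Alt.cov (g : Geo n A) {k : ℕ} {S : Ten n A k} (h : Alt S) : Alt1 (g.cov S) := fun x => by
  rw [g.sl_cov]; exact h.act _
lemma Alt1.cov (g : Geo n A) {k : ℕ} {S : Ten n A (k+1)} (h : Alt1 S) : Alt2 (g.cov S) := fun x => by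
  rw [g.sl_cov]; exact h.act _
lemma Alt2.cov (g : Geo n A) {k : ℕ} {S : Ten n A (k+2)} (h : Alt2 S) : Alt3 (g.cov S) := fun x => by
  rw [g.sl_cov]; exact h.act _

/-- contraction of the first two slots -/
def ctr (γ : Fin n → Fin n → A) {k : ℕ} (S : Ten n A (k+2)) : Ten n A k :=
  fun idx => ∑ c, ∑ d, γ c d * sl (sl S (bs c)) (bs d) idx
lemma sl_ctr (γ : Fin n → Fin n → A) {k : ℕ} (S : Ten n A (k+3)) (x : Vec n A) (idx) :
    sl (ctr γ S) x idx = ∑ c, ∑ d, γ c d * sl (sl (sl S (bs c)) (bs d)) x idx := by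
  simp only [ctr, sl, Finset.mul_sum]
  rw [Finset.sum_comm]
  refine Finset.sum_congr rfl fun c _ => ?_
  rw [Finset.sum_comm]
  refine Finset.sum_congr rfl fun d _ => Finset.sum_congr rfl fun e _ => ?_
  refine Finset.sum_congr rfl fun _ _ => Finset.sum_congr rfl fun _ _ => ?_
  ring

lemma sum_lab {R : Type*} [AddCommMonoid R] (f : Lab n → R) :
    ∑ t, f t = f (.inr true) + f (.inr false) + ∑ i, f (.inl i) := by
  rw [Fintype.sum_sum_type, add_comm, Fintype.sum_bool]

lemma sum_surv (f : Lab n → Lab n → ℝ) (h : ∀ t s, t ≠ .inr true ∨ s.star ≠ .inr true → f t s = 0) :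
    ∑ t, ∑ s, f t s = f (.inr true) (.inr false) := by
  rw [Finset.sum_eq_single (.inr true), Finset.sum_eq_single (.inr false)]
  · intro s _ hs
    refine h _ _ (Or.inr fun e => hs ?_)
    have := congrArg Lab.star e
    rw [Lab.star_star] at this
    exact this
  · simp
  · intro t _ ht
    exact Finset.sum_eq_zero fun s _ => h _ _ (Or.inl ht)
  · simp

namespace EGeo
variable {g : EGeo n A}

variable (g) in
def kT : Ten n A 1 := sl g.gT g.l
lemma ev1_kT (u : Vec n A) : ev1 g.kT u = g.ip g.l u := rfl
lemma ev1_kx (x u : Vec n A) : ev1 (act (g.nab x) g.kT) u = g.ip (g.Nx x) u := by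
  rw [ev1_act, ev1_kT, ev1_kT]
  have := g.dv_ip x g.l u
  change g.dv x _ - _ = _
  rw [this]
  change _ = g.ip ((g.nab x).D g.l) u
  ring

lemma pr1 (S S' : Ten n A 1) (x y : Vec n A) : pr g.gam (sl S x) (sl S' y) = ev1 S x * ev1 S' y := rfl

lemma pr_lab1 (y : g.Y) (S : Ten n A 1) : g.ev y (pr g.gam S S) =
    ∑ t : Lab n, g.ev y (ev1 S (g.vec y t)) * g.ev y (ev1 S (g.vec y t.star)) := by
  rw [g.pr_lab]; refine Finset.sum_congr rfl fun t _ => ?_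
  rw [pr1, map_mul]
lemma pr_lab2 (y : g.Y) (S : Ten n A 2) : g.ev y (pr g.gam S S) =
    ∑ t : Lab n, ∑ s : Lab n, g.ev y (ev2 S (g.vec y t) (g.vec y s)) * g.ev y (ev2 S (g.vec y t.star) (g.vec y s.star)) := by
  rw [g.pr_lab]; refine Finset.sum_congr rfl fun t _ => ?_
  rw [g.pr_lab]; refine Finset.sum_congr rfl fun t _ => ?_
  rw [pr1, map_mul]; rfl

lemma ctr_lab (y : g.Y) {k : ℕ} (S : Ten n A (k+2)) (idx) : g.ev y (ctr g.gam S idx) =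
    ∑ t : Lab n, g.ev y (sl (sl S (g.vec y t)) (g.vec y t.star) idx) :=
  g.ev_gam y (LinearMap.mk₂ A (fun x u => sl (sl S x) u idx)
    (fun x x' u => by rw [sl_add, sl_add_left]; rfl) (fun f x u => by rw [sl_smul, sl_smul_left]; rfl)
    (fun x u u' => by rw [sl_add]; rfl) (fun f x u => by rw [sl_smul]; rfl))

lemma ev1_ctr_lab (y : g.Y) (S : Ten n A 3) (x : Vec n A) : g.ev y (ev1 (ctr g.gam S) x) =
    ∑ t : Lab n, g.ev y (ev3 S (g.vec y t) (g.vec y t.star) x) := by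
  rw [ev1, sl_ctr]
  exact g.ev_gam y (LinearMap.mk₂ A (fun z u => sl (sl (sl S z) u) x ![])
    (fun x x' u => by rw [sl_add, sl_add_left, sl_add_left]; rfl) (fun f x u => by rw [sl_smul, sl_smul_left, sl_smul_left]; rfl)
    (fun x u u' => by rw [sl_add, sl_add_left]; rfl) (fun f x u => by rw [sl_smul, sl_smul_left]; rfl))
lemma sl_ctr' (γ : Fin n → Fin n → A) {k : ℕ} (S : Ten n A (k+3)) (x : Vec n A) :
    sl (ctr γ S) x = fun idx => ∑ c, ∑ d, γ c d * sl (sl (sl S (bs c)) (bs d)) x idx :=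
  funext fun idx => sl_ctr γ S x idx
lemma ev2_ctr_lab (y : g.Y) (S : Ten n A 4) (x x' : Vec n A) : g.ev y (ev2 (ctr g.gam S) x x') =
    ∑ t : Lab n, g.ev y (ev2 (sl (sl S (g.vec y t)) (g.vec y t.star)) x x') := by
  have e : ev2 (ctr g.gam S) x x' = ∑ c, ∑ d, g.gam c d * ev2 (sl (sl S (bs c)) (bs d)) x x' := by
    simp only [ev2]
    rw [sl_ctr']
    simp only [sl, Finset.mul_sum]
    rw [Finset.sum_comm]
    refine Finset.sum_congr rfl fun c _ => ?_
    rw [Finset.sum_comm]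
    refine Finset.sum_congr rfl fun d _ => Finset.sum_congr rfl fun _ _ => ?_
    refine Finset.sum_congr rfl fun _ _ => Finset.sum_congr rfl fun _ _ => Finset.sum_congr rfl fun _ _ => ?_
    ring
  rw [e]
  exact g.ev_gam y (LinearMap.mk₂ A (fun z u => ev2 (sl (sl S z) u) x x')
    (fun x x' u => by simp only [ev2, sl_add, sl_add_left]; rfl)
    (fun f x u => by simp only [ev2, sl_smul, sl_smul_left]; rfl)
    (fun x u u' => by simp only [ev2, sl_add, sl_add_left]; rfl)
    (fun f x u => by simp only [ev2, sl_smul, sl_smul_left]; rfl))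

lemma ip_l_inl (y : g.Y) (i : Fin n) : g.ip g.l (g.vec y (.inl i)) = 0 := g.hw y i

lemma TT_eq {q : ℕ} {F : Ten n A (q+1)}
    (hT : ∀ x y, pr g.gam (sl F x) (sl F y) = g.ip g.l x * g.ip g.l y) : TT g.gam F F = TT g.gam g.kT g.kT :=
  ten2_ext fun u v => by rw [ev2_TT, ev2_TT, hT, pr1]; rfl

lemma ev2_add (P Q : Ten n A 2) (u v : Vec n A) : ev2 (P + Q) u v = ev2 P u v + ev2 Q u v := by
  simp [ev2, sl_add_left]

/-- step I1a -/
lemma stepA (h : pr g.gam (ctr g.gam (g.cov (TT g.gam g.kT g.kT))) (ctr g.gam (g.cov (TT g.gam g.kT g.kT))) = 0)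
    (y : g.Y) (i : Fin n) : g.ev y (g.ip (g.Nx g.l) ((g.fr y).w i)) = 0 := by
  have e3 : ∀ x u v, ev3 (g.cov (TT g.gam g.kT g.kT)) x u v = g.ip (g.Nx x) u * g.ip g.l v + g.ip g.l u * g.ip (g.Nx x) v := by
    intro x u v
    change ev2 (sl (g.cov _) x) u v = _
    rw [g.sl_cov, g.act_TT, ev2_add, ev2_TT, ev2_TT, pr1, pr1, ev1_kx, ev1_kx, ev1_kT, ev1_kT]
  have e1 : ∀ v, g.ev y (ev1 (ctr g.gam (g.cov (TT g.gam g.kT g.kT))) v) =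
      (∑ t, g.ev y (g.ip (g.Nx (g.vec y t)) (g.vec y t.star))) * g.ev y (g.ip g.l v) + g.ev y (g.ip (g.Nx g.l) v) := by
    intro v
    rw [ev1_ctr_lab]
    simp only [e3, map_add, map_mul, Finset.sum_add_distrib, ← Finset.sum_mul]
    congr 1
    rw [sum_lab]
    have h1 : g.ip g.l (g.vec y (Lab.star (.inr true))) = 1 := g.norm
    have h2 : g.ip g.l (g.vec y (Lab.star (.inr false))) = 0 := g.null
    have h3 : ∀ i, g.ip g.l (g.vec y (Lab.star (.inl i))) = 0 := g.hw y
    rw [h1, h2]; simp only [h3]; simp [vec]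
  have h0 := congrArg (g.ev y) h
  rw [pr_lab1, map_zero, sum_lab] at h0
  have hl : g.ev y (ev1 (ctr g.gam (g.cov (TT g.gam g.kT g.kT))) (g.vec y (.inr true))) = 0 := by
    rw [e1]
    change _ * g.ev y (g.ip g.l g.l) + g.ev y (g.ip ((g.nab g.l).D g.l) g.l) = 0
    rw [g.null, g.ip_nab_l]; simp
  have hl' : g.ev y (ev1 (ctr g.gam (g.cov (TT g.gam g.kT g.kT))) (g.vec y (Lab.star (.inr false)))) = 0 := hl
  rw [hl, hl', zero_mul, mul_zero, zero_add, zero_add] at h0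
  simp only [Lab.star] at h0
  rw [Finset.sum_eq_zero_iff_of_nonneg (fun i _ => mul_self_nonneg _)] at h0
  have h1 := mul_self_eq_zero.1 (h0 i (Finset.mem_univ _))
  rw [e1, ip_l_inl, map_zero, mul_zero, zero_add] at h1
  exact h1

/-- step I1b -/
lemma stepB (h : pr g.gam (ctr g.gam (g.cov (g.cov (TT g.gam g.kT g.kT)))) (ctr g.gam (g.cov (g.cov (TT g.gam g.kT g.kT)))) = 0)
    (hA : ∀ (y : g.Y) (i : Fin n), g.ev y (g.ip (g.Nx g.l) ((g.fr y).w i)) = 0) : g.WK := by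
  set B := ctr g.gam (g.cov (g.cov (TT g.gam g.kT g.kT))) with hB
  have main : ∀ (y : g.Y) (i j : Fin n), g.ev y (g.ip (g.Nx ((g.fr y).w j)) ((g.fr y).w i)) = 0 := by
    intro y i j
    obtain ⟨a, ha⟩ : ∃ a : Vec n A → Vec n A → Vec n A → A, ∀ x x' u, a x x' u =
      ev1 (sl (sl (g.cov (g.cov g.kT)) x) x') u := ⟨_, fun _ _ _ => rfl⟩
    have e : ∀ u v, g.ev y (ev2 B u v) = ∑ t : Lab n, g.ev y (
        a (g.vec y t) (g.vec y t.star) u * g.ip g.l v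
        + g.ip (g.Nx (g.vec y t.star)) u * g.ip (g.Nx (g.vec y t)) v
        + (g.ip (g.Nx (g.vec y t)) u * g.ip (g.Nx (g.vec y t.star)) v + g.ip g.l u * a (g.vec y t) (g.vec y t.star) v)) := by
      intro u v
      rw [hB, ev2_ctr_lab]
      refine Finset.sum_congr rfl fun t _ => ?_
      rw [g.jet2]
      simp only [ev2_add, ev2_TT, pr1, g.sl_cov _ _, ev1_kx, ev1_kT, ha]
    have hN : ∀ x, g.ip (g.Nx x) g.l = 0 := fun x => g.ip_nab_l x
    have sym : ∀ u v, g.ev y (ev2 B u v) = g.ev y (ev2 B v u) := by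
      intro u v
      rw [e, e]
      refine Finset.sum_congr rfl fun t _ => ?_
      congr 1; ring
    have hll : g.ev y (ev2 B g.l g.l) = 0 := by
      rw [e]; refine Finset.sum_eq_zero fun t _ => ?_
      rw [hN, hN, g.null]; simp
    have hlw : ∀ i, g.ev y (ev2 B g.l ((g.fr y).w i)) = 0 := by
      intro i
      rw [e]; refine Finset.sum_eq_zero fun t _ => ?_
      rw [hN, hN, g.null, g.hw]; simp
    have h0 := congrArg (g.ev y) h
    rw [pr_lab2, map_zero] at h0
    simp only [sum_lab] at h0
    simp only [vec, Lab.star, Bool.not_true, Bool.not_false, hll, hlw, sym g.nn g.l, sym _ g.l, zero_mul, mul_zero,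
      Finset.sum_const_zero, add_zero, zero_add] at h0
    have hii : g.ev y (ev2 B ((g.fr y).w i) ((g.fr y).w i)) = 0 := by
      have hn : ∀ i, 0 ≤ ∑ j, g.ev y (ev2 B ((g.fr y).w i) ((g.fr y).w j)) * g.ev y (ev2 B ((g.fr y).w i) ((g.fr y).w j)) :=
        fun i => Finset.sum_nonneg fun j _ => mul_self_nonneg _
      have h1 : ∑ i, ∑ j, g.ev y (ev2 B ((g.fr y).w i) ((g.fr y).w j)) * g.ev y (ev2 B ((g.fr y).w i) ((g.fr y).w j)) = 0 := by
        refine le_antisymm ?_ (Finset.sum_nonneg fun i _ => hn i)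
        nlinarith [mul_self_nonneg (g.ev y (ev2 B g.l g.nn))]
      rw [Finset.sum_eq_zero_iff_of_nonneg (fun i _ => hn i)] at h1
      have h2 := h1 i (Finset.mem_univ _)
      rw [Finset.sum_eq_zero_iff_of_nonneg (fun i _ => mul_self_nonneg _)] at h2
      exact mul_self_eq_zero.1 (h2 i (Finset.mem_univ _))
    rw [e, sum_lab] at hii
    simp only [vec, Lab.star, Bool.not_true, Bool.not_false, map_add, map_mul, g.hw, hA, map_zero, zero_mul, mul_zero,
      add_zero, zero_add] at hii
    rw [Finset.sum_eq_zero_iff_of_nonneg (fun i _ => add_nonneg (mul_self_nonneg _) (mul_self_nonneg _))] at hii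
    have := hii j (Finset.mem_univ _)
    exact mul_self_eq_zero.1 (by linarith)
  intro x hx
  refine g.dual fun v hv => g.inj _ fun y => ?_
  rw [sub_self] at hv
  have hw : ∀ i, g.ev y (g.ip (g.Nx x) ((g.fr y).w i)) = 0 := by
    intro i
    have := g.ev_lin y ((g.ipL ((g.fr y).w i)).comp g.Nx) x
    simp only [LinearMap.comp_apply] at this
    change g.ev y (g.ip ((g.fr y).w i) (g.Nx x)) = _ * g.ev y (g.ip ((g.fr y).w i) (g.Nx g.l)) + _
      + ∑ j, _ * g.ev y (g.ip ((g.fr y).w i) (g.Nx ((g.fr y).w j))) at this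
    rw [g.ip_symm, this, g.ip_symm ((g.fr y).w i) (g.Nx g.l), hA, g.mem_Fil_zero.1 hx]
    simp only [g.ip_symm ((g.fr y).w i), main]
    simp
  have := g.ev_lin y (g.ipL (g.Nx x)) v
  change g.ev y (g.ip (g.Nx x) v) = _ * g.ev y (g.ip (g.Nx x) g.l) + _
      + ∑ j, _ * g.ev y (g.ip (g.Nx x) ((g.fr y).w j)) at this
  change g.ev y (g.ip (g.Nx x) v) = 0
  rw [this, show g.ip (g.Nx x) g.l = 0 from g.ip_nab_l x, g.mem_Fil_zero.1 hv]
  simp [hw]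

end EGeo
end geo7

set_option linter.unusedSectionVars false
set_option linter.unusedSimpArgs false
set_option linter.unusedVariables false
section geo8
variable {A : Type*} [CommRing A] [Algebra ℝ A] {n : ℕ}

namespace EGeo
variable {g : EGeo n A}

lemma vec_mem0 (y : g.Y) {t : Lab n} (ht : t ≠ .inr false) : g.vec y t ∈ g.Fil 0 := by
  rcases t with i | (_ | _)
  · exact g.mem_Fil_zero.2 (g.hw y i)
  · exact absurd rfl ht
  · exact g.l_mem0

lemma BO_cov_lab (hK : g.WK) {k : ℕ} {S : Ten n A k} {s : ℤ} (h : BO g.Fil S s) (y : g.Y) (t : Lab n) :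
    BO g.Fil (sl (g.cov S) (g.vec y t)) (s + 1 + t.b) := by
  rw [g.sl_cov]
  rcases t with i | (_ | _)
  · exact (hK.BO_nab0 (g.mem_Fil_zero.2 (g.hw y i)) h).mono (by simp [Lab.b])
  · exact (g.BO_nab _ h).mono (by simp [Lab.b])
  · exact (hK.BO_nab0 g.l_mem0 h).mono (by simp [Lab.b])

lemma surv_lt {t s : Lab n} (h : t ≠ .inr true ∨ s.star ≠ .inr true) :
    (t.b + t.wt) + (s.star.b - s.wt) < 0 := by
  have h1 := t.b_wt
  have h2 := s.star.b_wt
  rw [Lab.wt_star] at h2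
  rcases h with h | h
  · have := Lab.b_wt_lt h; omega
  · have := Lab.b_wt_lt h; rw [Lab.wt_star] at this; omega

/-- step I1c -/
lemma stepC {q : ℕ} {F : Ten n A (q+1)} (hA : Alt F)
    (hT : ∀ x y, pr g.gam (sl F x) (sl F y) = g.ip g.l x * g.ip g.l y) (hK : g.WK)
    {D' : Ten n A (q+2)} (hD' : ∀ x y, sl (sl D' x) y = sl (sl (g.cov F) y) x)
    (h : pr g.gam (g.cov F) D' = 0) : act (g.nab g.l) F = 0 := by
  have hF := typeN hA hT
  have h1 : ∀ y, g.ev y (pr g.gam (sl (sl (g.cov F) g.l) g.nn) (sl (sl (g.cov F) g.l) g.nn)) = 0 := by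
    intro y
    have h0 := congrArg (g.ev y) h
    rw [g.pr_lab, map_zero] at h0
    simp only [g.pr_lab y (sl (g.cov F) _), hD'] at h0
    rw [sum_surv] at h0
    · exact h0
    · intro t s hts
      have := surv_lt hts
      refine g.pr_BO y ((BO_cov_lab hK hF y t).sl (g.vec_mem y s)) ((BO_cov_lab hK hF y s.star).sl (g.vec_mem y t.star)) ?_
      rw [Lab.wt_star]; omega
  simp only [g.sl_cov] at h1
  have hRA : Alt (act (g.nab g.l) F) := hA.act _
  have hRB : BO g.Fil (act (g.nab g.l) F) (-1) := hK.BO_nab0 g.l_mem0 hF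
  have hl : Kills g.l (act (g.nab g.l) F) := hRA.kills (NGeo.lemB (hRB.sl' g.l_mem (by norm_num)) (hRA.sl _))
  refine NGeo.lemA hRB (hRA.kills ?_)
  exact eq_zero_of (hl.2 _) hRA.kills_sl h1

lemma smul_F {q : ℕ} {F : Ten n A (q+1)}
    (hT : ∀ x y, pr g.gam (sl F x) (sl F y) = g.ip g.l x * g.ip g.l y) (f f' : A) :
    pr g.gam (sl (f • F) g.nn) (sl (f' • F) g.nn) = f * f' := by
  rw [sl_smul_left, sl_smul_left, pr_smul_left, pr_smul_right, hT, g.norm]; ring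

lemma stepC' {q : ℕ} {F : Ten n A (q+1)} (hA : Alt F)
    (hT : ∀ x y, pr g.gam (sl F x) (sl F y) = g.ip g.l x * g.ip g.l y) (hK : g.WK)
    (h0 : act (g.nab g.l) F = 0) : g.FK ∧ act g.L F = 0 := by
  have hF := typeN hA hT
  have h1 : act (g.nab g.l) (TT g.gam F F) = 0 := by
    rw [g.act_TT, h0]
    refine ten2_ext fun u v => ?_
    rw [ev2_add, ev2_TT, ev2_TT, sl_zero_left, sl_zero_left, pr_zero_left, pr_zero_right]
    simp [ev2, sl_zero_left]
  rw [TT_eq hT, g.act_TT] at h1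
  have h2 : ev2 (TT g.gam (act (g.nab g.l) g.kT) g.kT + TT g.gam g.kT (act (g.nab g.l) g.kT)) g.nn g.nn = 0 := by
    rw [h1]; simp [ev2, sl_zero_left]
  rw [ev2_add, ev2_TT, ev2_TT, pr1, pr1, ev1_kx, ev1_kT, g.norm, mul_one, one_mul] at h2
  have h3 := two_cancel h2
  obtain ⟨f, hf⟩ := g.mem_Fil_one.1 (hK g.l g.l_mem0)
  have hFK : g.FK := by
    refine ⟨hK, ?_⟩
    change g.ip ((g.nab g.l).D g.l) g.nn = 0 at h3
    rw [← hf, g.ip_smul_left, g.norm, mul_one] at h3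
    rw [← hf, h3, zero_smul]
  refine ⟨hFK, ?_⟩
  have h4 := g.act_nab_l F
  rw [h0, NGeo.lemB (hFK.BO_N hF) (hA.act _), add_zero] at h4
  exact h4.symm

lemma H_symm (u v : Vec n A) : ev2 g.HH u v = ev2 g.HH v u := by
  simp only [NGeo.HH, ev2_act]
  have := g.ip_symm
  unfold Geo.ip at this
  rw [this u v, this _ v, this u]; ring
lemma LH_symm (u v : Vec n A) : ev2 (act g.L g.HH) u v = ev2 (act g.L g.HH) v u := by
  rw [ev2_act, ev2_act, H_symm u v, H_symm _ v, H_symm u]; ring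

/-- step I2 -/
lemma stepD {q : ℕ} {F : Ten n A (q+1)} (hA : Alt F)
    (hT : ∀ x y, pr g.gam (sl F x) (sl F y) = g.ip g.l x * g.ip g.l y) (hK : g.FK)
    (hl0 : act (g.nab g.l) F = 0) (hL : act g.L F = 0)
    {Z' : Ten n A (q+3)} (hZ' : ∀ x y z, sl (sl (sl Z' x) y) z = sl (sl (sl (g.cov (g.cov F)) z) y) x)
    (h : pr g.gam (g.cov (g.cov F)) Z' = 0) : BO g.Fil (act g.L g.HH) (-2) := by
  have hF := typeN hA hT
  have hD : BO g.Fil (g.cov F) (-1) := hK.BO_cov hF (by rw [hL]; exact BO.zero _)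
  have hLD : act g.L (g.cov F) = kt (g.CC g.l) F := by rw [g.lie_cov, hL, g.cov_zero, zero_add]
  have hcH : ∀ x ∈ g.Fil 0, BO g.Fil (sl (g.cov g.HH) x) (-1) := fun x hx => by
    rw [g.sl_cov]; exact hK.1.BO_nab0 hx hK.BO_H
  have hC : ∀ v ∈ g.Fil 0, ∀ u ∈ g.Fil 0, g.CC g.l v u ∈ g.Fil 1 := by
    intro v hv u hu
    refine g.dual fun w hw => ?_
    rw [sub_self] at hw
    refine two_cancel ?_
    have := g.C3_formula v u w
    have e : ∀ x ∈ g.Fil 0, ∀ u ∈ g.Fil 0, ∀ v ∈ g.Fil 0, ev3 (g.cov g.HH) x u v = 0 := fun x hx u hu v hv =>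
      NGeo.BO.ev2 (hcH x hx) hu hv (by norm_num)
    rw [e v hv u hu w hw, e u hu v hv w hw, e w hw v hv u hu] at this
    change g.ip _ w + g.ip _ w = _ at this
    simpa using this
  set c : Vec n A → A := fun v => g.ip g.l (g.CC g.l v g.nn) with hc
  have hZ : ∀ v ∈ g.Fil 0, sl (sl (g.cov (g.cov F)) g.l) v = (- c v) • F := by
    intro v hv
    rw [g.sl_cov, g.act_nab_l, hLD, sl_add_left, sl_kt, NGeo.lemE hF hA _ (hC v hv)]
    rw [NGeo.lemB ((hK.BO_N hD).sl' hv (by norm_num)) ((hA.cov g.toGeo).act (endo g.Nx) v), add_zero]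
  have hZl : sl (sl (g.cov (g.cov F)) g.l) g.l = 0 := by
    rw [g.sl_cov, sl_act, g.sl_cov, hl0, act_zero, hK.2, sl_zero, sub_zero]
  have hcl : c g.l = 0 := by
    have h1 := hZ g.l g.l_mem0
    rw [hZl] at h1
    have h2 := smul_F hT (- c g.l) 1
    rw [← h1, sl_zero_left, pr_zero_left] at h2
    simpa using h2.symm
  have hcw : ∀ y i, g.ev y (c ((g.fr y).w i)) = 0 := by
    intro y i
    have h0 := congrArg (g.ev y) h
    rw [g.pr_lab, map_zero] at h0
    simp only [g.pr_lab y (sl (g.cov (g.cov F)) _), g.pr_lab y (sl (sl (g.cov (g.cov F)) _) _), hZ'] at h0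
    have h1 : ∀ t : Lab n, ∑ t1 : Lab n, ∑ t2 : Lab n, g.ev y (pr g.gam
        (sl (sl (sl (g.cov (g.cov F)) (g.vec y t)) (g.vec y t1)) (g.vec y t2))
        (sl (sl (sl (g.cov (g.cov F)) (g.vec y t2.star)) (g.vec y t1.star)) (g.vec y t.star)))
      = ∑ t2 : Lab n, ∑ t1 : Lab n, g.ev y (pr g.gam
        (sl (sl (sl (g.cov (g.cov F)) (g.vec y t)) (g.vec y t1)) (g.vec y t2))
        (sl (sl (sl (g.cov (g.cov F)) (g.vec y t2.star)) (g.vec y t1.star)) (g.vec y t.star))) :=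
      fun t => Finset.sum_comm
    simp only [h1] at h0
    rw [sum_surv] at h0
    · rw [sum_lab] at h0
      simp only [vec, Lab.star, Bool.not_true, Bool.not_false, hZl, sl_zero_left, pr_zero_left, pr_zero_right,
        map_zero, zero_add, add_zero, hZ _ (g.mem_Fil_zero.2 (g.hw y _)), smul_F hT, map_mul] at h0
      rw [Finset.sum_eq_zero_iff_of_nonneg (fun i _ => mul_self_nonneg _)] at h0
      have := mul_self_eq_zero.1 (h0 i (Finset.mem_univ _))
      rwa [map_neg, neg_eq_zero] at this
    · intro t s hts
      have := surv_lt hts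
      refine Finset.sum_eq_zero fun t1 _ => ?_
      refine g.pr_BO y (((BO_cov_lab hK.1 hD y t).sl (g.vec_mem y t1)).sl (g.vec_mem y s))
        (((BO_cov_lab hK.1 hD y s.star).sl (g.vec_mem y t1.star)).sl (g.vec_mem y t.star)) ?_
      rw [Lab.wt_star, Lab.wt_star]; omega
  have hc0 : ∀ v ∈ g.Fil 0, c v = 0 := by
    intro v hv
    refine g.inj _ fun y => ?_
    have := g.ev_lin y ((g.ipL g.l).comp ((g.CC g.l).flip g.nn)) v
    change g.ev y (c v) = _ * g.ev y (c g.l) + _ + ∑ j, _ * g.ev y (c ((g.fr y).w j)) at this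
    rw [this, hcl, g.mem_Fil_zero.1 hv]
    simp [hcw]
  have hLn : ∀ v ∈ g.Fil 0, ev2 (act g.L g.HH) v g.nn = 0 := by
    intro v hv
    have h1 := g.C3_formula v g.nn g.l
    have e1 : NGeo.qk g.gT (g.CC g.l) v g.nn g.l = 0 := by
      change g.ip _ _ = 0
      rw [g.ip_symm]; exact hc0 v hv
    have e2 : ev3 (g.cov g.HH) v g.nn g.l = 0 := NGeo.BO.ev2 (hcH v hv) g.nn_mem g.l_mem (by norm_num)
    have e3 : ev3 (g.cov g.HH) g.nn v g.l = 0 := by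
      refine NGeo.BO.ev2 (s := 0) ?_ hv g.l_mem (by norm_num)
      rw [g.sl_cov]; exact g.BO_nab _ hK.BO_H
    rw [e1, e2, e3] at h1
    have h2 : ev2 (act (g.nab g.l) g.HH) v g.nn = 0 := by
      have : ev2 (sl (g.cov g.HH) g.l) v g.nn = 0 := by
        change ev3 (g.cov g.HH) g.l v g.nn = 0
        simpa using h1
      rwa [g.sl_cov] at this
    rw [g.act_nab_l, ev2_add, NGeo.BO.ev2 (hK.BO_N hK.BO_H) hv g.nn_mem (by norm_num), add_zero] at h2
    exact h2
  have hL0 : ∀ v ∈ g.Fil 0, ∀ x, ev2 (act g.L g.HH) v x = 0 := by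
    intro v hv x
    obtain ⟨u, hu, e⟩ := g.split x
    rw [e, ev2_add_right, ev2_smul_right, hLn v hv, mul_zero, zero_add]
    exact NGeo.BO.ev2 (hK.BO_L hK.BO_H) hv hu (by norm_num)
  intro a u hu b v hv hs
  refine ten0_ext ?_
  change ev2 _ u v = 0
  by_cases ha : 0 ≤ a
  · exact hL0 u (g.Fil_anti ha hu) v
  · rw [LH_symm]
    exact hL0 v (g.Fil_anti (by omega) hv) u

/-- step I3 -/
lemma stepE {q : ℕ} {F : Ten n A (q+1)} (hA : Alt F)
    (hT : ∀ x y, pr g.gam (sl F x) (sl F y) = g.ip g.l x * g.ip g.l y) (hK : g.FK)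
    (hL : act g.L F = 0) (hLH : BO g.Fil (act g.L g.HH) (-2))
    {W' : Ten n A (q+4)} (hW' : ∀ x y z w, sl (sl (sl (sl W' x) y) z) w = sl (sl (sl (sl (g.cov (g.cov (g.cov F))) z) w) x) y)
    (h : pr g.gam (g.cov (g.cov (g.cov F))) W' = 0) : act g.L (act g.L g.HH) = 0 := by
  have hF := typeN hA hT
  have hD : BO g.Fil (g.cov F) (-1) := hK.BO_cov hF (by rw [hL]; exact BO.zero _)
  have hLD : act g.L (g.cov F) = kt (g.CC g.l) F := by rw [g.lie_cov, hL, g.cov_zero, zero_add]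
  have hcH : BO g.Fil (g.cov g.HH) (-1) := hK.BO_cov hK.BO_H hLH
  have hC : g.BOK (g.CC g.l) (-1) := NGeo.BTK_CC (j := 0) hK.BO_H hcH
  have hCF : BO g.Fil (kt (g.CC g.l) F) (-2) := hC.kt hF
  have hZ : BO g.Fil (g.cov (g.cov F)) (-1) := hK.BO_cov hD (by rw [hLD]; exact hCF)
  have hLZ : act g.L (g.cov (g.cov F)) = g.cov (kt (g.CC g.l) F) + kt (g.CC g.l) (g.cov F) := by
    rw [g.lie_cov, hLD]
  have hW : sl (g.cov (g.cov (g.cov F))) g.l = g.cov (kt (g.CC g.l) F) +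
      (kt (g.CC g.l) (g.cov F) + act (endo g.Nx) (g.cov (g.cov F))) := by
    rw [g.sl_cov, g.act_nab_l, hLZ]
    exact add_assoc _ _ _
  have hR : BO g.Fil (kt (g.CC g.l) (g.cov F) + act (endo g.Nx) (g.cov (g.cov F))) (-2) :=
    (hC.kt hD).add (hK.BO_N hZ)
  have hW1 : ∀ y (t : Lab n), BO g.Fil (sl (sl (g.cov (g.cov (g.cov F))) g.l) (g.vec y t)) (t.b - 1) := by
    intro y t
    rw [hW, sl_add_left]
    refine ((BO_cov_lab hK.1 hCF y t).mono (by omega)).add ((hR.sl (g.vec_mem y t)).mono ?_)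
    rcases t with i | (_ | _) <;> simp [Lab.wt, Lab.b]
  set B := opK g.L (g.CC g.l) with hB
  set Y := act g.L (g.cov g.HH) with hY
  have hY' : Y = g.cov (act g.L g.HH) + kt (g.CC g.l) g.HH := g.lie_cov _ _
  have hCH : BO g.Fil (kt (g.CC g.l) g.HH) (-2) := hC.kt hK.BO_H
  have ev3_add : ∀ (P Q : Ten n A 3) x u v, ev3 (P + Q) x u v = ev3 P x u v + ev3 Q x u v := by
    intro P Q x u v; simp [ev3, sl_add_left]
  have hBf : ∀ x u v, (NGeo.qk g.gT B x u v + NGeo.qk g.HH (g.CC g.l) x u v) + (NGeo.qk g.gT B x u v + NGeo.qk g.HH (g.CC g.l) x u v)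
      = (ev3 Y x u v + ev3 Y u x v) + (- ev3 Y v x u) := by
    intro x u v
    have h1 := congrFun (congrFun (congrFun (g.L3_qk g.gT (g.CC g.l)) x) u) v
    have h2 : NGeo.qk (act g.L g.gT) (g.CC g.l) x u v + NGeo.qk g.gT B x u v = g.L3 (NGeo.qk g.gT (g.CC g.l)) x u v := h1.symm
    have h3 : NGeo.qk (act g.L g.gT) (g.CC g.l) x u v = NGeo.qk g.HH (g.CC g.l) x u v := rfl
    rw [add_comm (NGeo.qk g.gT B x u v), ← h3, h2]
    have e : ∀ x u v, ev3 Y x u v = g.L3 (ev3 (g.cov g.HH)) x u v := by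
      intro x u v; rw [hY, ev3_act]; rfl
    rw [e, e, e]
    simp only [NGeo.L3]
    have := fun x u v => g.C3_formula x u v
    have hd := congrArg g.L.d (this x u v)
    simp only [map_add, map_neg] at hd
    linear_combination hd - this (g.L.D x) u v - this x (g.L.D u) v - this x u (g.L.D v)
  have covn : BO g.Fil (sl (g.cov (act g.L g.HH)) g.nn) (-1) := by rw [g.sl_cov]; exact g.BO_nab _ hLH
  have cov0 : ∀ u ∈ g.Fil 0, BO g.Fil (sl (g.cov (act g.L g.HH)) u) (-2) := fun u hu => by
    rw [g.sl_cov]; exact hK.1.BO_nab0 hu hLH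
  have hB0 : ∀ u ∈ g.Fil 0, B g.nn u ∈ g.Fil 1 := by
    intro u hu
    refine g.dual fun v hv => ?_
    rw [sub_self] at hv
    have e1 : NGeo.qk g.HH (g.CC g.l) g.nn u v = 0 :=
      NGeo.BO.ev2 hK.BO_H (hC (-1) 0 _ _ g.nn_mem hu) hv (by norm_num)
    have := hBf g.nn u v
    rw [e1, hY', ev3_add, ev3_add, ev3_add,
      NGeo.BO3_ev3 hCH (-1) 0 0 _ _ _ g.nn_mem hu hv (by norm_num),
      NGeo.BO3_ev3 hCH 0 (-1) 0 _ _ _ hu g.nn_mem hv (by norm_num),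
      NGeo.BO3_ev3 hCH 0 (-1) 0 _ _ _ hv g.nn_mem hu (by norm_num),
      show ev3 (g.cov (act g.L g.HH)) g.nn u v = 0 from NGeo.BO.ev2 covn hu hv (by norm_num),
      show ev3 (g.cov (act g.L g.HH)) u g.nn v = 0 from NGeo.BO.ev2 (cov0 u hu) g.nn_mem hv (by norm_num),
      show ev3 (g.cov (act g.L g.HH)) v g.nn u = 0 from NGeo.BO.ev2 (cov0 v hv) g.nn_mem hu (by norm_num)] at this
    refine two_cancel (?_ : NGeo.qk g.gT B g.nn u v + NGeo.qk g.gT B g.nn u v = 0)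
    simpa using this
  set b := g.ip g.l (B g.nn g.nn) with hb
  have hA3 : Alt3 (g.cov (g.cov (g.cov F))) := ((hA.cov g.toGeo).cov g.toGeo).cov g.toGeo
  have hWn : sl (sl (sl (g.cov (g.cov (g.cov F))) g.l) g.l) g.nn = (- b) • F := by
    rw [← sub_eq_zero]
    refine NGeo.lemB (g := g.toNGeo) ?_ ((hA3 _ _ _).sub (hA.smul _))
    have e : sl (sl (sl (g.cov (g.cov (g.cov F))) g.l) g.l) g.nn - (-b) • F =
        sl (act (endo g.Nx) (kt (g.CC g.l) F)) g.nn
        + sl (sl (kt (g.CC g.l) (g.cov F) + act (endo g.Nx) (g.cov (g.cov F))) g.l) g.nn := by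
      have e1 : act g.L (kt (g.CC g.l) F) = kt B F := by
        rw [act_kt, hL]
        have : kt (g.CC g.l) (0 : Ten n A (q+1)) = 0 := ten_ext fun x => by rw [sl_kt, act_zero, sl_zero_left]
        rw [this, add_zero]
      rw [hW, sl_add_left, sl_add_left, g.sl_cov, g.act_nab_l, e1, sl_add_left, sl_kt, NGeo.lemE hF hA _ hB0]
      abel
    rw [e]
    exact ((hK.BO_N hCF).sl' g.nn_mem (by norm_num)).add ((hR.sl g.l_mem).sl' g.nn_mem (by norm_num))
  have hb0 : b = 0 := by
    refine g.inj _ fun y => ?_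
    have h0 := congrArg (g.ev y) h
    rw [g.pr_lab, map_zero] at h0
    simp only [g.pr_lab y (sl (g.cov (g.cov (g.cov F))) _), g.pr_lab y (sl (sl (g.cov (g.cov (g.cov F))) _) _),
      g.pr_lab y (sl (sl (sl (g.cov (g.cov (g.cov F))) _) _) _), hW'] at h0
    have h1 : ∀ t : Lab n, ∑ t1 : Lab n, ∑ t2 : Lab n, ∑ t3 : Lab n, g.ev y (pr g.gam
        (sl (sl (sl (sl (g.cov (g.cov (g.cov F))) (g.vec y t)) (g.vec y t1)) (g.vec y t2)) (g.vec y t3))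
        (sl (sl (sl (sl (g.cov (g.cov (g.cov F))) (g.vec y t2.star)) (g.vec y t3.star)) (g.vec y t.star)) (g.vec y t1.star)))
      = ∑ t2 : Lab n, ∑ t1 : Lab n, ∑ t3 : Lab n, g.ev y (pr g.gam
        (sl (sl (sl (sl (g.cov (g.cov (g.cov F))) (g.vec y t)) (g.vec y t1)) (g.vec y t2)) (g.vec y t3))
        (sl (sl (sl (sl (g.cov (g.cov (g.cov F))) (g.vec y t2.star)) (g.vec y t3.star)) (g.vec y t.star)) (g.vec y t1.star))) :=
      fun t => Finset.sum_comm
    simp only [h1] at h0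
    rw [sum_surv, sum_surv] at h0
    · simp only [vec, Lab.star, Bool.not_true, Bool.not_false] at h0
      rw [hWn, smul_F hT, map_mul] at h0
      have := mul_self_eq_zero.1 h0
      rwa [map_neg, neg_eq_zero] at this
    · intro t s hts
      have := surv_lt hts
      refine g.pr_BO y (((hW1 y t).sl g.nn_mem).sl (g.vec_mem y s))
        (((hW1 y s.star).sl g.nn_mem).sl (g.vec_mem y t.star)) ?_
      rw [Lab.wt_star]; omega
    · intro t s hts
      have := surv_lt hts
      refine Finset.sum_eq_zero fun t1 _ => Finset.sum_eq_zero fun t3 _ => ?_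
      refine g.pr_BO y ((((BO_cov_lab hK.1 hZ y t).sl (g.vec_mem y t1)).sl (g.vec_mem y s)).sl (g.vec_mem y t3))
        ((((BO_cov_lab hK.1 hZ y s.star).sl (g.vec_mem y t3.star)).sl (g.vec_mem y t.star)).sl (g.vec_mem y t1.star)) ?_
      rw [Lab.wt_star, Lab.wt_star, Lab.wt_star]; omega
  have hnn : ev2 (act g.L (act g.L g.HH)) g.nn g.nn = 0 := by
    have h1 := hBf g.nn g.nn g.l
    have e0 : NGeo.qk g.gT B g.nn g.nn g.l = 0 := by
      change g.ip _ _ = 0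
      rw [g.ip_symm]; exact hb0
    have e1 : NGeo.qk g.HH (g.CC g.l) g.nn g.nn g.l = 0 :=
      NGeo.BO.ev2 hK.BO_H (g.mem_Fil_neg (w := -1) le_rfl _) g.l_mem (by norm_num)
    rw [e0, e1, hY', ev3_add, ev3_add,
      NGeo.BO3_ev3 hCH (-1) (-1) 1 _ _ _ g.nn_mem g.nn_mem g.l_mem (by norm_num),
      NGeo.BO3_ev3 hCH 1 (-1) (-1) _ _ _ g.l_mem g.nn_mem g.nn_mem (by norm_num),
      show ev3 (g.cov (act g.L g.HH)) g.nn g.nn g.l = 0 from NGeo.BO.ev2 covn g.nn_mem g.l_mem (by norm_num)] at h1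
    have h2 : ev2 (act (g.nab g.l) (act g.L g.HH)) g.nn g.nn = 0 := by
      have : ev2 (sl (g.cov (act g.L g.HH)) g.l) g.nn g.nn = 0 := by
        change ev3 (g.cov (act g.L g.HH)) g.l g.nn g.nn = 0
        simpa using h1
      rwa [g.sl_cov] at this
    rw [g.act_nab_l, ev2_add, NGeo.BO.ev2 (hK.BO_N hLH) g.nn_mem g.nn_mem (by norm_num), add_zero] at h2
    exact h2
  have hBO := hK.BO_L hLH
  refine ten2_ext fun u v => ?_
  obtain ⟨u', hu, eu⟩ := g.split u
  obtain ⟨v', hv, ev⟩ := g.split v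
  rw [eu, ev, ev2_add_right, ev2_add_left, ev2_smul_left, ev2_smul_right, hnn,
    NGeo.BO.ev2 hBO hu (g.mem_Fil_neg (w := -1) le_rfl _) (by norm_num),
    NGeo.BO.ev2 hBO (g.mem_Fil_neg (w := -1) le_rfl _) hv (by norm_num)]
  simp [ev2, sl_zero_left]

/-- the main abstract statement -/
theorem main {q : ℕ} {F : Ten n A (q+1)} (hA : Alt F)
    (hT : ∀ x y, pr g.gam (sl F x) (sl F y) = g.ip g.l x * g.ip g.l y)
    (hIa : pr g.gam (ctr g.gam (g.cov (TT g.gam F F))) (ctr g.gam (g.cov (TT g.gam F F))) = 0)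
    (hIb : pr g.gam (ctr g.gam (g.cov (g.cov (TT g.gam F F)))) (ctr g.gam (g.cov (g.cov (TT g.gam F F)))) = 0)
    {D' : Ten n A (q+2)} (hD' : ∀ x y, sl (sl D' x) y = sl (sl (g.cov F) y) x)
    (h1 : pr g.gam (g.cov F) D' = 0)
    {Z' : Ten n A (q+3)} (hZ' : ∀ x y z, sl (sl (sl Z' x) y) z = sl (sl (sl (g.cov (g.cov F)) z) y) x)
    (h2 : pr g.gam (g.cov (g.cov F)) Z' = 0)
    {W' : Ten n A (q+4)} (hW' : ∀ x y z w, sl (sl (sl (sl W' x) y) z) w = sl (sl (sl (sl (g.cov (g.cov (g.cov F))) z) w) x) y)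
    (h3 : pr g.gam (g.cov (g.cov (g.cov F))) W' = 0) (I : ℕ) :
    BO g.Fil (NGeo.covN g.toGeo F I) (-1) := by
  rw [TT_eq hT] at hIa hIb
  have hWK : g.WK := stepB hIb (stepA hIa)
  have hl := stepC hA hT hWK hD' h1
  obtain ⟨hK, hL⟩ := stepC' hA hT hWK hl
  have hLH := stepD hA hT hK hl hL hZ' h2
  exact NGeo.part_two hK hLH (stepE hA hT hK hL hLH hW' h3) (typeN hA hT) hL I

end EGeo
end geo8

set_option linter.unusedSectionVars false
set_option linter.unusedSimpArgs false
set_option linter.unusedVariables false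
section con9
variable {n p : ℕ} (γ : Fin n → Fin n → ℝ) (D : ∀ I, Ten n ℝ (p + I))

/-- concomitants of order at most three at a point, indexed by a type of free indices -/
def Con (ι : Type) (H : (ι → Fin n) → ℝ) : Prop :=
  ∃ (J : Type) (_ : Fintype J) (_ : Nonempty J) (ord : J → ℕ) (_ : ∀ j, ord j ≤ 3) (P : Type) (_ : Fintype P)
    (_ : DecidableEq P) (e : (P ⊕ P) ⊕ ι ≃ Σ j : J, Fin (p + ord j)), ∀ f, H f = ∑ a : P → Fin n, ∑ b : P → Fin n,
      (∏ i, γ (a i) (b i)) * ∏ j, D (ord j) (fun s => Sum.elim (Sum.elim a b) f (e.symm ⟨j, s⟩))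

variable {γ D}
lemma Con.base {I : ℕ} (hI : I ≤ 3) : Con γ D (Fin (p + I)) (D I) := by
  refine ⟨Unit, inferInstance, inferInstance, fun _ => I, fun _ => hI, Empty, inferInstance, inferInstance,
    { toFun := fun t => ⟨(), Sum.elim (fun t => (Sum.elim Empty.elim Empty.elim t)) id t⟩
      invFun := fun t => Sum.inr t.2
      left_inv := ?_
      right_inv := ?_ }, fun f => ?_⟩
  · rintro ((a | a) | t)
    · exact a.elim
    · exact a.elim
    · rfl
  · rintro ⟨⟨⟩, t⟩; rfl
  · simp

lemma Con.reidx {ι κ : Type} {H : (ι → Fin n) → ℝ} (h : Con γ D ι H) (u : ι → κ) (hu : Function.Bijective u) :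
    Con γ D κ (fun f => H (fun i => f (u i))) := by
  obtain ⟨J, i1, i2, ord, ho, P, i3, i4, e, he⟩ := h
  refine ⟨J, i1, i2, ord, ho, P, i3, i4, (Equiv.sumCongr (Equiv.refl _) (Equiv.ofBijective u hu).symm).trans e, fun f => ?_⟩
  change H _ = _
  rw [he]
  refine Finset.sum_congr rfl fun a _ => Finset.sum_congr rfl fun b _ => ?_
  congr 1
  refine Finset.prod_congr rfl fun j _ => congrArg _ (funext fun s => ?_)
  rw [Equiv.symm_trans_apply]
  rcases e.symm ⟨j, s⟩ with t | t <;> simp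

lemma sum_split {P Q : Type} [Fintype P] [Fintype Q] [DecidableEq P] [DecidableEq Q] (X : (P ⊕ Q → Fin n) → ℝ) :
    ∑ a, X a = ∑ a : P → Fin n, ∑ b : Q → Fin n, X (Sum.elim a b) := by
  rw [← (Equiv.sumArrowEquivProdArrow P Q (Fin n)).symm.sum_comp, Fintype.sum_prod_type]
  rfl

lemma Con.mul {ι κ : Type} {H : (ι → Fin n) → ℝ} {K : (κ → Fin n) → ℝ} (h : Con γ D ι H) (h' : Con γ D κ K) :
    Con γ D (ι ⊕ κ) (fun f => H (fun i => f (Sum.inl i)) * K (fun i => f (Sum.inr i))) := by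
  obtain ⟨J, i1, i2, ord, ho, P, i3, i4, e, he⟩ := h
  obtain ⟨J', i1', i2', ord', ho', P', i3', i4', e', he'⟩ := h'
  let e0 : ((P ⊕ P') ⊕ (P ⊕ P')) ⊕ (ι ⊕ κ) ≃ ((P ⊕ P) ⊕ ι) ⊕ ((P' ⊕ P') ⊕ κ) :=
    { toFun := fun t => Sum.elim (Sum.elim
          (Sum.elim (fun s => Sum.inl (Sum.inl (Sum.inl s))) (fun s => Sum.inr (Sum.inl (Sum.inl s))))
          (Sum.elim (fun s => Sum.inl (Sum.inl (Sum.inr s))) (fun s => Sum.inr (Sum.inl (Sum.inr s)))))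
          (Sum.elim (fun s => Sum.inl (Sum.inr s)) (fun s => Sum.inr (Sum.inr s))) t
      invFun := fun t => Sum.elim (Sum.map (Sum.map Sum.inl Sum.inl) Sum.inl) (Sum.map (Sum.map Sum.inr Sum.inr) Sum.inr) t
      left_inv := by rintro (((s | s) | (s | s)) | (s | s)) <;> rfl
      right_inv := by rintro (((s | s) | s) | ((s | s) | s)) <;> rfl }
  refine ⟨J ⊕ J', inferInstance, inferInstance, Sum.elim ord ord', by rintro (j | j) <;> simp [ho, ho'],
    P ⊕ P', inferInstance, inferInstance,
    (e0.trans (Equiv.sumCongr e e')).trans (Equiv.sumSigmaDistrib (fun j => Fin (p + Sum.elim ord ord' j))).symm, fun f => ?_⟩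
  · change H _ * K _ = _
    rw [he, he', sum_split, Finset.sum_mul_sum]
    refine Finset.sum_congr rfl fun a _ => Finset.sum_congr rfl fun a' _ => ?_
    rw [sum_split, Finset.sum_mul_sum]
    refine Finset.sum_congr rfl fun b _ => Finset.sum_congr rfl fun b' _ => ?_
    have h1 : ∀ j s, Sum.elim (Sum.elim (Sum.elim a a') (Sum.elim b b')) f
        (Sum.map (Sum.map Sum.inl Sum.inl) Sum.inl (e.symm ⟨j, s⟩))
        = Sum.elim (Sum.elim a b) (fun i => f (Sum.inl i)) (e.symm ⟨j, s⟩) := by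
      intro j s; rcases e.symm ⟨j, s⟩ with (t | t) | t <;> rfl
    have h2 : ∀ j s, Sum.elim (Sum.elim (Sum.elim a a') (Sum.elim b b')) f
        (Sum.map (Sum.map Sum.inr Sum.inr) Sum.inr (e'.symm ⟨j, s⟩))
        = Sum.elim (Sum.elim a' b') (fun i => f (Sum.inr i)) (e'.symm ⟨j, s⟩) := by
      intro j s; rcases e'.symm ⟨j, s⟩ with (t | t) | t <;> rfl
    rw [Fintype.prod_sum_type, Fintype.prod_sum_type]
    exact (mul_mul_mul_comm _ _ _ _).trans (congrArg₂ (· * ·) rfl (congrArg₂ (· * ·)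
      (Finset.prod_congr rfl fun j _ => congrArg (D (ord j)) (funext fun s => (h1 j s).symm))
      (Finset.prod_congr rfl fun j _ => congrArg (D (ord' j)) (funext fun s => (h2 j s).symm))))

lemma Con.contr {ι Q : Type} [Fintype Q] [DecidableEq Q] {H : ((Q ⊕ Q) ⊕ ι → Fin n) → ℝ} (h : Con γ D ((Q ⊕ Q) ⊕ ι) H) :
    Con γ D ι (fun f => ∑ a : Q → Fin n, ∑ b : Q → Fin n, (∏ i, γ (a i) (b i)) * H (Sum.elim (Sum.elim a b) f)) := by
  obtain ⟨J, i1, i2, ord, ho, P, i3, i4, e, he⟩ := h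
  refine ⟨J, i1, i2, ord, ho, Q ⊕ P, inferInstance, inferInstance,
    Equiv.trans
    { toFun := fun t => Sum.elim (Sum.elim
          (Sum.elim (fun s => Sum.inr (Sum.inl (Sum.inl s))) (fun s => Sum.inl (Sum.inl s)))
          (Sum.elim (fun s => Sum.inr (Sum.inl (Sum.inr s))) (fun s => Sum.inl (Sum.inr s))))
          (fun s => Sum.inr (Sum.inr s)) t
      invFun := fun t => Sum.elim (Sum.elim (fun s => Sum.inl (Sum.inl (Sum.inr s))) (fun s => Sum.inl (Sum.inr (Sum.inr s))))
          (Sum.elim (Sum.elim (fun s => Sum.inl (Sum.inl (Sum.inl s))) (fun s => Sum.inl (Sum.inr (Sum.inl s))))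
            (fun s => Sum.inr s)) t
      left_inv := by rintro (((s | s) | (s | s)) | s) <;> rfl
      right_inv := by rintro ((s | s) | ((s | s) | s)) <;> rfl } e, fun f => ?_⟩
  rw [sum_split]
  refine Finset.sum_congr rfl fun a _ => ?_
  have : ∀ b : Q → Fin n, (∏ i, γ (a i) (b i)) * H (Sum.elim (Sum.elim a b) f) = ∑ a' : P → Fin n, ∑ b' : P → Fin n,
      (∏ i, γ (a i) (b i)) * ((∏ i, γ (a' i) (b' i)) * ∏ j, D (ord j) (fun s => Sum.elim (Sum.elim a' b')
        (Sum.elim (Sum.elim a b) f) (e.symm ⟨j, s⟩))) := by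
    intro b; rw [he, Finset.mul_sum]; simp only [Finset.mul_sum]
  simp only [this]
  rw [Finset.sum_comm]
  refine Finset.sum_congr rfl fun a' _ => ?_
  rw [sum_split]
  refine Finset.sum_congr rfl fun b _ => Finset.sum_congr rfl fun b' _ => ?_
  rw [Fintype.prod_sum_type]
  simp only [Sum.elim_inl, Sum.elim_inr]
  rw [mul_assoc]
  congr 2
  refine Finset.prod_congr rfl fun j _ => congrArg _ (funext fun s => ?_)
  rw [Equiv.symm_trans_apply]
  rcases e.symm ⟨j, s⟩ with (t | t) | ((t | t) | t) <;> rfl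

lemma Con.contr1 {ι κ : Type} {H : (ι → Fin n) → ℝ} (h : Con γ D ι H) (u : ι → (Unit ⊕ Unit) ⊕ κ) (hu : Function.Bijective u) :
    Con γ D κ (fun f => ∑ c, ∑ d, γ c d * H (fun i => Sum.elim (Sum.elim (fun _ => c) (fun _ => d)) f (u i))) := by
  have := (h.reidx u hu).contr
  convert this using 2 with f
  rw [← (Equiv.funUnique Unit (Fin n)).symm.sum_comp]
  refine Finset.sum_congr rfl fun c _ => ?_
  rw [← (Equiv.funUnique Unit (Fin n)).symm.sum_comp]
  refine Finset.sum_congr rfl fun d _ => ?_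
  rw [Fintype.prod_unique]
  congr 2

lemma Con.zero (hv : ∀ S : ConcomScheme p 0, (∀ j, S.ord j ≤ 3) → ∀ v, ∑ φ : Fin S.m × Bool → Fin n,
    (∏ i : Fin S.m, γ (φ (i, false)) (φ (i, true))) *
    ∏ j : Fin S.N, D (S.ord j) (fun s => Sum.elim φ v (S.slots.symm ⟨j, s⟩)) = 0)
    {ι : Type} [IsEmpty ι] {H : (ι → Fin n) → ℝ} (h : Con γ D ι H) (f) : H f = 0 := by
  obtain ⟨J, i1, i2, ord, ho, P, i3, i4, e, he⟩ := h
  let eJ := (Fintype.equivFin J)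
  let eP := (Fintype.equivFin P)
  let e0 : (Fin (Fintype.card P) × Bool) ⊕ Fin 0 ≃ (P ⊕ P) ⊕ ι :=
    { toFun := fun t => Sum.elim (fun t : Fin (Fintype.card P) × Bool =>
          Sum.inl (cond t.2 (Sum.inr (eP.symm t.1)) (Sum.inl (eP.symm t.1)))) (fun t : Fin 0 => t.elim0) t
      invFun := fun z => Sum.elim (Sum.elim (fun s => Sum.inl (eP s, false)) (fun s => Sum.inl (eP s, true)))
            (fun s => isEmptyElim s) z
      left_inv := by
        rintro (⟨t, _ | _⟩ | t)
        · simp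
        · simp
        · exact t.elim0
      right_inv := by
        rintro ((t | t) | t)
        · simp
        · simp
        · exact isEmptyElim t }
  let S : ConcomScheme p 0 := {
    N := Fintype.card J
    hN := Fintype.card_pos
    ord := fun j => ord (eJ.symm j)
    m := Fintype.card P
    slots := (e0.trans e).trans (Equiv.sigmaCongrLeft (β := fun j => Fin (p + ord j)) eJ.symm).symm }
  have h0 := hv S (fun j => ho _) Fin.elim0
  have hS : ∀ j s, S.slots.symm ⟨j, s⟩ = e0.symm (e.symm ⟨eJ.symm j, s⟩) := fun j s => rfl
  rw [he, ← h0]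
  simp only [hS]
  let E : (P ⊕ P → Fin n) ≃ (Fin S.m × Bool → Fin n) :=
    { toFun := fun a t => a (cond t.2 (Sum.inr (eP.symm t.1)) (Sum.inl (eP.symm t.1)))
      invFun := fun φ t => φ (Sum.elim (fun s => (eP s, false)) (fun s => (eP s, true)) t)
      left_inv := fun a => by
        funext t; rcases t with t | t <;> simp
      right_inv := fun a => by
        funext t; rcases t with ⟨t, _ | _⟩ <;> simp }
  rw [← E.sum_comp, sum_split]
  refine Finset.sum_congr rfl fun a _ => Finset.sum_congr rfl fun b _ => ?_
  congr 1
  · exact (eP.symm.prod_comp (fun i => γ (a i) (b i))).symm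
  · rw [← eJ.symm.prod_comp]
    refine Finset.prod_congr rfl fun j _ => congrArg _ (funext fun s => ?_)
    rcases e.symm ⟨eJ.symm j, s⟩ with (t | t) | t
    · simp [E, e0]
    · simp [E, e0]
    · exact isEmptyElim t

/-- tensor valued concomitants -/
def ConT (γ : Fin n → Fin n → ℝ) (D : ∀ I, Ten n ℝ (p + I)) (i : ℕ) {k : ℕ} (H : (Fin i → Fin n) → Ten n ℝ k) : Prop :=
  Con γ D (Fin i ⊕ Fin k) (fun f => H (fun j => f (Sum.inl j)) (fun j => f (Sum.inr j)))

lemma Con.toT {k : ℕ} {H : Ten n ℝ k} (h : Con γ D (Fin k) H) : ConT γ D 0 (fun _ => H) :=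
  h.reidx Sum.inr ⟨Sum.inr_injective, by rintro (a | a); exacts [a.elim0, ⟨a, rfl⟩]⟩

lemma ConT.sl {i k : ℕ} {H : (Fin i → Fin n) → Ten n ℝ (k+1)} (h : ConT γ D i H) :
    ConT γ D (i+1) (fun f => VSI.sl (H (fun j => f j.castSucc)) (bs (f (Fin.last i)))) := by
  let E : Fin i ⊕ Fin (k+1) ≃ Fin (i+1) ⊕ Fin k :=
    { toFun := Sum.elim (fun j => Sum.inl j.castSucc) (fun j => Fin.cases (Sum.inl (Fin.last i)) (fun j => Sum.inr j) j)
      invFun := Sum.elim (fun j => Fin.lastCases (Sum.inr 0) (fun j => Sum.inl j) j) (fun j => Sum.inr j.succ)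
      left_inv := by
        rintro (j | j)
        · simp
        · refine Fin.cases ?_ (fun j => ?_) j <;> simp
      right_inv := by
        rintro (j | j)
        · refine Fin.lastCases ?_ (fun j => ?_) j <;> simp
        · simp }
  have := h.reidx E E.bijective
  unfold ConT
  convert this using 2 with f
  change VSI.sl _ (bs _) _ = H _ _
  rw [sl_bs]
  change H _ _ = H _ _
  congr 1
  funext j
  refine Fin.cases ?_ (fun j => ?_) j
  · rfl
  · rfl

lemma pr_sum : ∀ {k : ℕ} (S S' : Ten n ℝ k), pr γ S S' = ∑ a : Fin k → Fin n, ∑ b : Fin k → Fin n,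
    (∏ i, γ (a i) (b i)) * (S a * S' b)
  | 0, S, S' => by
      have e : ∀ f : Fin 0 → Fin n, f = ![] := fun f => Subsingleton.elim _ _
      rw [pr, Fintype.sum_unique, Fintype.sum_unique, e default]
      simp
  | k+1, S, S' => by
      have e : ∀ X : (Fin (k+1) → Fin n) → ℝ, ∑ a, X a = ∑ c, ∑ a : Fin k → Fin n, X (Fin.cons c a) := by
        intro X
        rw [← (Fin.consEquiv (fun _ => Fin n)).sum_comp, Fintype.sum_prod_type]; rfl
      simp only [pr, pr_sum (k := k), e, sl_bs, Fin.prod_univ_succ, Fin.cons_zero, Fin.cons_succ, Finset.mul_sum]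
      refine Finset.sum_congr rfl fun c _ => ?_
      rw [Finset.sum_comm]
      simp only [mul_assoc]

lemma ConT.pr {i j k : ℕ} {H : (Fin i → Fin n) → Ten n ℝ k} {K : (Fin j → Fin n) → Ten n ℝ k}
    (h : ConT γ D i H) (h' : ConT γ D j K) :
    Con γ D (Fin i ⊕ Fin j) (fun f => VSI.pr γ (H (fun t => f (Sum.inl t))) (K (fun t => f (Sum.inr t)))) := by
  have := ((Con.mul h h').reidx ((Equiv.sumSumSumComm _ _ _ _).trans (Equiv.sumComm _ _))
    (Equiv.bijective _)).contr
  convert this using 2 with f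
  rw [pr_sum]
  rfl

lemma con_pr (hv : ∀ S : ConcomScheme p 0, (∀ j, S.ord j ≤ 3) → ∀ v, ∑ φ : Fin S.m × Bool → Fin n,
    (∏ i : Fin S.m, γ (φ (i, false)) (φ (i, true))) *
    ∏ j : Fin S.N, D (S.ord j) (fun s => Sum.elim φ v (S.slots.symm ⟨j, s⟩)) = 0)
    {k : ℕ} {H K : Ten n ℝ k} (h : Con γ D (Fin k) H) (h' : Con γ D (Fin k) K) : pr γ H K = 0 :=
  (h.toT.pr h'.toT).zero hv (fun a => Sum.elim Fin.elim0 Fin.elim0 a)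

lemma con_TT {k : ℕ} {H K : Ten n ℝ (k+1)} (h : Con γ D (Fin (k+1)) H) (h' : Con γ D (Fin (k+1)) K) :
    Con γ D (Fin 2) (TT γ H K) :=
  (h.toT.sl.pr h'.toT.sl).reidx (Sum.elim ![0] ![1]) (by decide)

end con9

section con10
variable {n q : ℕ} {γ : Fin n → Fin n → ℝ} {D : ∀ I, Ten n ℝ (q + 1 + I)}

lemma con_a1 : Con γ D (Fin 1) (fun f => ∑ c, ∑ d, γ c d * pr γ (sl (sl (D 1) (bs c)) (bs d)) (sl (D 0) (bs (f 0)))) :=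
  ((Con.base (I := 1) (by norm_num)).toT.sl.sl.pr (Con.base (I := 0) (by norm_num)).toT.sl).contr1
    (Sum.elim ![Sum.inl (Sum.inl ()), Sum.inl (Sum.inr ())] ![Sum.inr 0]) (by decide)

lemma con_a2 : Con γ D (Fin 1) (fun f => ∑ c, ∑ d, γ c d * pr γ (sl (D 0) (bs d)) (sl (sl (D 1) (bs c)) (bs (f 0)))) :=
  ((Con.base (I := 0) (by norm_num)).toT.sl.pr (Con.base (I := 1) (by norm_num)).toT.sl.sl).contr1
    (Sum.elim ![Sum.inl (Sum.inr ())] ![Sum.inl (Sum.inl ()), Sum.inr 0]) (by decide)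

lemma con_b1 : Con γ D (Fin 2) (fun f => ∑ c, ∑ d, γ c d *
    pr γ (sl (sl (sl (D 2) (bs c)) (bs d)) (bs (f 0))) (sl (D 0) (bs (f 1)))) :=
  ((Con.base (I := 2) (by norm_num)).toT.sl.sl.sl.pr (Con.base (I := 0) (by norm_num)).toT.sl).contr1
    (Sum.elim ![Sum.inl (Sum.inl ()), Sum.inl (Sum.inr ()), Sum.inr 0] ![Sum.inr 1]) (by decide)
lemma con_b2 : Con γ D (Fin 2) (fun f => ∑ c, ∑ d, γ c d *
    pr γ (sl (sl (D 1) (bs d)) (bs (f 0))) (sl (sl (D 1) (bs c)) (bs (f 1)))) :=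
  ((Con.base (I := 1) (by norm_num)).toT.sl.sl.pr (Con.base (I := 1) (by norm_num)).toT.sl.sl).contr1
    (Sum.elim ![Sum.inl (Sum.inr ()), Sum.inr 0] ![Sum.inl (Sum.inl ()), Sum.inr 1]) (by decide)
lemma con_b3 : Con γ D (Fin 2) (fun f => ∑ c, ∑ d, γ c d *
    pr γ (sl (sl (D 1) (bs c)) (bs (f 0))) (sl (sl (D 1) (bs d)) (bs (f 1)))) :=
  ((Con.base (I := 1) (by norm_num)).toT.sl.sl.pr (Con.base (I := 1) (by norm_num)).toT.sl.sl).contr1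
    (Sum.elim ![Sum.inl (Sum.inl ()), Sum.inr 0] ![Sum.inl (Sum.inr ()), Sum.inr 1]) (by decide)
lemma con_b4 : Con γ D (Fin 2) (fun f => ∑ c, ∑ d, γ c d *
    pr γ (sl (D 0) (bs (f 0))) (sl (sl (sl (D 2) (bs c)) (bs d)) (bs (f 1)))) :=
  ((Con.base (I := 0) (by norm_num)).toT.sl.pr (Con.base (I := 2) (by norm_num)).toT.sl.sl.sl).contr1
    (Sum.elim ![Sum.inr 0] ![Sum.inl (Sum.inl ()), Sum.inl (Sum.inr ()), Sum.inr 1]) (by decide)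

/-- index permutations -/
def u2 (k : ℕ) : Fin (k+2) → Fin (k+2) := Fin.cons 1 (Fin.cons 0 fun i => i.succ.succ)
def u3 (k : ℕ) : Fin (k+3) → Fin (k+3) := Fin.cons 2 (Fin.cons 1 (Fin.cons 0 fun i => i.succ.succ.succ))
def u4 (k : ℕ) : Fin (k+4) → Fin (k+4) := Fin.cons 2 (Fin.cons 3 (Fin.cons 0 (Fin.cons 1 fun i => i.succ.succ.succ.succ)))
lemma u2_inv (k : ℕ) : Function.Involutive (u2 k) := by
  intro i
  refine Fin.cases rfl (fun i => Fin.cases rfl (fun i => rfl) i) i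
lemma u3_inv (k : ℕ) : Function.Involutive (u3 k) := by
  intro i
  refine Fin.cases rfl (fun i => Fin.cases rfl (fun i => Fin.cases rfl (fun i => rfl) i) i) i
lemma u4_inv (k : ℕ) : Function.Involutive (u4 k) := by
  intro i
  refine Fin.cases rfl (fun i => Fin.cases rfl (fun i => Fin.cases rfl (fun i => Fin.cases rfl (fun i => rfl) i) i) i) i

lemma con_u2 : Con γ D (Fin (q+2)) (fun f => D 1 (fun i => f (u2 q i))) :=
  (Con.base (I := 1) (by norm_num)).reidx (u2 q) (u2_inv q).bijective
lemma con_u3 : Con γ D (Fin (q+3)) (fun f => D 2 (fun i => f (u3 q i))) :=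
  (Con.base (I := 2) (by norm_num)).reidx (u3 q) (u3_inv q).bijective
lemma con_u4 : Con γ D (Fin (q+4)) (fun f => D 3 (fun i => f (u4 q i))) :=
  (Con.base (I := 3) (by norm_num)).reidx (u4 q) (u4_inv q).bijective
end con10

section perm
variable {A : Type*} [CommRing A] [Algebra ℝ A] {n q : ℕ}
lemma sum3_comm (X : Fin n → Fin n → Fin n → A) : ∑ c, ∑ b, ∑ a, X c b a = ∑ a, ∑ b, ∑ c, X c b a := by
  calc _ = ∑ c, ∑ a, ∑ b, X c b a := Finset.sum_congr rfl fun c _ => Finset.sum_comm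
    _ = ∑ a, ∑ c, ∑ b, X c b a := Finset.sum_comm
    _ = _ := Finset.sum_congr rfl fun c _ => Finset.sum_comm
lemma sum4_comm (X : Fin n → Fin n → Fin n → Fin n → A) :
    ∑ d, ∑ c, ∑ b, ∑ a, X d c b a = ∑ b, ∑ a, ∑ d, ∑ c, X d c b a := by
  calc _ = ∑ d, ∑ b, ∑ c, ∑ a, X d c b a := Finset.sum_congr rfl fun c _ => Finset.sum_comm
    _ = ∑ b, ∑ d, ∑ c, ∑ a, X d c b a := Finset.sum_comm
    _ = ∑ b, ∑ d, ∑ a, ∑ c, X d c b a :=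
      Finset.sum_congr rfl fun c _ => Finset.sum_congr rfl fun d _ => Finset.sum_comm
    _ = _ := Finset.sum_congr rfl fun c _ => Finset.sum_comm
lemma sl_u2 (S : Ten n A (q+2)) (x y : Vec n A) :
    sl (sl (fun f => S (fun i => f (u2 q i))) x) y = sl (sl S y) x := by
  funext f
  have e : ∀ a b, (fun i => (Fin.cons a (Fin.cons b f) : Fin (q+2) → Fin n) (u2 q i)) = Fin.cons b (Fin.cons a f) := by
    intro a b; funext i; refine Fin.cases rfl (fun i => Fin.cases rfl (fun i => rfl) i) i
  simp only [sl, e, Finset.mul_sum]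
  rw [Finset.sum_comm]
  refine Finset.sum_congr rfl fun a _ => Finset.sum_congr rfl fun b _ => by ring
lemma sl_u3 (S : Ten n A (q+3)) (x y z : Vec n A) :
    sl (sl (sl (fun f => S (fun i => f (u3 q i))) x) y) z = sl (sl (sl S z) y) x := by
  funext f
  have e : ∀ a b c, (fun i => (Fin.cons a (Fin.cons b (Fin.cons c f)) : Fin (q+3) → Fin n) (u3 q i))
      = Fin.cons c (Fin.cons b (Fin.cons a f)) := by
    intro a b c; funext i; refine Fin.cases rfl (fun i => Fin.cases rfl (fun i => Fin.cases rfl (fun i => rfl) i) i) i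
  simp only [sl, e, Finset.mul_sum]
  refine (sum3_comm _).trans ?_
  refine Finset.sum_congr rfl fun a _ => Finset.sum_congr rfl fun b _ => Finset.sum_congr rfl fun c _ => by ring
lemma sl_u4 (S : Ten n A (q+4)) (x y z w : Vec n A) :
    sl (sl (sl (sl (fun f => S (fun i => f (u4 q i))) x) y) z) w = sl (sl (sl (sl S z) w) x) y := by
  funext f
  have e : ∀ a b c d, (fun i => (Fin.cons a (Fin.cons b (Fin.cons c (Fin.cons d f))) : Fin (q+4) → Fin n) (u4 q i))
      = Fin.cons c (Fin.cons d (Fin.cons a (Fin.cons b f))) := by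
    intro a b c d; funext i
    refine Fin.cases rfl (fun i => Fin.cases rfl (fun i => Fin.cases rfl (fun i => Fin.cases rfl (fun i => rfl) i) i) i) i
  simp only [sl, e, Finset.mul_sum]
  refine (sum4_comm _).trans ?_
  refine Finset.sum_congr rfl fun a _ => Finset.sum_congr rfl fun b _ => Finset.sum_congr rfl fun c _ =>
    Finset.sum_congr rfl fun d _ => by ring
end perm

set_option linter.unusedSectionVars false
set_option linter.unusedSimpArgs false
set_option linter.unusedVariables false
section prab
variable {n q : ℕ} {γ : Fin n → Fin n → ℝ} {D : ∀ I, Ten n ℝ (q + 1 + I)}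

lemma pr_add2 {k : ℕ} {P1 P2 : Ten n ℝ k} (hv : ∀ S : ConcomScheme (q+1) 0, (∀ j, S.ord j ≤ 3) → ∀ v, ∑ φ : Fin S.m × Bool → Fin n,
    (∏ i : Fin S.m, γ (φ (i, false)) (φ (i, true))) *
    ∏ j : Fin S.N, D (S.ord j) (fun s => Sum.elim φ v (S.slots.symm ⟨j, s⟩)) = 0)
    (c1 : Con γ D (Fin k) P1) (c2 : Con γ D (Fin k) P2) : pr γ (P1 + P2) (P1 + P2) = 0 := by
  rw [pr_add_left, pr_add_right, pr_add_right, con_pr hv c1 c1, con_pr hv c1 c2, con_pr hv c2 c1, con_pr hv c2 c2]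
  simp

lemma pr_add4 {k : ℕ} {P1 P2 P3 P4 : Ten n ℝ k} (hv : ∀ S : ConcomScheme (q+1) 0, (∀ j, S.ord j ≤ 3) → ∀ v, ∑ φ : Fin S.m × Bool → Fin n,
    (∏ i : Fin S.m, γ (φ (i, false)) (φ (i, true))) *
    ∏ j : Fin S.N, D (S.ord j) (fun s => Sum.elim φ v (S.slots.symm ⟨j, s⟩)) = 0)
    (c1 : Con γ D (Fin k) P1) (c2 : Con γ D (Fin k) P2) (c3 : Con γ D (Fin k) P3) (c4 : Con γ D (Fin k) P4) :
    pr γ ((P1 + P2) + (P3 + P4)) ((P1 + P2) + (P3 + P4)) = 0 := by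
  simp only [pr_add_left, pr_add_right]
  rw [con_pr hv c1 c1, con_pr hv c1 c2, con_pr hv c2 c1, con_pr hv c2 c2, con_pr hv c3 c3, con_pr hv c3 c4,
    con_pr hv c4 c3, con_pr hv c4 c4, con_pr hv c1 c3, con_pr hv c1 c4, con_pr hv c2 c3, con_pr hv c2 c4,
    con_pr hv c3 c1, con_pr hv c3 c2, con_pr hv c4 c1, con_pr hv c4 c2]
  simp

lemma pr_a (hv : ∀ S : ConcomScheme (q+1) 0, (∀ j, S.ord j ≤ 3) → ∀ v, ∑ φ : Fin S.m × Bool → Fin n,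
    (∏ i : Fin S.m, γ (φ (i, false)) (φ (i, true))) *
    ∏ j : Fin S.N, D (S.ord j) (fun s => Sum.elim φ v (S.slots.symm ⟨j, s⟩)) = 0) :
    pr γ (k := 1) ((fun f => ∑ c, ∑ d, γ c d * pr γ (sl (sl (D 1) (bs c)) (bs d)) (sl (D 0) (bs (f 0)))) +
      (fun f => ∑ c, ∑ d, γ c d * pr γ (sl (D 0) (bs d)) (sl (sl (D 1) (bs c)) (bs (f 0)))))
     ((fun f => ∑ c, ∑ d, γ c d * pr γ (sl (sl (D 1) (bs c)) (bs d)) (sl (D 0) (bs (f 0)))) +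
      (fun f => ∑ c, ∑ d, γ c d * pr γ (sl (D 0) (bs d)) (sl (sl (D 1) (bs c)) (bs (f 0))))) = 0 :=
  pr_add2 hv con_a1 con_a2

lemma pr_b (hv : ∀ S : ConcomScheme (q+1) 0, (∀ j, S.ord j ≤ 3) → ∀ v, ∑ φ : Fin S.m × Bool → Fin n,
    (∏ i : Fin S.m, γ (φ (i, false)) (φ (i, true))) *
    ∏ j : Fin S.N, D (S.ord j) (fun s => Sum.elim φ v (S.slots.symm ⟨j, s⟩)) = 0) :
    pr γ (k := 2) (((fun f => ∑ c, ∑ d, γ c d * pr γ (sl (sl (sl (D 2) (bs c)) (bs d)) (bs (f 0))) (sl (D 0) (bs (f 1)))) +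
      (fun f => ∑ c, ∑ d, γ c d * pr γ (sl (sl (D 1) (bs d)) (bs (f 0))) (sl (sl (D 1) (bs c)) (bs (f 1))))) +
      ((fun f => ∑ c, ∑ d, γ c d * pr γ (sl (sl (D 1) (bs c)) (bs (f 0))) (sl (sl (D 1) (bs d)) (bs (f 1)))) +
      (fun f => ∑ c, ∑ d, γ c d * pr γ (sl (D 0) (bs (f 0))) (sl (sl (sl (D 2) (bs c)) (bs d)) (bs (f 1))))))
     (((fun f => ∑ c, ∑ d, γ c d * pr γ (sl (sl (sl (D 2) (bs c)) (bs d)) (bs (f 0))) (sl (D 0) (bs (f 1)))) +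
      (fun f => ∑ c, ∑ d, γ c d * pr γ (sl (sl (D 1) (bs d)) (bs (f 0))) (sl (sl (D 1) (bs c)) (bs (f 1))))) +
      ((fun f => ∑ c, ∑ d, γ c d * pr γ (sl (sl (D 1) (bs c)) (bs (f 0))) (sl (sl (D 1) (bs d)) (bs (f 1)))) +
      (fun f => ∑ c, ∑ d, γ c d * pr γ (sl (D 0) (bs (f 0))) (sl (sl (sl (D 2) (bs c)) (bs d)) (bs (f 1)))))) = 0 :=
  pr_add4 hv con_b1 con_b2 con_b3 con_b4
end prab

section evs
variable {A : Type*} [CommRing A] [Algebra ℝ A] {n : ℕ}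

def evT (ev : A →+* ℝ) {k : ℕ} (S : Ten n A k) : Ten n ℝ k := fun idx => ev (S idx)

lemma evT_sl (ev : A →+* ℝ) {k : ℕ} (S : Ten n A (k+1)) (a : Fin n) :
    evT ev (sl S (bs a)) = sl (evT ev S) (bs a) := by
  rw [sl_bs, sl_bs]; rfl

lemma ev_pr (ev : A →+* ℝ) (γ : Fin n → Fin n → A) : ∀ {k : ℕ} (S S' : Ten n A k),
    ev (pr γ S S') = pr (fun a b => ev (γ a b)) (evT ev S) (evT ev S')
  | 0, S, S' => by simp [pr, evT]
  | k+1, S, S' => by simp only [pr, map_sum, map_mul, ev_pr ev γ (k := k), evT_sl]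

lemma evT_TT (ev : A →+* ℝ) (γ : Fin n → Fin n → A) {k : ℕ} (S S' : Ten n A (k+1)) :
    evT ev (TT γ S S') = TT (fun a b => ev (γ a b)) (evT ev S) (evT ev S') := by
  funext idx
  simp only [TT, evT]
  rw [ev_pr, evT_sl, evT_sl]

lemma sl_TT (γ : Fin n → Fin n → A) {k : ℕ} (S S' : Ten n A (k+1)) (a : Fin n) (idx) :
    sl (TT γ S S') (bs a) idx = pr γ (sl S (bs a)) (sl S' (bs (idx 0))) := by
  rw [sl_bs]; rfl

namespace EGeo
variable {g : EGeo n A}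

/-- the abstract theorem with concomitants -/
theorem main' {q : ℕ} {F : Ten n A (q+1)} (hA : Alt F)
    (hT : ∀ x y, pr g.gam (sl F x) (sl F y) = g.ip g.l x * g.ip g.l y)
    (hv : ∀ y, ∀ S : ConcomScheme (q+1) 0, (∀ j, S.ord j ≤ 3) → ∀ v, ∑ φ : Fin S.m × Bool → Fin n,
      (∏ i : Fin S.m, g.ev y (g.gam (φ (i, false)) (φ (i, true)))) *
      ∏ j : Fin S.N, g.ev y (NGeo.covN g.toGeo F (S.ord j) (fun s => Sum.elim φ v (S.slots.symm ⟨j, s⟩))) = 0)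
    (I : ℕ) : BO g.Fil (NGeo.covN g.toGeo F I) (-1) := by
  have hcon : ∀ y {k : ℕ} {H K : Ten n ℝ k},
      Con (fun a b => g.ev y (g.gam a b)) (fun I => evT (g.ev y) (NGeo.covN g.toGeo F I)) (Fin k) H →
      Con (fun a b => g.ev y (g.gam a b)) (fun I => evT (g.ev y) (NGeo.covN g.toGeo F I)) (Fin k) K →
      pr (fun a b => g.ev y (g.gam a b)) H K = 0 := fun y _ _ _ h h' => con_pr (hv y) h h'
  refine main hA hT ?_ ?_ (sl_u2 (g.cov F)) ?_ (sl_u3 (g.cov (g.cov F))) ?_ (sl_u4 (g.cov (g.cov (g.cov F)))) ?_ I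
  · refine g.inj _ fun y => ?_
    rw [ev_pr]
    have e : evT (g.ev y) (ctr g.gam (g.cov (TT g.gam F F))) =
       (fun f => ∑ c, ∑ d, g.ev y (g.gam c d) * pr (fun a b => g.ev y (g.gam a b))
          (sl (sl (evT (g.ev y) (g.cov F)) (bs c)) (bs d)) (sl (evT (g.ev y) F) (bs (f 0)))) +
       (fun f => ∑ c, ∑ d, g.ev y (g.gam c d) * pr (fun a b => g.ev y (g.gam a b)) (sl (evT (g.ev y) F) (bs d))
          (sl (sl (evT (g.ev y) (g.cov F)) (bs c)) (bs (f 0)))) := by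
      funext f
      simp only [evT, ctr, Pi.add_apply, map_sum, map_mul]
      rw [← Finset.sum_add_distrib]
      refine Finset.sum_congr rfl fun c _ => ?_
      rw [← Finset.sum_add_distrib]
      refine Finset.sum_congr rfl fun d _ => ?_
      rw [g.sl_cov, g.act_TT, sl_add_left, Pi.add_apply, sl_TT, sl_TT, map_add, ev_pr, ev_pr, mul_add]
      simp only [evT_sl, ← g.sl_cov]
    exact (congrArg₂ (pr _) e e).trans (pr_a (D := fun I => evT (g.ev y) (NGeo.covN g.toGeo F I)) (hv y))
  · refine g.inj _ fun y => ?_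
    rw [ev_pr]
    have e : evT (g.ev y) (ctr g.gam (g.cov (g.cov (TT g.gam F F)))) =
       ((fun f => ∑ c, ∑ d, g.ev y (g.gam c d) * pr (fun a b => g.ev y (g.gam a b))
          (sl (sl (sl (evT (g.ev y) (g.cov (g.cov F))) (bs c)) (bs d)) (bs (f 0))) (sl (evT (g.ev y) F) (bs (f 1)))) +
       (fun f => ∑ c, ∑ d, g.ev y (g.gam c d) * pr (fun a b => g.ev y (g.gam a b))
          (sl (sl (evT (g.ev y) (g.cov F)) (bs d)) (bs (f 0))) (sl (sl (evT (g.ev y) (g.cov F)) (bs c)) (bs (f 1))))) +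
       ((fun f => ∑ c, ∑ d, g.ev y (g.gam c d) * pr (fun a b => g.ev y (g.gam a b))
          (sl (sl (evT (g.ev y) (g.cov F)) (bs c)) (bs (f 0))) (sl (sl (evT (g.ev y) (g.cov F)) (bs d)) (bs (f 1)))) +
       (fun f => ∑ c, ∑ d, g.ev y (g.gam c d) * pr (fun a b => g.ev y (g.gam a b))
          (sl (evT (g.ev y) F) (bs (f 0))) (sl (sl (sl (evT (g.ev y) (g.cov (g.cov F))) (bs c)) (bs d)) (bs (f 1))))) := by
      funext f
      simp only [evT, ctr, Pi.add_apply, map_sum, map_mul]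
      rw [← Finset.sum_add_distrib, ← Finset.sum_add_distrib, ← Finset.sum_add_distrib]
      refine Finset.sum_congr rfl fun c _ => ?_
      rw [← Finset.sum_add_distrib, ← Finset.sum_add_distrib, ← Finset.sum_add_distrib]
      refine Finset.sum_congr rfl fun d _ => ?_
      rw [g.jet2]
      simp only [Pi.add_apply, map_add, TT, ev_pr, evT_sl]
      simp only [← mul_add]
    exact (congrArg₂ (pr _) e e).trans (pr_b (D := fun I => evT (g.ev y) (NGeo.covN g.toGeo F I)) (hv y))
  · refine g.inj _ fun y => ?_
    rw [ev_pr]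
    exact hcon y (Con.base (I := 1) (by norm_num)) con_u2
  · refine g.inj _ fun y => ?_
    rw [ev_pr]
    exact hcon y (Con.base (I := 2) (by norm_num)) con_u3
  · refine g.inj _ fun y => ?_
    rw [ev_pr]
    exact hcon y (Con.base (I := 3) (by norm_num)) con_u4

lemma BO_eval : ∀ {k : ℕ} {S : Ten n A k} {s : ℤ}, BO g.Fil S s → ∀ (x : Fin k → Vec n A) (w : Fin k → ℤ),
    (∀ i, x i ∈ g.Fil (w i)) → s < ∑ i, w i → ∑ ψ : Fin k → Fin n, (∏ i, x i (ψ i)) * S ψ = 0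
  | 0, S, s, h, x, w, hx, hs => by
      have := h (by simpa using hs)
      rw [this]; simp
  | k+1, S, s, h, x, w, hx, hs => by
      rw [Fin.sum_univ_succ] at hs
      have := BO_eval (h (w 0) (x 0) (hx 0)) (fun i => x i.succ) (fun i => w i.succ) (fun i => hx _) (by omega)
      rw [← this, ← (Fin.consEquiv (fun _ => Fin n)).sum_comp, Fintype.sum_prod_type, Finset.sum_comm]
      refine Finset.sum_congr rfl fun ψ _ => ?_
      simp only [sl, Finset.mul_sum, Fin.prod_univ_succ]
      refine Finset.sum_congr rfl fun a _ => ?_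
      change (x 0 a * ∏ i : Fin k, x i.succ (ψ i)) * S (Fin.cons a ψ) = _
      ring

lemma gam_lab (y : g.Y) (a b : Fin n) : g.ev y (g.gam a b) =
    ∑ t : Lab n, g.ev y (g.vec y t a) * g.ev y (g.vec y t.star b) := by
  rw [(g.fr y).eq]
  simp only [Fintype.sum_sum_type, Fintype.sum_bool, vec, Lab.star, Bool.not_true, Bool.not_false]
  ring

lemma full_zero (y : g.Y) {p : ℕ} (S : ConcomScheme p 0) (D : ∀ I, Ten n A (p + I)) (hD : ∀ I, BO g.Fil (D I) (-1)) (v) :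
    ∑ φ : Fin S.m × Bool → Fin n, (∏ i : Fin S.m, g.ev y (g.gam (φ (i, false)) (φ (i, true)))) *
      ∏ j : Fin S.N, g.ev y (D (S.ord j) (fun s => Sum.elim φ v (S.slots.symm ⟨j, s⟩))) = 0 := by
  have h1 : ∀ φ : Fin S.m × Bool → Fin n, (∏ i : Fin S.m, g.ev y (g.gam (φ (i, false)) (φ (i, true)))) =
      ∑ τ : Fin S.m → Lab n, ∏ i, g.ev y (g.vec y (τ i) (φ (i, false))) * g.ev y (g.vec y (τ i).star (φ (i, true))) := by
    intro φ
    simp only [gam_lab y, Finset.prod_univ_sum, Fintype.piFinset_univ]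
  simp only [h1, Finset.sum_mul]
  rw [Finset.sum_comm]
  refine Finset.sum_eq_zero fun τ _ => ?_
  let L : Fin S.m × Bool → Lab n := fun t => cond t.2 (τ t.1).star (τ t.1)
  let M : (Σ j : Fin S.N, Fin (p + S.ord j)) → Lab n := fun z => Sum.elim L (fun s : Fin 0 => s.elim0) (S.slots.symm z)
  have h2 : ∀ φ : Fin S.m × Bool → Fin n, (∏ i, g.ev y (g.vec y (τ i) (φ (i, false))) * g.ev y (g.vec y (τ i).star (φ (i, true))))
      = ∏ j, ∏ s, g.ev y (g.vec y (M ⟨j, s⟩) (Sum.elim φ v (S.slots.symm ⟨j, s⟩))) := by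
    intro φ
    rw [← Fintype.prod_sigma' (fun j s => g.ev y (g.vec y (M ⟨j, s⟩) (Sum.elim φ v (S.slots.symm ⟨j, s⟩)))),
      ← S.slots.prod_comp]
    simp only [Sigma.eta, M, Equiv.symm_apply_apply]
    rw [Fintype.prod_sum_type, Fintype.prod_prod_type]
    simp [L, mul_comm]
  have h3 : ∑ z, (M z).wt = 0 := by
    rw [← S.slots.sum_comp]
    simp only [M, Equiv.symm_apply_apply]
    rw [Fintype.sum_sum_type, Fintype.sum_prod_type]
    simp [L, Lab.wt_star]
  rw [Fintype.sum_sigma] at h3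
  obtain ⟨j0, hj0⟩ : ∃ j, 0 ≤ ∑ s, (M ⟨j, s⟩).wt := by
    by_contra! hcon
    have : ∑ j, ∑ s, (M ⟨j, s⟩).wt < ∑ j : Fin S.N, 0 :=
      Finset.sum_lt_sum_of_nonempty ⟨⟨0, S.hN⟩, Finset.mem_univ _⟩ fun j _ => hcon j
    simp at this
    omega
  let E : (∀ j : Fin S.N, Fin (p + S.ord j) → Fin n) ≃ (Fin S.m × Bool → Fin n) :=
    { toFun := fun ψ t => ψ (S.slots (Sum.inl t)).1 (S.slots (Sum.inl t)).2
      invFun := fun φ j s => Sum.elim φ v (S.slots.symm ⟨j, s⟩)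
      left_inv := fun ψ => by
        funext j s
        rcases hh : S.slots.symm ⟨j, s⟩ with t | t
        · have h1 := (Equiv.symm_apply_eq _).1 hh
          change Sum.elim _ v (S.slots.symm ⟨j, s⟩) = _
          rw [hh, Sum.elim_inl]
          change ψ (S.slots (Sum.inl t)).1 (S.slots (Sum.inl t)).2 = _
          rw [← h1]
        · exact t.elim0
      right_inv := fun φ => by
        funext t; simp }
  rw [← E.sum_comp]
  have h4 : ∀ ψ j s, Sum.elim (E ψ) v (S.slots.symm ⟨j, s⟩) = ψ j s := fun ψ j s =>
    congrFun (congrFun (E.symm_apply_apply ψ) j) s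
  simp only [h2, h4, ← Finset.prod_mul_distrib]
  have h5 := Finset.prod_univ_sum (fun j : Fin S.N => (Finset.univ : Finset (Fin (p + S.ord j) → Fin n)))
    (fun j ψ => (∏ s, g.ev y (g.vec y (M ⟨j, s⟩) (ψ s))) * g.ev y (D (S.ord j) ψ))
  rw [Fintype.piFinset_univ] at h5
  rw [← h5]
  refine Finset.prod_eq_zero (Finset.mem_univ j0) ?_
  have := congrArg (g.ev y) (BO_eval (hD (S.ord j0)) (fun s => g.vec y (M ⟨j0, s⟩)) (fun s => (M ⟨j0, s⟩).wt)
    (fun s => g.vec_mem y _) (by omega))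
  simpa only [map_sum, map_mul, map_prod, map_zero] using this

end EGeo
end evs

set_option linter.unusedSectionVars false
set_option linter.unusedSimpArgs false
set_option linter.unusedVariables false
section smoothness
variable {n : ℕ}

lemma smooth_pd {f : Pt n → ℝ} (hf : ContDiff ℝ (⊤ : ℕ∞) f) (a : Fin n) :
    ContDiff ℝ (⊤ : ℕ∞) (fun x => pd f a x) := by
  have h : ContDiff ℝ (⊤ : ℕ∞) (fderiv ℝ f) := hf.fderiv_right (by simp)
  exact h.clm_apply contDiff_const

variable {g : MetricField n}

lemma lor_det (hg : IsLorentzMetric g) (x : Pt n) : IsUnit (g x).det := by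
  obtain ⟨P, hP, h⟩ := hg.2.2 x
  have h1 := congrArg Matrix.det h
  rw [Matrix.det_mul, Matrix.det_mul, Matrix.det_transpose, Matrix.det_diagonal] at h1
  have h2 : (∏ i : Fin n, if (i : ℕ) = 0 then (-1 : ℝ) else 1) ≠ 0 :=
    Finset.prod_ne_zero_iff.2 fun i _ => by split_ifs <;> norm_num
  rw [isUnit_iff_ne_zero]
  intro h0
  rw [h0] at h1
  apply h2
  rw [← h1]; ring

lemma smooth_det (hg : IsLorentzMetric g) : ContDiff ℝ (⊤ : ℕ∞) (fun x => (g x).det) := by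
  simp only [Matrix.det_apply]
  refine ContDiff.sum fun σ _ => ?_
  refine ContDiff.const_smul _ (contDiff_prod fun i _ => hg.1 _ _)

lemma smooth_inv (hg : IsLorentzMetric g) (a b : Fin n) :
    ContDiff ℝ (⊤ : ℕ∞) (fun x => (g x)⁻¹ a b) := by
  have e : ∀ x, (g x)⁻¹ a b = ((g x).det)⁻¹ * (g x).adjugate a b := by
    intro x
    rw [Matrix.inv_def, Ring.inverse_eq_inv', Matrix.smul_apply, smul_eq_mul]
  simp only [e]
  refine ((smooth_det hg).inv fun x => (lor_det hg x).ne_zero).mul ?_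
  simp only [Matrix.adjugate_apply, Matrix.det_apply]
  refine ContDiff.sum fun σ _ => ?_
  refine ContDiff.const_smul _ (contDiff_prod fun i _ => ?_)
  simp only [Matrix.updateRow_apply]
  split_ifs
  · exact contDiff_const
  · exact hg.1 _ _

lemma smooth_chr (hg : IsLorentzMetric g) (a b c : Fin n) :
    ContDiff ℝ (⊤ : ℕ∞) (fun x => christoffel g x a b c) := by
  unfold christoffel
  refine contDiff_const.mul (ContDiff.sum fun d _ => (smooth_inv hg _ _).mul ?_)
  exact ((smooth_pd (hg.1 _ _) _).add (smooth_pd (hg.1 _ _) _)).sub (smooth_pd (hg.1 _ _) _)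

lemma smooth_covD (hg : IsLorentzMetric g) {k : ℕ} {T : TensorField n k} (hT : IsSmoothT T) :
    IsSmoothT (covD g T) := by
  intro idx
  unfold covD
  exact (smooth_pd (hT _) _).sub (ContDiff.sum fun m _ => ContDiff.sum fun e _ => (smooth_chr hg _ _ _).mul (hT _))

lemma smooth_covDIter (hg : IsLorentzMetric g) {k : ℕ} {T : TensorField n k} (hT : IsSmoothT T) :
    ∀ I, IsSmoothT (covDIter g T I)
  | 0 => hT
  | I+1 => smooth_covD hg (smooth_covDIter hg hT I)

lemma g_symm (hg : IsLorentzMetric g) (x : Pt n) (a b : Fin n) : g x a b = g x b a :=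
  ((hg.2.1 x).apply a b).symm

lemma ginv_symm (hg : IsLorentzMetric g) (x : Pt n) (a b : Fin n) : (g x)⁻¹ a b = (g x)⁻¹ b a := by
  have : ((g x)⁻¹).transpose = (g x)⁻¹ := by
    rw [Matrix.transpose_nonsing_inv, (hg.2.1 x).eq]
  exact (congrFun (congrFun this b) a)

lemma ginv_mul (hg : IsLorentzMetric g) (x : Pt n) (a c : Fin n) :
    ∑ b, (g x)⁻¹ a b * g x b c = if a = c then 1 else 0 := by
  have := congrFun (congrFun (Matrix.nonsing_inv_mul (g x) (lor_det hg x)) a) c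
  rw [Matrix.mul_apply, Matrix.one_apply] at this
  exact this

lemma gmul_inv (hg : IsLorentzMetric g) (x : Pt n) (a c : Fin n) :
    ∑ b, g x a b * (g x)⁻¹ b c = if a = c then 1 else 0 := by
  have := congrFun (congrFun (Matrix.mul_nonsing_inv (g x) (lor_det hg x)) a) c
  rw [Matrix.mul_apply, Matrix.one_apply] at this
  exact this

lemma chr_symm (hg : IsLorentzMetric g) (x : Pt n) (e b c : Fin n) : christoffel g x e b c = christoffel g x e c b := by
  unfold christoffel
  congr 1
  refine Finset.sum_congr rfl fun d _ => ?_
  have e1 : ∀ a b, (fun y => g y a b) = fun y => g y b a := fun a b => funext fun y => g_symm hg y a b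
  rw [e1 d c, e1 b d, e1 b c]
  ring

lemma chr_low (hg : IsLorentzMetric g) (x : Pt n) (a b c : Fin n) : ∑ e, christoffel g x e a b * g x e c =
    (1/2) * (pd (fun y => g y c b) a x + pd (fun y => g y a c) b x - pd (fun y => g y a b) c x) := by
  unfold christoffel
  simp only [mul_assoc, Finset.sum_mul, ← Finset.mul_sum]
  congr 1
  rw [Finset.sum_comm]
  have : ∀ d, ∑ e, (g x)⁻¹ e d * ((pd (fun y => g y d b) a x + pd (fun y => g y a d) b x - pd (fun y => g y a b) d x)
     * g x e c) = (pd (fun y => g y d b) a x + pd (fun y => g y a d) b x - pd (fun y => g y a b) d x) *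
      (if d = c then 1 else 0) := by
    intro d
    rw [← ginv_mul hg x d c, Finset.mul_sum]
    refine Finset.sum_congr rfl fun e _ => ?_
    rw [ginv_symm hg x e d]; ring
  rw [Finset.sum_congr rfl fun d _ => this d]
  simp

lemma g_compat (hg : IsLorentzMetric g) (x : Pt n) (a b c : Fin n) : pd (fun y => g y b c) a x =
    ∑ e, christoffel g x e a b * g x e c + ∑ e, christoffel g x e a c * g x b e := by
  have e1 : ∀ a b, (fun y => g y a b) = fun y => g y b a := fun a b => funext fun y => g_symm hg y a b
  simp only [g_symm hg x b]
  rw [chr_low hg, chr_low hg, e1 c b, e1 a b, e1 a c]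
  ring
end smoothness

section ring
variable {n : ℕ} (O : TopologicalSpace.Opens (Pt n))

/-- extension by zero -/
def ez (f : O → ℝ) : Pt n → ℝ := open Classical in fun x => if h : x ∈ O then f ⟨x, h⟩ else 0

variable {O}
lemma ez_apply (f : O → ℝ) (y : O) : ez O f y = f y := by simp [ez]
lemma ez_add (f h : O → ℝ) : ez O (f + h) = ez O f + ez O h := by
  funext x; by_cases hx : x ∈ O <;> simp [ez, hx]
lemma ez_mul (f h : O → ℝ) : ez O (f * h) = ez O f * ez O h := by
  funext x; by_cases hx : x ∈ O <;> simp [ez, hx]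
lemma ez_smul (c : ℝ) (f : O → ℝ) : ez O (c • f) = c • ez O f := by
  funext x; by_cases hx : x ∈ O <;> simp [ez, hx]
lemma ez_res (f : Pt n → ℝ) : Set.EqOn (ez O fun y => f y) f O := by
  intro x hx
  exact ez_apply (O := O) (fun y => f y) ⟨x, hx⟩

variable (O)
/-- smooth functions on an open set -/
def SO : Subalgebra ℝ (O → ℝ) where
  carrier := {f | ContDiffOn ℝ (⊤ : ℕ∞) (ez O f) O}
  mul_mem' := fun {a b} ha hb => by
    simp only [Set.mem_ofPred_eq, ez_mul] at *
    exact ha.mul hb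
  add_mem' := fun {a b} ha hb => by
    simp only [Set.mem_ofPred_eq, ez_add] at *
    exact ha.add hb
  algebraMap_mem' := fun r =>
    (contDiffOn_const (c := r)).congr (ez_res fun _ => r)

variable {O}
/-- restriction -/
def rs (f : Pt n → ℝ) (hf : ContDiffOn ℝ (⊤ : ℕ∞) f O) : SO O := ⟨fun y => f y, hf.congr (ez_res f)⟩

@[simp] lemma rs_apply (f : Pt n → ℝ) (hf : ContDiffOn ℝ (⊤ : ℕ∞) f O) (y : O) : (rs f hf).1 y = f y := rfl

lemma so_diff (f : SO O) (y : O) : DifferentiableAt ℝ (ez O f.1) y :=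
  (f.2.contDiffAt (O.isOpen.mem_nhds y.2)).differentiableAt (by simp)

lemma so_pd (f : SO O) (a : Fin n) : ContDiffOn ℝ (⊤ : ℕ∞) (fun x => pd (ez O f.1) a x) O :=
  (f.2.fderiv_of_isOpen O.isOpen (by simp)).clm_apply contDiffOn_const

variable (O)
def parO (a : Fin n) : Derivation ℝ (SO O) (SO O) :=
  Derivation.mk'
    { toFun := fun f => rs _ (so_pd f a)
      map_add' := fun f h => by
        apply Subtype.ext; funext y
        change pd (ez O (f.1 + h.1)) a y = pd (ez O f.1) a y + pd (ez O h.1) a y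
        rw [ez_add, pd, fderiv_add (so_diff f y) (so_diff h y)]; rfl
      map_smul' := fun c f => by
        apply Subtype.ext; funext y
        change pd (ez O (c • f.1)) a y = c * pd (ez O f.1) a y
        rw [ez_smul, pd, fderiv_const_smul (so_diff f y)]; rfl }
    (fun f h => by
        apply Subtype.ext; funext y
        change pd (ez O (f.1 * h.1)) a y = f.1 y * pd (ez O h.1) a y + h.1 y * pd (ez O f.1) a y
        rw [ez_mul, pd, fderiv_mul (so_diff f y) (so_diff h y), ez_apply, ez_apply]; rfl)

variable {O}
lemma parO_apply (a : Fin n) (f : SO O) (y : O) : (parO O a f).1 y = pd (ez O f.1) a y := rfl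

lemma pd_congr {f h : Pt n → ℝ} (e : Set.EqOn f h O) (a : Fin n) (y : O) : pd f a y = pd h a y := by
  unfold pd
  rw [Filter.EventuallyEq.fderiv_eq (e.eventuallyEq_of_mem (O.isOpen.mem_nhds y.2))]

lemma parO_rs (a : Fin n) (f : Pt n → ℝ) (hf) (y : O) : (parO O a (rs f hf)).1 y = pd f a y := by
  rw [parO_apply]; exact pd_congr (ez_res f) a y

lemma parO_comm (a b : Fin n) (f : SO O) : parO O a (parO O b f) = parO O b (parO O a f) := by
  apply Subtype.ext; funext y
  have key : ∀ a b, (parO O a (parO O b f)).1 y =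
      fderiv ℝ (fderiv ℝ (ez O f.1)) y (Pi.single a 1) (Pi.single b 1) := by
    intro a b
    have : parO O b f = rs _ (so_pd f b) := rfl
    rw [this, parO_rs]
    unfold pd
    have hd : DifferentiableAt ℝ (fderiv ℝ (ez O f.1)) y :=
      (((f.2.fderiv_of_isOpen (m := (⊤ : ℕ∞)) O.isOpen (by simp)).contDiffAt (O.isOpen.mem_nhds y.2))).differentiableAt (by simp)
    rw [fderiv_clm_apply hd (differentiableAt_const _)]
    simp
  rw [key, key]
  have hs : IsSymmSndFDerivAt ℝ (ez O f.1) y :=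
    (f.2.contDiffAt (O.isOpen.mem_nhds y.2)).isSymmSndFDerivAt (by simp only [minSmoothness_of_isRCLikeNormedField]; exact WithTop.coe_le_coe.2 (le_top : (2 : ℕ∞) ≤ ⊤))
  exact hs _ _

variable {g : MetricField n}

variable (O) in
/-- geometry on an open set -/
def geoO (hg : IsLorentzMetric g) : Geo n (SO O) where
  par := parO O
  par_comm := parO_comm
  G := fun a b => rs (fun x => g x a b) (hg.1 a b).contDiffOn
  G_symm := fun a b => Subtype.ext (funext fun y => g_symm hg y a b)
  gam := fun a b => rs (fun x => (g x)⁻¹ a b) (smooth_inv hg a b).contDiffOn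
  gam_symm := fun a b => Subtype.ext (funext fun y => ginv_symm hg y a b)
  inv := fun a c => Subtype.ext (funext fun y => by
    have := ginv_mul hg y a c
    simp only [AddSubmonoidClass.coe_finsetSum, MulMemClass.coe_mul, Finset.sum_apply, Pi.mul_apply, rs_apply, this]
    split_ifs <;> rfl)
  Gam := fun e b c => rs (fun x => christoffel g x e b c) (smooth_chr hg e b c).contDiffOn
  Gam_symm := fun e b c => Subtype.ext (funext fun y => chr_symm hg y e b c)
  compat := fun a b c => Subtype.ext (funext fun y => by
    have := g_compat hg y a b c
    rw [parO_rs, this]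
    simp only [AddMemClass.coe_add, AddSubmonoidClass.coe_finsetSum, MulMemClass.coe_mul, Finset.sum_apply, Pi.mul_apply, Pi.add_apply, rs_apply])

variable (O) in
def resT {k : ℕ} (T : TensorField n k) (hT : IsSmoothT T) : Ten n (SO O) k :=
  fun idx => rs (fun x => T x idx) (hT idx).contDiffOn

lemma cov_res (hg : IsLorentzMetric g) {k : ℕ} (T : TensorField n k) (hT : IsSmoothT T) :
    (geoO O hg).cov (resT O T hT) = resT O (covD g T) (smooth_covD hg hT) := by
  funext idx
  apply Subtype.ext; funext y
  have h1 : ∀ a f, (geoO O hg).dv (bs a) f = parO O a f := by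
    intro a f
    rw [Geo.dv_apply]
    simp [bs, Pi.single_apply]; rfl
  have h2 : ∀ a b e, ((geoO O hg).nab (bs a)).D (bs b) e = (geoO O hg).Gam e a b := by
    intro a b e
    have h3 : (geoO O hg).dv (bs a) ((bs b : Vec n (SO O)) e) = 0 := by
      simp only [bs, Pi.single_apply]; split_ifs <;> simp
    simp only [Geo.nab, Pi.add_apply, h3, Geo.GM]
    simp [bs, Pi.single_apply]
  simp only [Geo.cov, act, h2]
  have h4 : ∀ f, ((geoO O hg).nab (bs (idx 0))).d f = parO O (idx 0) f := h1 _
  rw [h4]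
  simp only [AddSubgroupClass.coe_sub, AddSubmonoidClass.coe_finsetSum, MulMemClass.coe_mul, Pi.sub_apply, Finset.sum_apply, Pi.mul_apply]
  simp only [resT, parO_rs, rs_apply]
  rfl

lemma covN_res (hg : IsLorentzMetric g) {k : ℕ} (T : TensorField n k) (hT : IsSmoothT T) : ∀ I,
    NGeo.covN (geoO O hg) (resT O T hT) I = resT O (covDIter g T I) (smooth_covDIter hg hT I)
  | 0 => rfl
  | I+1 => by
    rw [NGeo.covN, covN_res hg T hT I, cov_res]; rfl

variable (O) in
def evO (y : O) : SO O →+* ℝ := (Pi.evalRingHom (fun _ : O => ℝ) y).comp (SO O).subtype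

lemma evO_apply (y : O) (f : SO O) : evO O y f = f.1 y := rfl

lemma evO_inj (f : SO O) (h : ∀ y, evO O y f = 0) : f = 0 := Subtype.ext (funext h)

end ring

set_option linter.unusedSectionVars false
set_option linter.unusedSimpArgs false
set_option linter.unusedVariables false
section pointwise
variable {m n : ℕ}

lemma quad_sum (α : Fin n → ℝ) (W : Fin n → Fin n → ℝ) :
    ∑ a, ∑ b, α a * (∑ i, W i a * W i b) * α b = ∑ i, (∑ a, W i a * α a) ^ 2 := by
  simp only [sq, Finset.sum_mul_sum, Finset.mul_sum, Finset.sum_mul]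
  rw [Finset.sum_comm]
  rw [Finset.sum_congr rfl fun a _ => Finset.sum_comm]
  rw [Finset.sum_comm]
  refine Finset.sum_congr rfl fun i _ => ?_
  rw [Finset.sum_comm]
  refine Finset.sum_congr rfl fun a _ => Finset.sum_congr rfl fun b _ => by ring

open scoped MatrixOrder in
lemma psd_decomp {M : Matrix (Fin n) (Fin n) ℝ} (hM : M.PosSemidef) :
    ∃ B : Fin n → Fin n → ℝ, ∀ a b, M a b = ∑ i, B i a * B i b := by
  obtain ⟨B, hB⟩ := CStarAlgebra.nonneg_iff_eq_star_mul_self.1 hM.nonneg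
  refine ⟨B, fun a b => ?_⟩
  rw [hB, Matrix.mul_apply]
  rfl

/-- an orthonormal frame -/
structure ON (h : Geo n ℝ) (m : ℕ) where
  E0 : Vec n ℝ
  E : Fin m → Vec n ℝ
  gam_eq : ∀ a b, h.gam a b = - (E0 a * E0 b) + ∑ i, E i a * E i b
  ip00 : h.ip E0 E0 = -1
  ip0 : ∀ i, h.ip E0 (E i) = 0
  ip1 : ∀ i j, h.ip (E i) (E j) = if i = j then 1 else 0

namespace ON
variable {h : Geo n ℝ}

lemma exp (e : ON h m) (x : Vec n ℝ) : x = -(h.ip e.E0 x) • e.E0 + ∑ i, h.ip (e.E i) x • e.E i := by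
  have h1 : ∀ a, x a = ∑ b, h.gam a b * ∑ c, h.G b c * x c := by
    intro a
    simp only [Finset.mul_sum, ← mul_assoc]
    rw [Finset.sum_comm]
    simp only [← Finset.sum_mul, h.inv]
    simp
  have h2 : ∀ u : Vec n ℝ, h.ip u x = ∑ b, u b * ∑ c, h.G b c * x c := by
    intro u
    rw [h.ip_eq, Finset.sum_comm]
    refine Finset.sum_congr rfl fun b _ => ?_
    rw [Finset.mul_sum]
    refine Finset.sum_congr rfl fun c _ => by ring
  funext a
  rw [h1 a]
  simp only [e.gam_eq, Pi.add_apply, Pi.smul_apply, Finset.sum_apply, smul_eq_mul, h2, add_mul, Finset.sum_add_distrib, Finset.sum_mul, neg_mul, Finset.sum_neg_distrib]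
  congr 1
  · congr 1
    refine Finset.sum_congr rfl fun c _ => by ring
  · rw [Finset.sum_comm]
    refine Finset.sum_congr rfl fun b _ => Finset.sum_congr rfl fun c _ => by ring

lemma lin2 (e : ON h m) (t : Vec n ℝ →ₗ[ℝ] Vec n ℝ →ₗ[ℝ] ℝ) (x y : Vec n ℝ) : t x y =
    h.ip e.E0 x * h.ip e.E0 y * t e.E0 e.E0 - h.ip e.E0 x * ∑ j, h.ip (e.E j) y * t e.E0 (e.E j)
     - h.ip e.E0 y * ∑ i, h.ip (e.E i) x * t (e.E i) e.E0
     + ∑ i, ∑ j, h.ip (e.E i) x * h.ip (e.E j) y * t (e.E i) (e.E j) := by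
  conv_lhs => rw [e.exp x, e.exp y]
  simp only [map_add, map_neg, map_smul, map_sum, LinearMap.add_apply, LinearMap.neg_apply, LinearMap.smul_apply, LinearMap.sum_apply, smul_eq_mul, neg_smul, mul_add, Finset.sum_add_distrib, mul_neg, Finset.sum_neg_distrib, Finset.mul_sum, neg_mul]
  rw [Finset.sum_comm]
  simp only [mul_assoc, mul_left_comm, Finset.mul_sum]
  ring

lemma lin1 (e : ON h m) (t : Vec n ℝ →ₗ[ℝ] ℝ) (x : Vec n ℝ) : t x =
    - (h.ip e.E0 x * t e.E0) + ∑ j, h.ip (e.E j) x * t (e.E j) := by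
  conv_lhs => rw [e.exp x]
  simp

variable (h) in
def ipL : Vec n ℝ →ₗ[ℝ] Vec n ℝ →ₗ[ℝ] ℝ :=
  LinearMap.mk₂ ℝ h.ip h.ip_add_left (fun f u v => h.ip_smul_left f u v) h.ip_add_right (fun f u v => h.ip_smul_right f u v)

lemma ip_on (e : ON h m) (x y : Vec n ℝ) : h.ip x y = - (h.ip e.E0 x * h.ip e.E0 y) + ∑ i, h.ip (e.E i) x * h.ip (e.E i) y := by
  have := e.lin1 (ipL h x) y
  simp only [ipL, LinearMap.mk₂_apply] at this
  rw [this, h.ip_symm x e.E0]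
  simp only [h.ip_symm x (e.E _)]
  congr 1
  · ring
  · refine Finset.sum_congr rfl fun b _ => by ring

lemma revCS (e : ON h m) {t u : Vec n ℝ} (ht : h.ip t t < 0) (hu : h.ip t u = 0) : 0 ≤ h.ip u u := by
  rw [e.ip_on] at ht hu ⊢
  set t0 := h.ip e.E0 t
  set u0 := h.ip e.E0 u
  have cs := Finset.sum_mul_sq_le_sq_mul_sq Finset.univ (fun i => h.ip (e.E i) t) (fun i => h.ip (e.E i) u)
  simp only [← sq] at *
  set a := ∑ i, h.ip (e.E i) t ^ 2
  set b := ∑ i, h.ip (e.E i) u ^ 2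
  set c := ∑ i, h.ip (e.E i) t * h.ip (e.E i) u
  have hb : 0 ≤ b := Finset.sum_nonneg fun i _ => sq_nonneg _
  have ha : 0 ≤ a := Finset.sum_nonneg fun i _ => sq_nonneg _
  have hc : c = t0 * u0 := by linarith
  rw [hc] at cs
  have h1 : t0 ^ 2 * u0 ^ 2 ≤ t0 ^ 2 * b := by nlinarith
  have h2 : 0 < t0 ^ 2 := by linarith
  have := le_of_mul_le_mul_left h1 h2
  linarith

lemma frame (e : ON h m) {l w : Vec n ℝ} (hl : h.ip l l = 0) (hw : h.ip w w = 0) (hlw : h.ip l w = 1) :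
    ∃ W : Fin n → Vec n ℝ, (∀ a b, h.gam a b = l a * w b + w a * l b + ∑ i, W i a * W i b) ∧ ∀ i, h.ip l (W i) = 0 := by
  let M : Matrix (Fin n) (Fin n) ℝ := fun a b => h.gam a b - l a * w b - w a * l b
  have hG : ∀ u v : Vec n ℝ, h.ip u v = ∑ a, v a * ∑ b, u b * h.G b a := by
    intro u v
    rw [h.ip_eq]
    refine Finset.sum_congr rfl fun b _ => ?_
    rw [Finset.mul_sum]
  -- evaluating on covectors
  have hγ : ∀ α : Vec n ℝ, ∃ v : Vec n ℝ, (∀ u, h.ip v u = ∑ a, u a * α a) ∧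
      ∑ a, ∑ b, α a * h.gam a b * α b = h.ip v v := by
    intro α
    have key : ∀ u, h.ip (fun b => ∑ c, α c * h.gam c b) u = ∑ a, u a * α a := by
      intro u
      rw [hG]
      refine Finset.sum_congr rfl fun a _ => ?_
      congr 1
      simp only [Finset.sum_mul]
      rw [Finset.sum_comm]
      simp only [mul_assoc, ← Finset.mul_sum, h.inv]
      simp
    refine ⟨_, key, ?_⟩
    rw [key, Finset.sum_comm]
    refine Finset.sum_congr rfl fun a _ => ?_
    rw [Finset.sum_mul]
  have hM : ∀ α : Vec n ℝ, ∑ a, ∑ b, α a * M a b * α b =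
      ∑ a, ∑ b, α a * h.gam a b * α b - 2 * (∑ a, l a * α a) * ∑ a, w a * α a := by
    intro α
    have e1 : (∑ a, l a * α a) * ∑ a, w a * α a = ∑ a, ∑ b, α a * (l a * w b) * α b := by
      rw [Finset.sum_mul_sum]
      refine Finset.sum_congr rfl fun a _ => Finset.sum_congr rfl fun b _ => by ring
    have e2 : (∑ a, l a * α a) * ∑ a, w a * α a = ∑ a, ∑ b, α a * (w a * l b) * α b := by
      rw [mul_comm, Finset.sum_mul_sum]
      refine Finset.sum_congr rfl fun a _ => Finset.sum_congr rfl fun b _ => by ring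
    have e3 : 2 * (∑ a, l a * α a) * ∑ a, w a * α a = (∑ a, l a * α a) * ∑ a, w a * α a +
      (∑ a, l a * α a) * ∑ a, w a * α a := by ring
    rw [e3]
    nth_rewrite 1 [e1]
    rw [e2]
    simp only [M, mul_sub, sub_mul, Finset.sum_sub_distrib]
    ring
  have hpos : ∀ α : Vec n ℝ, 0 ≤ ∑ a, ∑ b, α a * M a b * α b := by
    intro α
    obtain ⟨v, hv, hvv⟩ := hγ α
    rw [hM, hvv, ← hv l, ← hv w]
    have h1 : h.ip (l - w) (l - w) < 0 := by
      simp only [h.ip_sub_left, h.ip_sub_right, hl, hw, h.ip_symm w l, hlw]; norm_num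
    have h2 := e.revCS (u := v - h.ip v w • l - h.ip v l • w) h1 (by
      simp only [h.ip_sub_left, h.ip_sub_right, h.ip_smul_right, h.ip_smul_left, hl, hw, h.ip_symm w l, hlw, h.ip_symm l v, h.ip_symm w v]; ring)
    simp only [h.ip_sub_left, h.ip_sub_right, h.ip_smul_right, h.ip_smul_left, hl, hw, h.ip_symm w l, hlw, h.ip_symm l v, h.ip_symm w v] at h2
    nlinarith
  have hPS : M.PosSemidef := by
    refine Matrix.PosSemidef.of_dotProduct_mulVec_nonneg ?_ ?_
    · ext a b
      change M b a = M a b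
      simp only [M, h.gam_symm a b]; ring
    · intro α
      have := hpos α
      simp only [dotProduct, Matrix.mulVec, star_trivial, Finset.mul_sum, ← mul_assoc]
      exact this
  obtain ⟨W, hW⟩ := psd_decomp hPS
  refine ⟨W, fun a b => ?_, ?_⟩
  · rw [← hW a b]; simp only [M]; ring
  · have h1 := hM (fun a => ∑ b, l b * h.G b a)
    have h2 : ∑ a, ∑ b, (∑ c, l c * h.G c a) * M a b * (∑ c, l c * h.G c b) = ∑ i, (h.ip l (W i)) ^ 2 := by
      simp only [hW, hG]
      exact quad_sum _ _
    obtain ⟨v, hv, hvv⟩ := hγ (fun a => ∑ b, l b * h.G b a)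
    have h3 : v = l := by
      have : v - l = 0 := h.nondeg fun u => by rw [h.ip_sub_left, hv, hG]; ring
      exact sub_eq_zero.1 this
    rw [h2, hvv, ← hG, ← hG, h3, hl] at h1
    have h4 : ∑ i, (h.ip l (W i)) ^ 2 = 0 := by rw [h1]; ring
    intro i
    have := (Finset.sum_eq_zero_iff_of_nonneg fun i _ => sq_nonneg _).1 h4 i (Finset.mem_univ _)
    exact pow_eq_zero_iff (two_ne_zero) |>.1 this

lemma pr_on (e : ON h m) {k : ℕ} (S S' : Ten n ℝ (k+1)) :
    pr h.gam S S' = - pr h.gam (sl S e.E0) (sl S' e.E0) + ∑ i, pr h.gam (sl S (e.E i)) (sl S' (e.E i)) := by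
  rw [pr_sl h.gam S S' e.E0 e.E0]
  simp only [pr_sl h.gam S S' (e.E _) (e.E _)]
  rw [pr]
  simp only [e.gam_eq, add_mul, Finset.sum_add_distrib, Finset.sum_mul, neg_mul, Finset.sum_neg_distrib]
  congr 1
  symm
  rw [Finset.sum_comm]
  refine Finset.sum_congr rfl fun a _ => ?_
  rw [Finset.sum_comm]

lemma ext_on (e : ON h m) {k : ℕ} {S : Ten n ℝ (k+1)} (h0 : sl S e.E0 = 0) (h1 : ∀ i, sl S (e.E i) = 0) : S = 0 := by
  refine ten_ext fun x => ?_
  rw [sl_zero_left, e.exp x, sl_add, sl_smul, h0, smul_zero, zero_add]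
  have : sl S (∑ i, h.ip (e.E i) x • e.E i) = slL S (∑ i, h.ip (e.E i) x • e.E i) := rfl
  rw [this, map_sum]
  refine Finset.sum_eq_zero fun i _ => ?_
  rw [map_smul]
  have : slL S (e.E i) = 0 := h1 i
  rw [this, smul_zero]

lemma posE (e : ON h m) : ∀ {k : ℕ} {R : Ten n ℝ k}, Kills e.E0 R → 0 ≤ pr h.gam R R
  | 0, R, _ => by simp only [pr]; exact mul_self_nonneg _
  | k+1, R, hk => by
      rw [pr_on e, hk.1, pr_zero_left, neg_zero, zero_add]
      exact Finset.sum_nonneg fun i _ => posE e (hk.2 _)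

lemma defE (e : ON h m) : ∀ {k : ℕ} {R : Ten n ℝ k}, Kills e.E0 R → pr h.gam R R = 0 → R = 0
  | 0, R, _, h0 => by
      simp only [pr] at h0
      funext idx
      rw [Subsingleton.elim idx ![]]
      exact mul_self_eq_zero.1 h0
  | k+1, R, hk, h0 => by
      rw [pr_on e, hk.1, pr_zero_left, neg_zero, zero_add] at h0
      have := (Finset.sum_eq_zero_iff_of_nonneg fun i _ => posE e (hk.2 _)).1 h0
      exact e.ext_on hk.1 fun i => defE e (hk.2 _) (this i (Finset.mem_univ _))

lemma zero_of (e : ON h m) {q : ℕ} {F : Ten n ℝ (q+1)} (hA : Alt F)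
    (h0 : ∀ a b, pr h.gam (sl F (bs a)) (sl F (bs b)) = 0) : F = 0 := by
  have h1 : ∀ x y, pr h.gam (sl F x) (sl F y) = 0 := by
    intro x y
    rw [pr_sl]; simp [h0]
  have h2 : sl F e.E0 = 0 := e.defE hA.kills_sl (h1 _ _)
  have hk : Kills e.E0 F := hA.kills h2
  exact e.ext_on h2 fun i => e.defE (hk.2 _) (h1 _ _)

lemma null_pos (e : ON h m) {q : ℕ} {F : Ten n ℝ (q+1)} (hA : Alt F) {N : Vec n ℝ} (hN : h.ip N N = 0) :
    0 ≤ pr h.gam (sl F N) (sl F N) := by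
  by_cases hz : N = 0
  · rw [hz, sl_zero, pr_zero_left]
  have : ∃ v, h.ip N v ≠ 0 := by
    by_contra! hc
    exact hz (h.nondeg hc)
  obtain ⟨v, hv⟩ := this
  set v' := (h.ip N v)⁻¹ • v
  have h1 : h.ip N v' = 1 := by rw [h.ip_smul_right]; field_simp
  set w := v' - (h.ip v' v' / 2) • N
  have h2 : h.ip N w = 1 := by simp only [w, h.ip_sub_right, h.ip_smul_right, hN, h1]; ring
  have h3 : h.ip w w = 0 := by
    simp only [w, h.ip_sub_left, h.ip_sub_right, h.ip_smul_left, h.ip_smul_right, hN, h1, h.ip_symm v' N]; ring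
  obtain ⟨W, hW, -⟩ := e.frame hN h3 h2
  exact pos_kills (γ := h.gam) (l := N) (nn := w) (ev := RingHom.id ℝ) ⟨W, hW⟩ hA.kills_sl

lemma scal {m : ℕ} {A β : ℝ} {b : Fin m → ℝ} {C : Fin m → Fin m → ℝ} (hβ : 0 ≤ β) (hb : ∑ i, b i ^ 2 = β ^ 2)
    (hq : A ^ 2 - 2 * ∑ i, b i ^ 2 + ∑ i, ∑ j, C i j ^ 2 = 0)
    (hp : β ≠ 0 → 0 ≤ A - 2 * β + (∑ i, ∑ j, b i * b j * C i j) / β ^ 2) :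
    A = β ∧ ∀ i j, β * C i j = b i * b j := by
  by_cases h0 : β = 0
  · subst h0
    have hc : 0 ≤ ∑ i, ∑ j, C i j ^ 2 := Finset.sum_nonneg fun i _ => Finset.sum_nonneg fun j _ => sq_nonneg _
    have hb' : ∀ i, b i = 0 := by
      intro i
      have h1 : ∑ i, b i ^ 2 = 0 := by rw [hb]; ring
      exact pow_eq_zero_iff (two_ne_zero) |>.1
        ((Finset.sum_eq_zero_iff_of_nonneg fun i _ => sq_nonneg _).1 h1 i (Finset.mem_univ _))
    refine ⟨?_, fun i j => by rw [hb' i]; ring⟩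
    rw [hb] at hq
    nlinarith [sq_nonneg A]
  · have hpos : 0 < β := lt_of_le_of_ne hβ (Ne.symm h0)
    have hp := hp h0
    set s := ∑ i, ∑ j, b i * b j * C i j
    have e1 : ∑ i, ∑ j, (β * C i j - b i * b j) ^ 2 = β ^ 2 * ∑ i, ∑ j, C i j ^ 2 - 2 * β * s + (β ^ 2) ^ 2 := by
      have : (β ^ 2) ^ 2 = ∑ i, ∑ j, b i ^ 2 * b j ^ 2 := by rw [← Finset.sum_mul_sum, hb]; ring
      rw [this]
      simp only [s, Finset.mul_sum, ← Finset.sum_sub_distrib, ← Finset.sum_add_distrib]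
      refine Finset.sum_congr rfl fun i _ => Finset.sum_congr rfl fun j _ => by ring
    have e2 : ∑ i, ∑ j, (β * C i j - b i * b j) ^ 2 + β ^ 2 * (A - β) ^ 2 ≤ 0 := by
      rw [e1]
      have h3 : ∑ i, ∑ j, C i j ^ 2 = 2 * β ^ 2 - A ^ 2 := by rw [hb] at hq; linarith
      rw [h3]
      have h4 : 0 ≤ (A - 2 * β) * β ^ 2 + s := by
        have := mul_nonneg hp (sq_nonneg β)
        rw [add_mul, div_mul_cancel₀ _ (pow_ne_zero 2 h0)] at this
        exact this
      nlinarith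
    have hc : 0 ≤ ∑ i, ∑ j, (β * C i j - b i * b j) ^ 2 :=
      Finset.sum_nonneg fun i _ => Finset.sum_nonneg fun j _ => sq_nonneg _
    have hd : 0 ≤ β ^ 2 * (A - β) ^ 2 := by positivity
    have hc0 : ∑ i, ∑ j, (β * C i j - b i * b j) ^ 2 = 0 := by linarith
    have hd0 : β ^ 2 * (A - β) ^ 2 = 0 := by linarith
    constructor
    · have := (mul_eq_zero.1 hd0).resolve_left (pow_ne_zero 2 h0)
      have := pow_eq_zero_iff (two_ne_zero) |>.1 this
      linarith
    · intro i j
      have h5 := (Finset.sum_eq_zero_iff_of_nonneg fun i _ => Finset.sum_nonneg fun j _ => sq_nonneg _).1 hc0 i (Finset.mem_univ _)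
      have h6 := (Finset.sum_eq_zero_iff_of_nonneg fun j _ => sq_nonneg _).1 h5 j (Finset.mem_univ _)
      have := pow_eq_zero_iff (two_ne_zero) |>.1 h6
      linarith

lemma rank1 (e : ON h m) {q : ℕ} {F : Ten n ℝ (q+1)} (hA : Alt F)
    (hT : pr h.gam (TT h.gam F F) (TT h.gam F F) = 0) :
    ∃ κ : Vec n ℝ, (∀ a b, pr h.gam (sl F (bs a)) (sl F (bs b)) = κ a * κ b) ∧
      ∑ a, ∑ b, h.gam a b * (κ a * κ b) = 0 := by
  let t : Vec n ℝ →ₗ[ℝ] Vec n ℝ →ₗ[ℝ] ℝ := (prL h.gam).compl₁₂ (slL F) (slL F)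
  have ht : ∀ x y, t x y = pr h.gam (sl F x) (sl F y) := fun x y => rfl
  have hts : ∀ x y, t x y = t y x := fun x y => pr_symm _ h.gam_symm _ _
  have hp : ∀ x y x' y', pr h.gam (sl (sl (TT h.gam F F) x) y) (sl (sl (TT h.gam F F) x') y') = t x y * t x' y' := by
    intro x y x' y'
    rw [ht, ht, ← ev2_TT h.gam F F x y, ← ev2_TT h.gam F F x' y']; rfl
  rw [pr_on e, pr_on e] at hT
  simp only [pr_on e (sl (TT h.gam F F) (e.E _)), hp] at hT
  set A := t e.E0 e.E0
  set b := fun i => t e.E0 (e.E i)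
  set C := fun i j => t (e.E i) (e.E j)
  have hbi : ∀ i, t (e.E i) e.E0 = b i := fun i => hts _ _
  have hbi' : ∀ i, t e.E0 (e.E i) = b i := fun i => rfl
  have hCi : ∀ i j, t (e.E i) (e.E j) = C i j := fun i j => rfl
  simp only [hbi, hbi', hCi] at hT
  have hq : A ^ 2 - 2 * ∑ i, b i ^ 2 + ∑ i, ∑ j, C i j ^ 2 = 0 := by
    simp only [Finset.sum_add_distrib, Finset.sum_neg_distrib, ← sq] at hT
    linarith
  set β := Real.sqrt (∑ i, b i ^ 2)
  have hβ0 : 0 ≤ ∑ i, b i ^ 2 := Finset.sum_nonneg fun i _ => sq_nonneg _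
  have hβ2 : ∑ i, b i ^ 2 = β ^ 2 := (Real.sq_sqrt hβ0).symm
  have hβ : 0 ≤ β := Real.sqrt_nonneg _
  obtain ⟨h1, h2⟩ := scal hβ hβ2 hq (by
    intro h0
    let N : Vec n ℝ := e.E0 - β⁻¹ • ∑ i, b i • e.E i
    have hsum : ∀ u, h.ip u (∑ i, b i • e.E i) = ∑ i, b i * h.ip u (e.E i) := by
      intro u
      have := map_sum (ipL h u) (fun i => b i • e.E i) Finset.univ
      simp only [map_smul, smul_eq_mul] at this
      exact this
    have hN : h.ip N N = 0 := by
      have h3 : h.ip e.E0 (∑ i, b i • e.E i) = 0 := by rw [hsum]; simp [e.ip0]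
      have h4 : h.ip (∑ i, b i • e.E i) (∑ i, b i • e.E i) = β ^ 2 := by
        rw [hsum, ← hβ2]
        refine Finset.sum_congr rfl fun i _ => ?_
        rw [h.ip_symm, hsum]
        simp [e.ip1, sq]
      simp only [N, h.ip_sub_left, h.ip_sub_right, h.ip_smul_left, h.ip_smul_right, h3, h4, e.ip00, h.ip_symm _ e.E0]
      field_simp
      ring
    have hpos := e.null_pos hA hN
    rw [← ht] at hpos
    have h5 : t N N = A - 2 * β + (∑ i, ∑ j, b i * b j * C i j) / β ^ 2 := by
      have h6 : t e.E0 (∑ i, b i • e.E i) = β ^ 2 := by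
        rw [map_sum, ← hβ2]
        refine Finset.sum_congr rfl fun i _ => ?_
        rw [map_smul, smul_eq_mul, hbi', sq]
      have h7 : t (∑ i, b i • e.E i) (∑ i, b i • e.E i) = ∑ i, ∑ j, b i * b j * C i j := by
        simp only [map_sum, map_smul, LinearMap.sum_apply, LinearMap.smul_apply, smul_eq_mul, hCi, Finset.mul_sum]
        rw [Finset.sum_comm]
        refine Finset.sum_congr rfl fun i _ => Finset.sum_congr rfl fun j _ => by ring
      simp only [N, map_sub, map_smul, LinearMap.sub_apply, LinearMap.smul_apply, smul_eq_mul, h6, h7,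
        hts (∑ i, b i • e.E i) e.E0]
      change A - _ - _ = _
      field_simp
      ring
    rw [← h5]; exact hpos)
  have h3 : ∀ x y, β * t x y = t e.E0 x * t e.E0 y := by
    intro x y
    rw [e.lin2 t x y, e.lin1 (t e.E0) x, e.lin1 (t e.E0) y]
    simp only [hbi, hbi', hCi]
    change β * (_ * _ * A - _ - _ + _) = (-(_ * A) + _) * (-(_ * A) + _)
    rw [h1]
    have h4 : β * ∑ i, ∑ j, h.ip (e.E i) x * h.ip (e.E j) y * C i j =
        (∑ i, h.ip (e.E i) x * b i) * ∑ j, h.ip (e.E j) y * b j := by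
      rw [Finset.sum_mul_sum]
      simp only [Finset.mul_sum]
      refine Finset.sum_congr rfl fun i _ => Finset.sum_congr rfl fun j _ => ?_
      linear_combination (h.ip (e.E i) x * h.ip (e.E j) y) * h2 i j
    linear_combination h4
  by_cases h0 : β = 0
  · refine ⟨0, fun a c => ?_, by simp⟩
    have hb0 : ∀ i, b i = 0 := by
      intro i
      have h1 : ∑ i, b i ^ 2 = 0 := by rw [hβ2, h0]; ring
      exact pow_eq_zero_iff (two_ne_zero) |>.1
        ((Finset.sum_eq_zero_iff_of_nonneg fun i _ => sq_nonneg _).1 h1 i (Finset.mem_univ _))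
    have hA0 : A = 0 := by rw [h1, h0]
    have hC0 : ∑ i, ∑ j, C i j ^ 2 = 0 := by rw [hA0] at hq; simp only [hb0] at hq; simpa using hq
    have hC : ∀ i j, C i j = 0 := by
      intro i j
      have h5 := (Finset.sum_eq_zero_iff_of_nonneg fun i _ => Finset.sum_nonneg fun j _ => sq_nonneg _).1 hC0 i (Finset.mem_univ _)
      have h6 := (Finset.sum_eq_zero_iff_of_nonneg fun j _ => sq_nonneg _).1 h5 j (Finset.mem_univ _)
      exact pow_eq_zero_iff (two_ne_zero) |>.1 h6
    rw [← ht, e.lin2 t]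
    simp only [hbi, hbi', hCi, hb0, hC]
    change _ * A - _ - _ + _ = _
    rw [hA0]; simp
  · have hpos : 0 < β := lt_of_le_of_ne hβ (Ne.symm h0)
    have hs : Real.sqrt β * Real.sqrt β = β := Real.mul_self_sqrt hβ
    have hs0 : Real.sqrt β ≠ 0 := (Real.sqrt_pos.2 hpos).ne'
    refine ⟨fun a => t e.E0 (bs a) / Real.sqrt β, fun a c => ?_, ?_⟩
    · rw [← ht, div_mul_div_comm, hs, ← h3]; field_simp
    · have h5 : ∀ x : Vec n ℝ, ∑ a, x a * (t e.E0 (bs a) / Real.sqrt β) = t e.E0 x / Real.sqrt β := by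
        intro x
        have : t e.E0 x = ∑ a, x a * t e.E0 (bs a) := by
          conv_lhs => rw [vec_eq_sum x]
          simp
        rw [this, Finset.sum_div]
        refine Finset.sum_congr rfl fun i _ => by ring
      have h6 : ∀ x : Vec n ℝ, ∑ a, ∑ c, x a * x c * (t e.E0 (bs a) / Real.sqrt β * (t e.E0 (bs c) / Real.sqrt β)) = t e.E0 x ^ 2 / β := by
        intro x
        have := congrArg (fun z => z * z) (h5 x)
        simp only [Finset.sum_mul_sum] at this
        rw [div_mul_div_comm, hs, ← sq] at this
        rw [← this]
        refine Finset.sum_congr rfl fun i _ => Finset.sum_congr rfl fun j _ => by ring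
      have h7 : ∑ a, ∑ c, h.gam a c * (t e.E0 (bs a) / Real.sqrt β * (t e.E0 (bs c) / Real.sqrt β)) =
          - (t e.E0 e.E0 ^ 2 / β) + ∑ i, t e.E0 (e.E i) ^ 2 / β := by
        simp only [← h6]
        simp only [e.gam_eq, add_mul, neg_mul, Finset.sum_add_distrib, Finset.sum_neg_distrib, Finset.sum_mul]
        congr 1
        symm
        rw [Finset.sum_comm]
        refine Finset.sum_congr rfl fun a _ => ?_
        rw [Finset.sum_comm]
      rw [h7]
      simp only [hbi']
      change - (A ^ 2 / β) + _ = 0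
      rw [← Finset.sum_div, hβ2, h1]; ring

end ON
end pointwise

set_option linter.unusedSectionVars false
set_option linter.unusedSimpArgs false
set_option linter.unusedVariables false
section altern
variable {A : Type*} [CommRing A] [Algebra ℝ A] {n : ℕ}

lemma alt_of : ∀ {k : ℕ} {S : Ten n A k},
    (∀ (idx : Fin k → Fin n) (σ : Equiv.Perm (Fin k)), S (idx ∘ σ) = ((Equiv.Perm.sign σ : ℤ) : A) * S idx) → Alt S
  | 0, _, _ => trivial
  | 1, _, _ => trivial
  | k+2, S, hS => by
    refine ⟨fun x y => ?_, fun x => alt_of fun idx σ => ?_⟩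
    · funext idx
      have h1 : ∀ a b, S (Fin.cons b (Fin.cons a idx)) = - S (Fin.cons a (Fin.cons b idx)) := by
        intro a b
        have h2 := hS (Fin.cons a (Fin.cons b idx)) (Equiv.swap 0 1)
        rw [Equiv.Perm.sign_swap (by simp)] at h2
        have h3 : (Fin.cons a (Fin.cons b idx) : Fin (k+2) → Fin n) ∘ (Equiv.swap 0 1) = Fin.cons b (Fin.cons a idx) := by
          funext i
          refine Fin.cases ?_ (fun i => Fin.cases ?_ (fun i => ?_) i) i
          · simp
          · change (Fin.cons a (Fin.cons b idx) : Fin (k+2) → Fin n) (Equiv.swap 0 1 1) = _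
            simp
          · have : (Equiv.swap (0 : Fin (k+2)) 1) i.succ.succ = i.succ.succ :=
              Equiv.swap_apply_of_ne_of_ne (Fin.succ_ne_zero _) (by
                intro h
                have := congrArg Fin.val h
                simp at this)
            simp [this]
        rw [h3] at h2
        rw [h2]; simp
      simp only [sl, Pi.neg_apply, Finset.mul_sum]
      rw [Finset.sum_comm, ← Finset.sum_neg_distrib]
      refine Finset.sum_congr rfl fun a _ => ?_
      rw [← Finset.sum_neg_distrib]
      refine Finset.sum_congr rfl fun b _ => ?_
      rw [h1 a b]; ring
    · simp only [sl, Finset.mul_sum]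
      refine Finset.sum_congr rfl fun a _ => ?_
      have h2 := hS (Fin.cons a idx) (Equiv.Perm.decomposeFin.symm (0, σ))
      have h3 : (Fin.cons a idx : Fin (k+2) → Fin n) ∘ (Equiv.Perm.decomposeFin.symm (0, σ)) = Fin.cons a (idx ∘ σ) := by
        funext i
        refine Fin.cases ?_ (fun i => ?_) i
        · simp
        · simp
      rw [h3, Equiv.Perm.decomposeFin.symm_sign] at h2
      rw [h2]; simp; ring
end altern

section fin
variable {n : ℕ} {g : MetricField n}

/-- pointwise geometry -/
def geoP (hg : IsLorentzMetric g) (y : Pt n) : Geo n ℝ where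
  par := fun _ => 0
  par_comm := fun a b f => rfl
  G := g y
  G_symm := g_symm hg y
  gam := fun a b => (g y)⁻¹ a b
  gam_symm := ginv_symm hg y
  inv := ginv_mul hg y
  Gam := fun _ _ _ => 0
  Gam_symm := fun _ _ _ => rfl
  compat := fun a b c => by simp

lemma on_exists {m : ℕ} {g : MetricField (m+1)} (hg : IsLorentzMetric g) (y : Pt (m+1)) : Nonempty (ON (geoP hg y) m) := by
  obtain ⟨P, hP, h⟩ := hg.2.2 y
  set η : Matrix (Fin (m+1)) (Fin (m+1)) ℝ := Matrix.diagonal fun i => if (i : ℕ) = 0 then (-1 : ℝ) else 1 with hη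
  have hηη : η * η = 1 := by
    rw [hη, Matrix.diagonal_mul_diagonal, ← Matrix.diagonal_one]
    congr 1
    funext i
    split_ifs <;> norm_num
  have h1 : (P * η) * (P.transpose * g y) = 1 := by
    apply mul_eq_one_comm.1
    rw [← mul_assoc, h, hηη]
  have h2 : (g y)⁻¹ = P * η * P.transpose := by
    apply Matrix.inv_eq_left_inv
    rw [mul_assoc, h1]
  have hip : ∀ i j, (geoP hg y).ip (fun a => P a i) (fun a => P a j) = η i j := by
    intro i j
    rw [← h, (geoP hg y).ip_eq, Matrix.mul_apply]
    refine Finset.sum_congr rfl fun b _ => ?_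
    rw [Matrix.mul_apply, Finset.sum_mul]
    refine Finset.sum_congr rfl fun a _ => ?_
    rw [Matrix.transpose_apply]
    change P b j * (P a i * g y a b) = _
    ring
  refine ⟨⟨fun a => P a 0, fun i a => P a i.succ, fun a b => ?_, ?_, fun i => ?_, fun i j => ?_⟩⟩
  · change (g y)⁻¹ a b = _
    rw [h2, Matrix.mul_apply, Fin.sum_univ_succ]
    simp [hη, Matrix.mul_diagonal]
  · rw [hip]; simp [hη]
  · rw [hip]; simp [hη, Matrix.diagonal_apply, (Fin.succ_ne_zero i).symm]
  · rw [hip]; simp [hη, Matrix.diagonal_apply]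

lemma smooth_pr (hg : IsLorentzMetric g) : ∀ {k : ℕ} {T T' : TensorField n k}, IsSmoothT T → IsSmoothT T' →
    ContDiff ℝ (⊤ : ℕ∞) (fun x => pr (fun a b => (g x)⁻¹ a b) (T x) (T' x))
  | 0, T, T', h, h' => (h _).mul (h' _)
  | k+1, T, T', h, h' => by
    simp only [pr]
    refine ContDiff.sum fun a _ => ContDiff.sum fun b _ => (smooth_inv hg a b).mul ?_
    simp only [sl_bs]
    exact smooth_pr hg (T := fun x idx => T x (Fin.cons a idx)) (T' := fun x idx => T' x (Fin.cons b idx))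
      (fun idx => h _) (fun idx => h' _)

/-- the energy-like tensor -/
def tt {q : ℕ} (g : MetricField n) (F : TensorField n (q+1)) (a b : Fin n) (x : Pt n) : ℝ :=
  pr (fun a b => (g x)⁻¹ a b) (sl (F x) (bs a)) (sl (F x) (bs b))

lemma smooth_tt (hg : IsLorentzMetric g) {q : ℕ} {F : TensorField n (q+1)} (hF : IsSmoothT F) (a b : Fin n) :
    ContDiff ℝ (⊤ : ℕ∞) (tt g F a b) := by
  unfold tt
  simp only [sl_bs]
  exact smooth_pr hg (T := fun x idx => F x (Fin.cons a idx)) (T' := fun x idx => F x (Fin.cons b idx))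
    (fun idx => hF _) (fun idx => hF _)

lemma tt_rank {m q : ℕ} {g : MetricField (m+1)} (hg : IsLorentzMetric g) {F : TensorField (m+1) (q+1)}
    (hF : IsFormField F) (h3 : IsVSIUpTo g F 3) (y : Pt (m+1)) :
    ∃ κ : Fin (m+1) → ℝ, (∀ a b, tt g F a b y = κ a * κ b) ∧ ∑ a, ∑ b, (g y)⁻¹ a b * (κ a * κ b) = 0 := by
  obtain ⟨e⟩ := on_exists hg y
  have hb : Con (fun a b => (g y)⁻¹ a b) (fun I => covDIter g F I y) (Fin (q+1)) (F y) :=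
    Con.base (D := fun I => covDIter g F I y) (I := 0) (by norm_num)
  exact e.rank1 (alt_of fun idx σ => by rw [hF.2]) (
    con_pr (γ := fun a b => (g y)⁻¹ a b) (D := fun I => covDIter g F I y) (fun S hS v => h3 S hS y v)
      (con_TT hb hb) (con_TT hb hb))

lemma covDIter_zero {k : ℕ} {T : TensorField n k} {W : Set (Pt n)} (hW : IsOpen W) (h0 : ∀ x ∈ W, T x = 0) :
    ∀ I, ∀ x ∈ W, covDIter g T I x = 0
  | 0, x, hx => h0 x hx
  | I+1, x, hx => by
    have ih := covDIter_zero hW h0 I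
    funext idx
    have h1 : (fun y => covDIter g T I y fun m => idx m.succ) =ᶠ[nhds x] fun _ => 0 := by
      filter_upwards [hW.mem_nhds hx] with y hy
      rw [ih y hy]; rfl
    change covD g (covDIter g T I) x idx = 0
    simp only [covD, pd]
    rw [h1.fderiv_eq, ih x hx]
    simp

lemma value_zero {k : ℕ} {T : TensorField n k} {W : Set (Pt n)} (hW : IsOpen W) (h0 : ∀ x ∈ W, T x = 0)
    (S : ConcomScheme k 0) (x : Pt n) (hx : x ∈ W) (v) : S.value g T x v = 0 := by
  unfold ConcomScheme.value
  refine Finset.sum_eq_zero fun φ _ => ?_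
  have : ∏ j : Fin S.N, covDIter g T (S.ord j) x (fun s => Sum.elim φ v (S.slots.symm ⟨j, s⟩)) = 0 :=
    Finset.prod_eq_zero (Finset.mem_univ (⟨0, S.hN⟩ : Fin S.N)) (by rw [covDIter_zero hW h0 _ x hx]; rfl)
  rw [this, mul_zero]

lemma value_cont (hg : IsLorentzMetric g) {k : ℕ} {T : TensorField n k} (hT : IsSmoothT T) (S : ConcomScheme k 0) (v) :
    Continuous (fun x => S.value g T x v) := by
  unfold ConcomScheme.value
  refine continuous_finsetSum _ fun φ _ => Continuous.mul ?_ ?_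
  · exact continuous_finsetProd _ fun i _ => (smooth_inv hg _ _).continuous
  · exact continuous_finsetProd _ fun i _ => (smooth_covDIter hg hT _ _).continuous

section opens
variable {m q : ℕ} {g : MetricField (m+1)} (hg : IsLorentzMetric g) {F : TensorField (m+1) (q+1)}
    (hF : IsFormField F) (a0 : Fin (m+1))

def Oa : TopologicalSpace.Opens (Pt (m+1)) :=
  ⟨{x | 0 < tt g F a0 a0 x}, isOpen_lt continuous_const (smooth_tt hg hF.1 a0 a0).continuous⟩

lemma Oa_pos (y : Oa hg hF a0) : 0 < tt g F a0 a0 y := y.2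

lemma sm_sqrt : ContDiffOn ℝ (⊤ : ℕ∞) (fun x => Real.sqrt (tt g F a0 a0 x)) (Oa hg hF a0) := by
  intro x hx
  exact ((smooth_tt hg hF.1 a0 a0).contDiffAt.sqrt (ne_of_gt hx)).contDiffWithinAt

lemma sm_isqrt : ContDiffOn ℝ (⊤ : ℕ∞) (fun x => (Real.sqrt (tt g F a0 a0 x))⁻¹) (Oa hg hF a0) :=
  (sm_sqrt hg hF a0).inv fun x hx => (Real.sqrt_pos.2 hx).ne'

def ri : SO (Oa hg hF a0) := rs _ (sm_isqrt hg hF a0)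
def kk (a : Fin (m+1)) : SO (Oa hg hF a0) := rs _ ((smooth_tt hg hF.1 a0 a).contDiffOn.mul (sm_isqrt hg hF a0))
def geoA : Geo (m+1) (SO (Oa hg hF a0)) := geoO (Oa hg hF a0) hg
def lA : Vec (m+1) (SO (Oa hg hF a0)) := fun a => ∑ b, kk hg hF a0 b * (geoA hg hF a0).gam b a
def nuA : Vec (m+1) (SO (Oa hg hF a0)) := ri hg hF a0 • bs a0
def nA : Vec (m+1) (SO (Oa hg hF a0)) :=
  nuA hg hF a0 - ((1/2 : ℝ) • (geoA hg hF a0).ip (nuA hg hF a0) (nuA hg hF a0)) • lA hg hF a0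

lemma ip_lA (x) : (geoA hg hF a0).ip (lA hg hF a0) x = ∑ a, kk hg hF a0 a * x a := by
  rw [Geo.ip_eq]
  refine Finset.sum_congr rfl fun a _ => ?_
  rw [← Finset.mul_sum]
  simp only [lA, Finset.sum_mul]
  rw [Finset.sum_comm]
  simp only [mul_assoc, ← Finset.mul_sum, (geoA hg hF a0).inv]
  simp [mul_comm]

lemma kk_ri : kk hg hF a0 a0 * ri hg hF a0 = 1 := by
  apply Subtype.ext; funext y
  change (tt g F a0 a0 y * (Real.sqrt (tt g F a0 a0 y))⁻¹) * (Real.sqrt (tt g F a0 a0 y))⁻¹ = 1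
  have h := Oa_pos hg hF a0 y
  rw [mul_assoc, ← mul_inv, Real.mul_self_sqrt h.le, mul_inv_cancel₀ h.ne']


lemma kk_val (a : Fin (m+1)) (y : Oa hg hF a0) : (kk hg hF a0 a).1 y = tt g F a0 a y * (Real.sqrt (tt g F a0 a0 y))⁻¹ := rfl

lemma kk_rank (y : Oa hg hF a0) {κ : Fin (m+1) → ℝ} (hκ : ∀ a b, tt g F a b y = κ a * κ b) (a b : Fin (m+1)) :
    (kk hg hF a0 a).1 y * (kk hg hF a0 b).1 y = κ a * κ b := by
  have h := Oa_pos hg hF a0 y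
  rw [kk_val, kk_val]
  have e : tt g F a0 a y * (Real.sqrt (tt g F a0 a0 y))⁻¹ * (tt g F a0 b y * (Real.sqrt (tt g F a0 a0 y))⁻¹)
      = tt g F a0 a y * tt g F a0 b y * (tt g F a0 a0 y)⁻¹ := by
    conv_rhs => rw [← Real.mul_self_sqrt h.le, mul_inv]
    ring
  rw [e]
  have h2 : κ a0 * κ a0 ≠ 0 := by rw [← hκ]; exact h.ne'
  simp only [hκ]
  have h3 : κ a0 ≠ 0 := fun h => h2 (by rw [h, mul_zero])
  field_simp

lemma nullA (h3 : IsVSIUpTo g F 3) : (geoA hg hF a0).ip (lA hg hF a0) (lA hg hF a0) = 0 := by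
  rw [ip_lA]
  refine evO_inj _ fun y => ?_
  obtain ⟨κ, h1, h2⟩ := tt_rank hg hF h3 y
  simp only [lA, Finset.mul_sum, map_sum, map_mul]
  rw [← h2]
  refine Finset.sum_congr rfl fun a _ => Finset.sum_congr rfl fun b _ => ?_
  rw [← kk_rank hg hF a0 y h1, ginv_symm hg]
  change (kk hg hF a0 a).1 y * ((kk hg hF a0 b).1 y * (g y)⁻¹ b a) = _
  ring

lemma ip_l_nu : (geoA hg hF a0).ip (lA hg hF a0) (nuA hg hF a0) = 1 := by
  rw [nuA, Geo.ip_smul_right, ip_lA]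
  simp only [bs, Pi.single_apply]
  simp only [mul_ite, mul_one, mul_zero, Finset.sum_ite_eq', Finset.mem_univ, if_true]
  rw [mul_comm, kk_ri]

lemma normA (h3 : IsVSIUpTo g F 3) : (geoA hg hF a0).ip (lA hg hF a0) (nA hg hF a0) = 1 := by
  rw [nA, Geo.ip_sub_right, Geo.ip_smul_right, nullA hg hF a0 h3, ip_l_nu, mul_zero, sub_zero]

lemma nnA (h3 : IsVSIUpTo g F 3) : (geoA hg hF a0).ip (nA hg hF a0) (nA hg hF a0) = 0 := by
  have h1 := nullA hg hF a0 h3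
  have h2 := ip_l_nu hg hF a0
  have h2' := h2
  rw [Geo.ip_symm] at h2'
  simp only [nA, Geo.ip_sub_right, Geo.ip_sub_left, Geo.ip_smul_right, Geo.ip_smul_left, h1, h2, h2']
  have key : ∀ f : SO (Oa hg hF a0), f = (1/2 : ℝ) • f + (1/2 : ℝ) • f := by
    intro f
    rw [← add_smul]; norm_num
  linear_combination key ((geoA hg hF a0).ip (nuA hg hF a0) (nuA hg hF a0))

lemma ev_ip (y : Oa hg hF a0) (u v : Vec (m+1) (SO (Oa hg hF a0))) :
    evO _ y ((geoA hg hF a0).ip u v) = (geoP hg (y : Pt (m+1))).ip (fun a => evO _ y (u a)) (fun a => evO _ y (v a)) := by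
  rw [Geo.ip_eq, Geo.ip_eq]
  simp only [map_sum, map_mul]
  rfl

lemma frA (h3 : IsVSIUpTo g F 3) (y : Oa hg hF a0) : ∃ fr : Frame (geoA hg hF a0).gam (lA hg hF a0) (nA hg hF a0) (evO _ y),
    ∀ i, (geoA hg hF a0).ip (lA hg hF a0) (fr.w i) = 0 := by
  obtain ⟨e⟩ := on_exists hg (y : Pt (m+1))
  have h1 := congrArg (evO _ y) (nullA hg hF a0 h3)
  have h2 := congrArg (evO _ y) (nnA hg hF a0 h3)
  have h4 := congrArg (evO _ y) (normA hg hF a0 h3)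
  rw [ev_ip, map_zero] at h1 h2
  rw [ev_ip, map_one] at h4
  obtain ⟨W, hW, hl⟩ := e.frame h1 h2 h4
  have hal : ∀ r : ℝ, evO (Oa hg hF a0) y (algebraMap ℝ _ r) = r := fun r => rfl
  refine ⟨⟨fun i a => algebraMap ℝ _ (W i a) - (geoA hg hF a0).ip (lA hg hF a0) (fun c => algebraMap ℝ _ (W i c)) * nA hg hF a0 a,
    fun a b => ?_⟩, fun i => ?_⟩
  · simp only [map_sub, map_mul, ev_ip, hal, hl, zero_mul, sub_zero]
    exact hW a b
  · have : (fun a => algebraMap ℝ (SO (Oa hg hF a0)) (W i a) - (geoA hg hF a0).ip (lA hg hF a0) (fun c => algebraMap ℝ _ (W i c)) * nA hg hF a0 a)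
      = (fun a => algebraMap ℝ (SO (Oa hg hF a0)) (W i a)) - (geoA hg hF a0).ip (lA hg hF a0) (fun c => algebraMap ℝ _ (W i c)) • nA hg hF a0 := rfl
    change (geoA hg hF a0).ip (lA hg hF a0) (fun a => algebraMap ℝ (SO (Oa hg hF a0)) (W i a) - (geoA hg hF a0).ip (lA hg hF a0) (fun c => algebraMap ℝ _ (W i c)) * nA hg hF a0 a) = 0
    rw [this, Geo.ip_sub_right, Geo.ip_smul_right, normA hg hF a0 h3, mul_one, sub_self]

def egA (h3 : IsVSIUpTo g F 3) : EGeo (m+1) (SO (Oa hg hF a0)) where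
  toGeo := geoA hg hF a0
  l := lA hg hF a0
  nn := nA hg hF a0
  null := nullA hg hF a0 h3
  norm := normA hg hF a0 h3
  Y := Oa hg hF a0
  ev := evO _
  inj := evO_inj
  fr := fun y => (frA hg hF a0 h3 y).choose
  hw := fun y => (frA hg hF a0 h3 y).choose_spec

lemma altA : Alt (resT (Oa hg hF a0) F hF.1) := by
  refine alt_of fun idx σ => Subtype.ext (funext fun y => ?_)
  have := hF.2 y idx σ
  change F y (idx ∘ σ) = _
  rw [this]
  rcases Int.units_eq_one_or (Equiv.Perm.sign σ) with h | h <;> rw [h] <;> simp <;> rfl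

lemma hTA (h3 : IsVSIUpTo g F 3) (x y : Vec (m+1) (SO (Oa hg hF a0))) :
    pr (geoA hg hF a0).gam (sl (resT (Oa hg hF a0) F hF.1) x) (sl (resT (Oa hg hF a0) F hF.1) y) =
      (geoA hg hF a0).ip (lA hg hF a0) x * (geoA hg hF a0).ip (lA hg hF a0) y := by
  have key : ∀ a b, pr (geoA hg hF a0).gam (sl (resT (Oa hg hF a0) F hF.1) (bs a)) (sl (resT (Oa hg hF a0) F hF.1) (bs b)) =
      kk hg hF a0 a * kk hg hF a0 b := by
    intro a b
    refine sub_eq_zero.1 (evO_inj _ fun z => ?_)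
    obtain ⟨κ, h1, h2⟩ := tt_rank hg hF h3 z
    rw [map_sub, map_mul, ev_pr, evT_sl, evT_sl, sub_eq_zero]
    change tt g F a b z = (kk hg hF a0 a).1 z * (kk hg hF a0 b).1 z
    rw [kk_rank hg hF a0 z h1, h1]
  rw [pr_sl, ip_lA, ip_lA, Finset.sum_mul_sum]
  refine Finset.sum_congr rfl fun a _ => Finset.sum_congr rfl fun b _ => ?_
  rw [key]; ring

lemma value_Oa (h3 : IsVSIUpTo g F 3) (y : Oa hg hF a0) (S : ConcomScheme (q+1) 0) (v) : S.value g F y v = 0 := by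
  have hc : ∀ (z : Oa hg hF a0) I idx, evO _ z (NGeo.covN (geoA hg hF a0) (resT (Oa hg hF a0) F hF.1) I idx) = covDIter g F I z idx := by
    intro z I idx
    have := congrFun (covN_res (O := Oa hg hF a0) hg F hF.1 I) idx
    rw [geoA, this]; rfl
  have hB := EGeo.main' (g := egA hg hF a0 h3) (altA hg hF a0) (hTA hg hF a0 h3) (fun z S hS v => by
    have h := h3 S hS (Subtype.val (p := fun x => x ∈ Oa hg hF a0) z) v
    unfold ConcomScheme.value at h
    rw [← h]
    refine Finset.sum_congr rfl fun φ _ => ?_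
    congr 1
    refine Finset.prod_congr rfl fun j _ => ?_
    exact hc z _ _)
  have h := EGeo.full_zero (g := egA hg hF a0 h3) y S _ hB v
  unfold ConcomScheme.value
  rw [← h]
  refine Finset.sum_congr rfl fun φ _ => ?_
  congr 1
  exact Finset.prod_congr rfl fun j _ => (hc y _ _).symm

end opens

theorem main_thm {n p : ℕ} (g : MetricField n) (hg : IsLorentzMetric g) (F : TensorField n p) (hF : IsFormField F)
    (h3 : IsVSIUpTo g F 3) : IsVSI g F := by
  intro I S _ x v
  cases p with
  | zero =>
    refine value_zero (W := Set.univ) isOpen_univ (fun x _ => ?_) S x trivial v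
    have hb : Con (fun a b => (g x)⁻¹ a b) (fun I => covDIter g F I x) (Fin 0) (F x) :=
      Con.base (D := fun I => covDIter g F I x) (I := 0) (by norm_num)
    have h := con_pr (γ := fun a b => (g x)⁻¹ a b) (D := fun I => covDIter g F I x) (fun S hS v => h3 S hS x v) hb hb
    funext idx
    have h' : F x ![] = 0 := mul_self_eq_zero.1 h
    rw [Subsingleton.elim idx ![], h']; rfl
  | succ q =>
    cases n with
    | zero =>
      exact value_zero (W := Set.univ) isOpen_univ (fun x _ => funext fun idx => (idx 0).elim0) S x trivial v
    | succ m =>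
      by_contra hne
      have hWo : IsOpen {z | S.value g F z v ≠ 0} := isOpen_ne_fun (value_cont hg hF.1 S v) continuous_const
      refine hne (value_zero hWo (fun z hz => ?_) S x hne v)
      obtain ⟨κ, h1, h2⟩ := tt_rank hg hF h3 z
      have h4 : ∀ a, κ a = 0 := by
        intro a
        by_contra ha
        refine hz (value_Oa hg hF a h3 ⟨z, ?_⟩ S v)
        change 0 < tt g F a a z
        rw [h1]
        exact mul_self_pos.2 ha
      obtain ⟨e⟩ := on_exists hg z
      refine e.zero_of (alt_of fun idx σ => by rw [hF.2]) fun a b => ?_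
      have := h1 a b
      rw [h4 a, zero_mul] at this
      exact this
end fin

/-- if a `p`-form field is VSI₃ then it is VSI (all scalar polynomial
invariants of arbitrary order vanish). -/
theorem vsi3_implies_vsi {n p : ℕ}
    (g : MetricField n) (hg : IsLorentzMetric g)
    (F : TensorField n p) (hF : IsFormField F)
    (h3 : IsVSIUpTo g F 3) : IsVSI g F := main_thm g hg F hF h3

end VSI
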